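/- Let (φ₁,ψ₁) and (φ₂,ψ₂) belong to H²(ℝ₊×ℝ)×H¹(ℝ₊×ℝ) and satisfy, for all x₃ ∈ ℝ: φ₁(0,x₃) = φ₂(0,x₃), ψ₁(0,x₃) = (∂φ₂/∂x₁)(0,x₃), and ψ₂(0,x₃) = (∂φ₁/∂x₂)(0,x₃). Then there exists ζ ∈ H^{5/2}(ℝ₊×ℝ₊×ℝ) such that (ζ, ∂ζ/∂x_i) = (φ_i, ψ_i) on the boundary face where x_i = 0, for i = 1, 2. -/

import Mathlib

open MeasureTheory Real Set
open scoped RealInnerProductSpace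
noncomputable section

abbrev E2 := EuclideanSpace ℝ (Fin 2)
def stdb2 (i : Fin 2) : E2 := EuclideanSpace.single i 1
def L2on {n : ℕ} (Ω : Set (EuclideanSpace ℝ (Fin n))) (u : EuclideanSpace ℝ (Fin n) → ℝ) : Prop :=
  MemLp u 2 (volume.restrict Ω)
def IsWeakD {n : ℕ} (Ω : Set (EuclideanSpace ℝ (Fin n)))
    (u v : EuclideanSpace ℝ (Fin n) → ℝ) (d : EuclideanSpace ℝ (Fin n)) : Prop :=
  ∀ φ : EuclideanSpace ℝ (Fin n) → ℝ, ContDiff ℝ (⊤ : ℕ∞) φ → HasCompactSupport φ → tsupport φ ⊆ Ω →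
    ∫ x in Ω, u x * fderiv ℝ φ x d = - ∫ x in Ω, v x * φ x
def tri (p : Fin 3 → E2) : Set E2 := interior (convexHull ℝ (range p))
def evec (p : Fin 3 → E2) (i : Fin 3) : E2 := p (i + 2) - p (i + 1)
def elen (p : Fin 3 → E2) (i : Fin 3) : ℝ := ‖evec p i‖
def tangv (p : Fin 3 → E2) (i : Fin 3) : E2 := (elen p i)⁻¹ • evec p i
def norv (p : Fin 3 → E2) (i : Fin 3) : E2 :=
  EuclideanSpace.single 0 (tangv p i 1) + EuclideanSpace.single 1 (-(tangv p i 0))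
def epar (p : Fin 3 → E2) (i : Fin 3) (t : ℝ) : E2 := p (i + 1) + t • evec p i
def ccw (p : Fin 3 → E2) : Prop :=
  0 < (p 1 - p 0) 0 * (p 2 - p 0) 1 - (p 1 - p 0) 1 * (p 2 - p 0) 0
def tau (i j : Fin 3) : ℝ := if i = j + 1 then 0 else 1

/-- weak derivative on an open interval of `ℝ` -/
def IsWeakD1 (S : Set ℝ) (u v : ℝ → ℝ) : Prop :=
  ∀ φ : ℝ → ℝ, ContDiff ℝ (⊤ : ℕ∞) φ → HasCompactSupport φ → tsupport φ ⊆ S →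
    ∫ t in S, u t * deriv φ t = - ∫ t in S, v t * φ t

def MemHedge : ℕ → (ℝ → ℝ) → Prop
  | 0, u => MemLp u 2 (volume.restrict (Ioo (0:ℝ) 1))
  | (k+1), u => MemLp u 2 (volume.restrict (Ioo (0:ℝ) 1)) ∧
      ∃ v, IsWeakD1 (Ioo (0:ℝ) 1) u v ∧ MemHedge k v

/-- membership of edgewise data in `H²(∂T) × H¹(∂T)` (with pointwise C¹/C⁰ representatives) -/
def MemBdryH2H1 (f g : Fin 3 → ℝ → ℝ) : Prop :=
  ∀ i, MemHedge 2 (f i) ∧ ContDiffOn ℝ 1 (f i) (Icc 0 1) ∧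
    MemHedge 1 (g i) ∧ ContinuousOn (g i) (Icc 0 1)

/-- compatibility conditions (2.2)-(2.4) -/
def Compat (p : Fin 3 → E2) (f g : Fin 3 → ℝ → ℝ) : Prop :=
  (∀ i j k : Fin 3, j ≠ i → k ≠ i → f j (tau i j) = f k (tau i k)) ∧
  ∃ w : Fin 3 → E2, ∀ i j : Fin 3, j ≠ i →
    derivWithin (f j) (Icc 0 1) (tau i j) = elen p j * ⟪w i, tangv p j⟫ ∧
    g j (tau i j) = ⟪w i, norv p j⟫

/-- `H²` membership with explicit weak gradient and Hessian data -/
def MemH2W {n : ℕ} (Ω : Set (EuclideanSpace ℝ (Fin n))) (ξ : EuclideanSpace ℝ (Fin n) → ℝ)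
    (G : Fin n → EuclideanSpace ℝ (Fin n) → ℝ)
    (Hs : Fin n → Fin n → EuclideanSpace ℝ (Fin n) → ℝ) : Prop :=
  L2on Ω ξ ∧ (∀ d, L2on Ω (G d) ∧ IsWeakD Ω ξ (G d) (EuclideanSpace.single d 1)) ∧
  ∀ d d', L2on Ω (Hs d d') ∧ IsWeakD Ω (G d) (Hs d d') (EuclideanSpace.single d' 1)

/-- Gagliardo-type `H^{1/2}` seminorm finiteness for functions on a domain in `ℝⁿ` -/
def GagH12 {n : ℕ} (Ω : Set (EuclideanSpace ℝ (Fin n))) (u : EuclideanSpace ℝ (Fin n) → ℝ) : Prop :=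
  Integrable (fun q : EuclideanSpace ℝ (Fin n) × EuclideanSpace ℝ (Fin n) =>
    (u q.1 - u q.2) ^ 2 / ‖q.1 - q.2‖ ^ (n + 1)) ((volume.restrict Ω).prod (volume.restrict Ω))

/-- membership in `H^{5/2}` of a domain: weak `H²` data whose second derivatives have finite
`H^{1/2}` Gagliardo seminorm. -/
def MemH52 {n : ℕ} (Ω : Set (EuclideanSpace ℝ (Fin n))) (ζ : EuclideanSpace ℝ (Fin n) → ℝ) : Prop :=
  ∃ G Hs, MemH2W Ω ζ G Hs ∧ ∀ d d', GagH12 Ω (Hs d d')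

/-- pointwise trace relation `Tr ζ = (f,g)` on `∂T` for a `C¹` function -/
def TraceEq (p : Fin 3 → E2) (ζ : E2 → ℝ) (f g : Fin 3 → ℝ → ℝ) : Prop :=
  ∀ i : Fin 3, ∀ t ∈ Icc (0:ℝ) 1,
    ζ (epar p i t) = f i t ∧ fderiv ℝ ζ (epar p i t) (norv p i) = g i t

abbrev E3 := EuclideanSpace ℝ (Fin 3)
def stdb3 (i : Fin 3) : E3 := EuclideanSpace.single i 1

/-- the open half-plane `ℝ₊ × ℝ` -/
def hplane : Set E2 := {y : E2 | 0 < y 0}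
/-- the open wedge `ℝ₊ × ℝ₊ × ℝ` -/
def wedge : Set E3 := {x : E3 | 0 < x 0 ∧ 0 < x 1}

/-- `b` is the trace of `u` on the boundary line `{y₀ = 0}` (parametrized by `y₁`)
of the half-plane, in the sense of the divergence theorem. -/
def HPTrace (u : E2 → ℝ) (Du : Fin 2 → E2 → ℝ) (b : ℝ → ℝ) : Prop :=
  ∀ φ : E2 → ℝ, ContDiff ℝ (⊤ : ℕ∞) φ → HasCompactSupport φ → ∀ d : Fin 2,
    ∫ x in hplane, (u x * fderiv ℝ φ x (stdb2 d) + Du d x * φ x)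
      = -(if d = 0 then ∫ t : ℝ, b t * φ (EuclideanSpace.single 1 t) else 0)

/-- the embedding of the half-plane onto the face `{x_i = 0}` (`i = 0, 1`) of the wedge -/
def embFace (i : Fin 3) (y : E2) : E3 :=
  (y 0) • stdb3 (i.succAbove 0) + (y 1) • stdb3 (i.succAbove 1)

/-- `b i` is the trace of `u` on the face `{x_i = 0}` (`i = 0, 1`) of the wedge,
in the sense of the divergence theorem. -/
def WedgeTrace (u : E3 → ℝ) (Du : Fin 3 → E3 → ℝ) (b : Fin 2 → E2 → ℝ) : Prop :=
  ∀ φ : E3 → ℝ, ContDiff ℝ (⊤ : ℕ∞) φ → HasCompactSupport φ → ∀ d : Fin 3,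
    ∫ x in wedge, (u x * fderiv ℝ φ x (stdb3 d) + Du d x * φ x)
      = -(if d = 0 then ∫ y in hplane, b 0 y * φ (embFace 0 y)
          else if d = 1 then ∫ y in hplane, b 1 y * φ (embFace 1 y) else 0)


set_option linter.unusedSimpArgs false
set_option linter.unusedVariables false

section
/-! ### Part 1 : averaging operators and their calculus -/

/-- cut-off extension by zero to the outside of the closed half-plane -/
def uz (u : E2 → ℝ) : E2 → ℝ := indicator {y : E2 | 0 ≤ y 0} u

/-- averaging operator -/
def AA (K u : E2 → ℝ) (y : E2) (n : ℝ) : ℝ := ∫ z, K z * uz u (y + n • z)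

def Kd (K : E2 → ℝ) (j : Fin 2) (z : E2) : ℝ := fderiv ℝ K z (stdb2 j)
def Kz (K : E2 → ℝ) (j : Fin 2) (z : E2) : ℝ := z j * K z

/-- `H¹` data on the half-plane, weak derivatives tested on `D` -/
structure H1 (D : Set E2) (u : E2 → ℝ) (v : Fin 2 → E2 → ℝ) : Prop where
  l2u : L2on hplane u
  l2v : ∀ j, L2on hplane (v j)
  wk : ∀ κ : E2 → ℝ, ContDiff ℝ (⊤ : ℕ∞) κ → HasCompactSupport κ → tsupport κ ⊆ D → ∀ j : Fin 2,
    ∫ x in hplane, (u x * fderiv ℝ κ x (stdb2 j) + v j x * κ x) = 0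

/-- admissible kernels -/
structure KC (D : Set E2) (K : E2 → ℝ) : Prop where
  smooth : ContDiff ℝ (⊤ : ℕ∞) K
  cpt : HasCompactSupport K
  sub : ∀ z ∈ tsupport K, ∀ y : E2, 0 ≤ y 0 → ∀ n : ℝ, 0 < n → y + n • z ∈ D

lemma Kd_smooth {K : E2 → ℝ} (h : ContDiff ℝ (⊤ : ℕ∞) K) (j : Fin 2) :
    ContDiff ℝ (⊤ : ℕ∞) (Kd K j) := by
  unfold Kd
  exact (h.fderiv_right (m := ((⊤ : ℕ∞) : WithTop ℕ∞)) (by simp)).clm_apply contDiff_const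

lemma Kz_smooth {K : E2 → ℝ} (h : ContDiff ℝ (⊤ : ℕ∞) K) (j : Fin 2) :
    ContDiff ℝ (⊤ : ℕ∞) (Kz K j) := by
  unfold Kz
  have : ContDiff ℝ (⊤ : ℕ∞) (fun z : E2 => z j) :=
    (EuclideanSpace.proj (𝕜 := ℝ) j).contDiff
  exact this.mul h

lemma Kd_tsupport (K : E2 → ℝ) (j : Fin 2) : tsupport (Kd K j) ⊆ tsupport K := 
  tsupport_fderiv_apply_subset ℝ (stdb2 j)

lemma Kz_tsupport (K : E2 → ℝ) (j : Fin 2) : tsupport (Kz K j) ⊆ tsupport K := 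
  tsupport_mul_subset_right

lemma KC.mono {D : Set E2} {K K' : E2 → ℝ} (h : KC D K) (h1 : ContDiff ℝ (⊤ : ℕ∞) K')
    (h2 : tsupport K' ⊆ tsupport K) : KC D K' :=
  ⟨h1, h.cpt.mono' (subset_tsupport K' |>.trans h2), fun z hz => h.sub z (h2 hz)⟩

lemma KC.d {D : Set E2} {K : E2 → ℝ} (h : KC D K) (j : Fin 2) : KC D (Kd K j) :=
  h.mono (Kd_smooth h.smooth j) (Kd_tsupport K j)

lemma KC.z {D : Set E2} {K : E2 → ℝ} (h : KC D K) (j : Fin 2) : KC D (Kz K j) :=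
  h.mono (Kz_smooth h.smooth j) (Kz_tsupport K j)

lemma measurableSet_hplane : MeasurableSet hplane :=
  measurableSet_lt measurable_const (EuclideanSpace.proj (𝕜 := ℝ) (0 : Fin 2)).continuous.measurable

lemma measurableSet_chp : MeasurableSet {y : E2 | 0 ≤ y 0} :=
  measurableSet_le measurable_const (EuclideanSpace.proj (𝕜 := ℝ) (0 : Fin 2)).continuous.measurable

lemma line_null : (volume : Measure E2) {y : E2 | y 0 = 0} = 0 := by
  have h : {y : E2 | y 0 = 0} = (LinearMap.ker (EuclideanSpace.proj (𝕜 := ℝ) (0 : Fin 2)).toLinearMap : Set E2) := by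
    ext y; simp
  rw [h]
  apply Measure.addHaar_submodule
  intro h
  have : (stdb2 0) ∈ (⊤ : Submodule ℝ E2) := trivial
  rw [← h] at this
  simp [stdb2] at this

lemma ae_ne_line : ∀ᵐ y : E2, y 0 ≠ 0 := by
  rw [ae_iff]; simpa using line_null

lemma uz_ae (u : E2 → ℝ) : uz u =ᵐ[volume] indicator hplane u := by
  filter_upwards [ae_ne_line] with y hy
  by_cases h : 0 < y 0
  · simp [uz, hplane, h, h.le]
  · have : ¬ (0 ≤ y 0) := fun h' => h (lt_of_le_of_ne h' (Ne.symm hy))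
    simp [uz, hplane, h, this]

lemma memLp_uz {u : E2 → ℝ} (h : L2on hplane u) : MemLp (uz u) 2 volume :=
  ((memLp_indicator_iff_restrict measurableSet_hplane).2 h).ae_eq (uz_ae u).symm

lemma integral_uz_mul (u f : E2 → ℝ) : ∫ x in hplane, u x * f x = ∫ x, uz u x * f x := by
  rw [← integral_indicator measurableSet_hplane]
  apply integral_congr_ae
  filter_upwards [uz_ae u] with x hx
  rw [hx]
  by_cases h : x ∈ hplane <;> simp [h]

lemma locInt_uz {u : E2 → ℝ} (h : L2on hplane u) : LocallyIntegrable (uz u) volume :=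
  (memLp_uz h).locallyIntegrable (by norm_num)

lemma integrable_mul_test {n : ℕ} {Ω : Set (EuclideanSpace ℝ (Fin n))} {u f : EuclideanSpace ℝ (Fin n) → ℝ} (h : L2on Ω u)
    (hf : Continuous f) (hc : HasCompactSupport f) : IntegrableOn (fun x => u x * f x) Ω := by
  have : MemLp f 2 (volume.restrict Ω) :=
    (hf.memLp_of_hasCompactSupport hc).restrict Ω
  exact MemLp.integrable_mul h this

/-- the rescaled kernel -/
def gk (K : E2 → ℝ) (n : ℝ) (x : E2) : ℝ := (n ^ 2)⁻¹ * K (-(n⁻¹ • x))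

lemma conv_scale {𝕜 : Type*} [RCLike 𝕜] (K : E2 → 𝕜) (f : E2 → 𝕜) (y : E2) {n : ℝ} (hn : 0 < n) :
    ∫ z, K z * f (y + n • z) = ∫ w, f w * (((n ^ 2)⁻¹ : ℝ) * K (-(n⁻¹ • (y - w)))) := by
  have h1 := Measure.integral_comp_smul_of_nonneg (volume : Measure E2)
    (fun x => f (x + y) * K (n⁻¹ • x)) n (hR := hn.le)
  simp only [smul_smul, inv_mul_cancel₀ hn.ne', one_smul] at h1
  have h2 : ∫ x, f (x + y) * K (n⁻¹ • x) = ∫ x, f x * K (n⁻¹ • (x - y)) := by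
    rw [← integral_add_right_eq_self (fun x => f x * K (n⁻¹ • (x - y))) y]
    simp
  rw [h2] at h1
  have : ∫ z, K z * f (y + n • z) = ∫ z, f (n • z + y) * K z := by
    congr 1; ext z; rw [mul_comm, add_comm]
  rw [this, h1]
  simp only [finrank_euclideanSpace, Fintype.card_fin]
  rw [← integral_smul]
  congr 1; ext w
  rw [← smul_neg, neg_sub, RCLike.real_smul_eq_coe_mul]; ring

lemma AA_conv (K u : E2 → ℝ) (y : E2) {n : ℝ} (hn : 0 < n) :
    AA K u y n = ∫ w, uz u w * gk K n (y - w) :=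
  conv_scale K (uz u) y hn

lemma gk_scaled_smooth {K : E2 → ℝ} (hK : ContDiff ℝ (⊤ : ℕ∞) K) (n : ℝ) (y : E2) :
    ContDiff ℝ (⊤ : ℕ∞) (fun w : E2 => K (n⁻¹ • (w - y))) :=
  hK.comp ((contDiff_id.sub contDiff_const).const_smul _)

def scaleHomeo (n : ℝ) (hn : n ≠ 0) (y : E2) : E2 ≃ₜ E2 :=
  (Homeomorph.subRight y).trans (Homeomorph.smulOfNeZero (n⁻¹) (inv_ne_zero hn))

lemma AA_ibp {D : Set E2} {K u : E2 → ℝ} {v : Fin 2 → E2 → ℝ} (hu : H1 D u v) (hK : KC D K)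
    {y : E2} (hy : 0 ≤ y 0) {n : ℝ} (hn : 0 < n) (j : Fin 2) :
    AA (Kd K j) u y n = - (n * AA K (v j) y n) := by
  set κ : E2 → ℝ := fun w => K (n⁻¹ • (w - y)) with hκ
  have hκs : ContDiff ℝ (⊤ : ℕ∞) κ := gk_scaled_smooth hK.smooth n y
  have hκe : κ = K ∘ (scaleHomeo n hn.ne' y) := by
    ext w; simp [κ, scaleHomeo]
  have hκc : HasCompactSupport κ := by
    rw [hκe]; exact hK.cpt.comp_homeomorph _
  have hκt : tsupport κ ⊆ D := by
    rw [hκe, tsupport_comp_eq_preimage]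
    intro w hw
    have := hK.sub _ hw y hy n hn
    simpa [scaleHomeo, smul_smul, hn.ne'] using this
  have hd : ∀ w, fderiv ℝ κ w (stdb2 j) = n⁻¹ * Kd K j (n⁻¹ • (w - y)) := by
    intro w
    have h1 : HasFDerivAt (fun w : E2 => n⁻¹ • (w - y)) (n⁻¹ • ContinuousLinearMap.id ℝ E2) w :=
      ((hasFDerivAt_id w).sub_const y).fun_const_smul n⁻¹
    have h2 := ((hK.smooth.differentiable (by simp)) (n⁻¹ • (w - y))).hasFDerivAt.comp w h1
    have h3 : fderiv ℝ κ w = _ := h2.fderiv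
    rw [h3]; simp [Kd]
  have hwk := hu.wk κ hκs hκc hκt j
  have hi1 : IntegrableOn (fun x => u x * fderiv ℝ κ x (stdb2 j)) hplane :=
    integrable_mul_test (f := Kd κ j) hu.l2u
      (by exact (Kd_smooth hκs j).continuous) (hκc.mono' ((subset_tsupport _).trans (Kd_tsupport κ j)))
  rw [integral_add hi1
    (integrable_mul_test (hu.l2v j) hκs.continuous hκc), integral_uz_mul, integral_uz_mul] at hwk
  rw [AA_conv _ _ _ hn, AA_conv _ _ _ hn]
  have e1 : ∫ w, uz u w * gk (Kd K j) n (y - w) = ((n ^ 2)⁻¹ * n) * ∫ w, uz u w * fderiv ℝ κ w (stdb2 j) := by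
    rw [← integral_const_mul]; congr 1; ext w
    rw [hd, gk, ← smul_neg, neg_sub]; field_simp
  have e2 : ∫ w, uz (v j) w * gk K n (y - w) = (n ^ 2)⁻¹ * ∫ w, uz (v j) w * κ w := by
    rw [← integral_const_mul]; congr 1; ext w
    rw [gk, ← smul_neg, neg_sub]; ring
  rw [e1, e2]
  have : ∫ w, uz u w * fderiv ℝ κ w (stdb2 j) = - ∫ w, uz (v j) w * κ w := by linarith
  rw [this]; ring

lemma gk_smoothOn {K : E2 → ℝ} (hK : ContDiff ℝ (⊤ : ℕ∞) K) :
    ContDiffOn ℝ (⊤ : ℕ∞) (Function.uncurry (gk K)) (Ioi (0:ℝ) ×ˢ (univ : Set E2)) := by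
  have h1 : ContDiffOn ℝ (⊤ : ℕ∞) (fun q : ℝ × E2 => (q.1)⁻¹) (Ioi (0:ℝ) ×ˢ (univ : Set E2)) :=
    contDiffOn_fst.inv (fun q hq => (show (0:ℝ) < q.1 from hq.1).ne')
  have h2 : ContDiffOn ℝ (⊤ : ℕ∞) (fun q : ℝ × E2 => (q.1 ^ 2)⁻¹) (Ioi (0:ℝ) ×ˢ (univ : Set E2)) :=
    (contDiffOn_fst.pow 2).inv (fun q hq => pow_ne_zero _ (show (0:ℝ) < q.1 from hq.1).ne')
  have h3 := hK.comp_contDiffOn (h1.smul contDiffOn_snd).neg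
  exact h2.mul h3

lemma gk_supp {K : E2 → ℝ} (hK : HasCompactSupport K) (b : ℝ) :
    ∃ k : Set E2, IsCompact k ∧ ∀ p x, p ∈ Ioo (0:ℝ) b → x ∉ k → gk K p x = 0 := by
  obtain ⟨R, hR⟩ := hK.isCompact.isBounded.subset_closedBall (0 : E2)
  refine ⟨Metric.closedBall 0 (b * R), isCompact_closedBall _ _, ?_⟩
  intro p x hp hx
  unfold gk
  rw [mul_eq_zero]; right
  apply image_eq_zero_of_notMem_tsupport
  intro h
  have h1 := hR h
  apply hx
  rw [mem_closedBall_zero_iff, norm_neg, norm_smul, norm_inv, Real.norm_of_nonneg hp.1.le] at h1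
  rw [mem_closedBall_zero_iff]
  have hp1 := hp.1
  have h2 : ‖x‖ ≤ p * R := by
    rw [inv_mul_le_iff₀ hp1] at h1; exact h1
  have hR0 : 0 ≤ R := le_trans (by positivity) h1
  exact h2.trans (mul_le_mul_of_nonneg_right hp.2.le hR0)

open scoped Convolution in
lemma AA_hasFDerivAt {K u : E2 → ℝ} (hu : L2on hplane u) (hK : ContDiff ℝ (⊤ : ℕ∞) K)
    (hKc : HasCompactSupport K) (q : ℝ × E2) (hq : 0 < q.1) :
    HasFDerivAt (fun q : ℝ × E2 => AA K u q.2 q.1)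
      ((uz u ⋆[(ContinuousLinearMap.mul ℝ ℝ).precompR (ℝ × E2), volume]
        fun x : E2 => fderiv ℝ (Function.uncurry (gk K)) (q.1, x)) q.2) q := by
  obtain ⟨k, hk, hks⟩ := gk_supp hKc (q.1 + 1)
  have := hasFDerivAt_convolution_right_with_param (μ := (volume : Measure E2))
    (ContinuousLinearMap.mul ℝ ℝ) (f := uz u) (g := gk K) (s := Ioo 0 (q.1 + 1)) isOpen_Ioo hk hks
    (locInt_uz hu) (((gk_smoothOn hK).mono (prod_mono (fun x hx => hx.1) le_rfl)).of_le (by norm_cast))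
    q ⟨hq, by linarith⟩
  refine this.congr_of_eventuallyEq ?_
  have : ∀ᶠ q' : ℝ × E2 in nhds q, 0 < q'.1 := continuous_fst.continuousAt.eventually (lt_mem_nhds hq)
  filter_upwards [this] with q' hq'
  rw [AA_conv K u q'.2 hq']; rfl

open scoped Convolution in
lemma AA_hasFDerivAt_apply {K u : E2 → ℝ} (hu : L2on hplane u) (hK : ContDiff ℝ (⊤ : ℕ∞) K)
    (hKc : HasCompactSupport K) (q : ℝ × E2) (hq : 0 < q.1) (m : ℝ × E2) :
    ((uz u ⋆[(ContinuousLinearMap.mul ℝ ℝ).precompR (ℝ × E2), volume]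
        fun x : E2 => fderiv ℝ (Function.uncurry (gk K)) (q.1, x)) q.2) m
      = ∫ w, uz u w * fderiv ℝ (Function.uncurry (gk K)) (q.1, q.2 - w) m := by
  obtain ⟨k, hk, hks⟩ := gk_supp hKc (q.1 + 1)
  have hc : Continuous (fun x : E2 => fderiv ℝ (Function.uncurry (gk K)) (q.1, x)) := by
    have h1 := (gk_smoothOn hK).continuousOn_fderiv_of_isOpen (isOpen_Ioi.prod isOpen_univ) (by simp)
    exact h1.comp_continuous (by fun_prop) (fun x => ⟨hq, trivial⟩)
  have hs : HasCompactSupport (fun x : E2 => fderiv ℝ (Function.uncurry (gk K)) (q.1, x)) := by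
    refine HasCompactSupport.intro hk ?_
    intro x hx
    apply (hasFDerivAt_zero_of_eventually_const (0 : ℝ) _).fderiv
    have e1 : ∀ᶠ p : ℝ × E2 in nhds (q.1, x), p.1 ∈ Ioo 0 (q.1 + 1) :=
      continuous_fst.continuousAt.eventually (isOpen_Ioo.mem_nhds ⟨hq, by simp⟩)
    have e2 : ∀ᶠ p : ℝ × E2 in nhds (q.1, x), p.2 ∈ kᶜ :=
      continuous_snd.continuousAt.eventually (hk.isClosed.isOpen_compl.mem_nhds hx)
    filter_upwards [e1, e2] with p h1 h2
    exact hks p.1 p.2 h1 h2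
  have hex : ConvolutionExists (uz u) (fun x : E2 => fderiv ℝ (Function.uncurry (gk K)) (q.1, x))
      ((ContinuousLinearMap.mul ℝ ℝ).precompR (ℝ × E2)) volume :=
    hs.convolutionExists_right _ (locInt_uz hu) hc
  have := ContinuousLinearMap.integral_apply (hex q.2) m
  exact this


lemma gk_fderiv {K : E2 → ℝ} (hK : ContDiff ℝ (⊤ : ℕ∞) K) {n : ℝ} (hn : 0 < n) (x : E2) (m : ℝ × E2) :
    fderiv ℝ (Function.uncurry (gk K)) (n, x) m =
      (-2 * (n ^ 3)⁻¹ * m.1) * K (-(n⁻¹ • x))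
        + (n ^ 2)⁻¹ * fderiv ℝ K (-(n⁻¹ • x)) (-(n⁻¹ • m.2) + (n ^ 2)⁻¹ • m.1 • x) := by
  have h1 : HasFDerivAt (fun q : ℝ × E2 => (q.1)⁻¹)
      ((-(n ^ 2)⁻¹) • ContinuousLinearMap.fst ℝ ℝ E2) (n, x) :=
    (hasDerivAt_inv hn.ne').comp_hasFDerivAt (n, x) (hasFDerivAt_fst (𝕜 := ℝ) (E := ℝ) (F := E2) (p := (n, x)))
  have h2 : HasFDerivAt (fun q : ℝ × E2 => -((q.1)⁻¹ • q.2)) _ (n, x) :=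
    (h1.smul (hasFDerivAt_snd (𝕜 := ℝ) (E := ℝ) (F := E2) (p := (n, x)))).neg
  have h3 := ((hK.differentiable (by simp)) (-(n⁻¹ • x))).hasFDerivAt.comp (n, x) h2
  have h4 := (h1.mul h1).mul h3
  have e : Function.uncurry (gk K) = fun q : ℝ × E2 => (q.1)⁻¹ * (q.1)⁻¹ * (K ∘ fun q : ℝ × E2 => -((q.1)⁻¹ • q.2)) q := by
    ext q; simp [Function.uncurry, gk, pow_two]
  rw [e]
  erw [h4.fderiv]
  simp only [add_apply, smul_apply, ContinuousLinearMap.coe_fst', ContinuousLinearMap.comp_apply,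
    neg_apply, ContinuousLinearMap.smulRight_apply, ContinuousLinearMap.coe_snd', smul_eq_mul, Function.comp, Pi.mul_apply]
  have e2 : -(n⁻¹ • m.2 + (-(n ^ 2)⁻¹ * m.1) • x) = -(n⁻¹ • m.2) + (n ^ 2)⁻¹ • m.1 • x := by
    rw [smul_smul]; module
  rw [e2]
  field_simp
  ring

lemma E2_eq (x : E2) : x = x 0 • stdb2 0 + x 1 • stdb2 1 := by
  ext i; fin_cases i <;> simp [stdb2]

lemma Kd_Kz {K : E2 → ℝ} (hK : ContDiff ℝ (⊤ : ℕ∞) K) (j : Fin 2) (z : E2) :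
    Kd (Kz K j) j z = K z + z j * Kd K j z := by
  unfold Kd Kz
  have h1 : HasFDerivAt (fun z : E2 => z j) (EuclideanSpace.proj (𝕜 := ℝ) j) z :=
    (EuclideanSpace.proj (𝕜 := ℝ) j).hasFDerivAt
  have h2 := h1.mul ((hK.differentiable (by simp)) z).hasFDerivAt
  erw [h2.fderiv]
  simp [stdb2]; ring

lemma AA_hasDeriv_y {D : Set E2} {K u : E2 → ℝ} {v : Fin 2 → E2 → ℝ} (hu : H1 D u v) (hK : KC D K)
    {y : E2} (hy : 0 ≤ y 0) {n : ℝ} (hn : 0 < n) (j : Fin 2) :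
    HasDerivAt (fun t : ℝ => AA K u (y + t • stdb2 j) n) (AA K (v j) y n) 0 := by
  have h := AA_hasFDerivAt hu.l2u hK.smooth hK.cpt (n, y) hn
  have h1 : HasDerivAt (fun t : ℝ => (n, y + t • stdb2 j)) ((0:ℝ), stdb2 j) 0 := by
    refine (hasDerivAt_const _ _).prodMk ?_
    simpa using ((hasDerivAt_id (0:ℝ)).smul_const (stdb2 j)).const_add y
  have h2 := HasFDerivAt.comp_hasDerivAt_of_eq (0:ℝ) (l := fun q : ℝ × E2 => AA K u q.2 q.1)
    (f := fun t : ℝ => (n, y + t • stdb2 j)) h h1 (by simp)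
  refine HasDerivAt.congr_deriv h2 ?_
  rw [AA_hasFDerivAt_apply hu.l2u hK.smooth hK.cpt (n, y) hn]
  symm
  have h3 := AA_ibp hu hK hy hn j
  have : AA K (v j) y n = -n⁻¹ * AA (Kd K j) u y n := by rw [h3]; field_simp
  rw [this, AA_conv _ _ _ hn, ← integral_const_mul]
  congr 1; ext w
  rw [gk_fderiv hK.smooth hn]
  simp only [gk, Kd, mul_zero, zero_mul, zero_smul, smul_zero, add_zero, map_neg, map_smul, smul_eq_mul, zero_add]
  ring

lemma AA_hasDeriv_n {D : Set E2} {K u : E2 → ℝ} {v : Fin 2 → E2 → ℝ} (hu : H1 D u v) (hK : KC D K)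
    {y : E2} (hy : 0 ≤ y 0) {n : ℝ} (hn : 0 < n) :
    HasDerivAt (fun t : ℝ => AA K u y t) (∑ j, AA (Kz K j) (v j) y n) n := by
  have h := AA_hasFDerivAt hu.l2u hK.smooth hK.cpt (n, y) hn
  have h1 : HasDerivAt (fun t : ℝ => (t, y)) ((1:ℝ), (0 : E2)) n :=
    (hasDerivAt_id n).prodMk (hasDerivAt_const _ _)
  have h2 := HasFDerivAt.comp_hasDerivAt n (l := fun q : ℝ × E2 => AA K u q.2 q.1)
    (f := fun t : ℝ => (t, y)) h h1
  refine HasDerivAt.congr_deriv h2 ?_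
  rw [AA_hasFDerivAt_apply hu.l2u hK.smooth hK.cpt (n, y) hn]
  symm
  have h3 : ∀ j, AA (Kz K j) (v j) y n = -n⁻¹ * AA (Kd (Kz K j) j) u y n := by
    intro j; rw [AA_ibp hu (hK.z j) hy hn j]; field_simp
  have hintg : ∀ j, Integrable (fun w => uz u w * gk (Kd (Kz K j) j) n (y - w)) := by
    intro j
    have hk := ((hK.z j).d j)
    refine MemLp.integrable_mul (q := 2) (memLp_uz hu.l2u) (Continuous.memLp_of_hasCompactSupport ?_ ?_)
    · unfold gk; have := hk.smooth.continuous; fun_prop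
    · obtain ⟨k, hkc, hks⟩ := gk_supp hk.cpt (n + 1)
      have : HasCompactSupport (gk (Kd (Kz K j) j) n) :=
        HasCompactSupport.intro hkc (fun x hx => hks n x ⟨hn, by simp⟩ hx)
      exact this.comp_homeomorph (Homeomorph.subLeft y)
  rw [Fin.sum_univ_two, h3, h3, AA_conv _ _ _ hn, AA_conv _ _ _ hn, ← mul_add,
    ← integral_add (hintg 0) (hintg 1), ← integral_const_mul]
  congr 1; ext w
  rw [gk_fderiv hK.smooth hn]
  simp only [gk, Kd_Kz hK.smooth, mul_zero, zero_mul, zero_smul, smul_zero, add_zero, map_neg, map_smul, smul_eq_mul, zero_add, mul_one, neg_zero, one_smul]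
  set x := y - w
  have e : fderiv ℝ K (-(n⁻¹ • x)) x = x 0 * Kd K 0 (-(n⁻¹ • x)) + x 1 * Kd K 1 (-(n⁻¹ • x)) := by
    conv_lhs => rw [E2_eq x]
    simp only [map_add, map_smul, smul_eq_mul, Kd]
    rw [← E2_eq x]
  rw [e]
  simp only [PiLp.neg_apply, PiLp.smul_apply, smul_eq_mul]
  field_simp
  ring

lemma AA_continuousAt {K u : E2 → ℝ} (hu : L2on hplane u) (hK : ContDiff ℝ (⊤ : ℕ∞) K)
    (hKc : HasCompactSupport K) (q : ℝ × E2) (hq : 0 < q.1) :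
    ContinuousAt (fun q : ℝ × E2 => AA K u q.2 q.1) q :=
  (AA_hasFDerivAt hu hK hKc q hq).continuousAt

end

section
/-! ### Part 2 : coordinates -/

/-- coordinates of `ℝ³` adapted to the face `d` -/
def ins (d : Fin 3) (p : ℝ × E2) : E3 := embFace d p.2 + p.1 • stdb3 d
/-- tangential coordinates -/
def py (d : Fin 3) (x : E3) : E2 := !₂[x (d.succAbove 0), x (d.succAbove 1)]

lemma py_apply (d : Fin 3) (x : E3) (j : Fin 2) : py d x j = x (d.succAbove j) := by
  fin_cases j <;> simp [py]

lemma embFace_same (d : Fin 3) (y : E2) : embFace d y d = 0 := by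
  simp [embFace, stdb3, Fin.ne_succAbove]

lemma embFace_succAbove (d : Fin 3) (y : E2) (j : Fin 2) : embFace d y (d.succAbove j) = y j := by
  fin_cases j <;> simp [embFace, stdb3, Fin.succAbove_right_inj]

lemma ins_same (d : Fin 3) (p : ℝ × E2) : ins d p d = p.1 := by
  simp [ins, embFace_same, stdb3]

lemma ins_succAbove (d : Fin 3) (p : ℝ × E2) (j : Fin 2) : ins d p (d.succAbove j) = p.2 j := by
  simp [ins, embFace_succAbove, stdb3, Fin.succAbove_ne]

lemma py_ins (d : Fin 3) (p : ℝ × E2) : py d (ins d p) = p.2 := by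
  ext j; rw [py_apply, ins_succAbove]

lemma ins_py (d : Fin 3) (x : E3) : ins d (x d, py d x) = x := by
  ext k
  rcases Fin.eq_self_or_eq_succAbove d k with rfl | ⟨j, rfl⟩
  · rw [ins_same]
  · rw [ins_succAbove, py_apply]

lemma ins_zero (d : Fin 3) (y : E2) : ins d (0, y) = embFace d y := by simp [ins]

lemma py_embFace (d : Fin 3) (y : E2) : py d (embFace d y) = y := by
  rw [← ins_zero, py_ins]

lemma continuous_py (d : Fin 3) : Continuous (py d) := by
  unfold py
  fun_prop

lemma continuous_embFace (d : Fin 3) : Continuous (embFace d) := by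
  unfold embFace; fun_prop

lemma continuous_ins (d : Fin 3) : Continuous (ins d) := by
  unfold ins embFace; fun_prop

def insH (d : Fin 3) : ℝ × E2 ≃ₜ E3 where
  toFun := ins d
  invFun x := (x d, py d x)
  left_inv p := by simp [py_ins, ins_same]
  right_inv x := ins_py d x
  continuous_toFun := continuous_ins d
  continuous_invFun := by
    have := continuous_py d
    fun_prop

lemma ins_mp (d : Fin 3) : MeasurePreserving (ins d) volume volume := by
  have h1 := (volume_preserving_piFinSuccAbove (fun _ : Fin 3 => ℝ) d).symm
  have h2 := (MeasurePreserving.id (volume : Measure ℝ)).prod (PiLp.volume_preserving_ofLp (Fin 2))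
  have h3 := ((PiLp.volume_preserving_toLp (Fin 3)).comp h1).comp h2
  suffices e : ins d = (WithLp.toLp 2 ∘ ⇑(MeasurableEquiv.piFinSuccAbove (fun _ : Fin 3 => ℝ) d).symm) ∘ Prod.map id WithLp.ofLp by
    rw [e]; exact h3
  funext p
  ext k
  rcases Fin.eq_self_or_eq_succAbove d k with rfl | ⟨j, rfl⟩
  · rw [ins_same]; simp [MeasurableEquiv.piFinSuccAbove, Fin.insertNthEquiv]
  · rw [ins_succAbove]; simp [MeasurableEquiv.piFinSuccAbove, Fin.insertNthEquiv]

lemma ins_emb (d : Fin 3) : MeasurableEmbedding (ins d) := (insH d).measurableEmbedding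

lemma norm_ins_sq (d : Fin 3) (p : ℝ × E2) : ‖ins d p‖ ^ 2 = p.1 ^ 2 + ‖p.2‖ ^ 2 := by
  rw [EuclideanSpace.norm_sq_eq, EuclideanSpace.norm_sq_eq, Fin.sum_univ_succAbove _ d]
  simp [ins_same, ins_succAbove]

lemma ins_add (d : Fin 3) (p q : ℝ × E2) : ins d (p + q) = ins d p + ins d q := by
  ext k
  rcases Fin.eq_self_or_eq_succAbove d k with rfl | ⟨j, rfl⟩
  · simp [ins_same]
  · simp [ins_succAbove]

lemma ins_sub (d : Fin 3) (p q : ℝ × E2) : ins d (p - q) = ins d p - ins d q := by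
  ext k
  rcases Fin.eq_self_or_eq_succAbove d k with rfl | ⟨j, rfl⟩
  · simp [ins_same]
  · simp [ins_succAbove]

lemma measurableSet_wedge : MeasurableSet wedge := by
  have h : ∀ j : Fin 3, Measurable (fun x : E3 => x j) := fun j =>
    (EuclideanSpace.proj (𝕜 := ℝ) j).continuous.measurable
  exact (measurableSet_lt measurable_const (h 0)).inter (measurableSet_lt measurable_const (h 1))

lemma isOpen_wedge : IsOpen wedge := by
  have h : ∀ j : Fin 3, Continuous (fun x : E3 => x j) := fun j =>
    (EuclideanSpace.proj (𝕜 := ℝ) j).continuous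
  exact (isOpen_lt continuous_const (h 0)).inter (isOpen_lt continuous_const (h 1))

lemma isOpen_hplane : IsOpen hplane :=
  isOpen_lt continuous_const (EuclideanSpace.proj (𝕜 := ℝ) (0 : Fin 2)).continuous

/-- the base faces -/
lemma ins_pre_wedge (i : Fin 2) : ins i.castSucc ⁻¹' wedge = Ioi (0:ℝ) ×ˢ hplane := by
  ext p
  have h1 := ins_same i.castSucc p
  have h2 := ins_succAbove i.castSucc p 0
  fin_cases i <;> simp [wedge, hplane] at h1 h2 ⊢ <;> rw [h1, h2]
  exact and_comm

/-- `ℝ² ≅ ℝ × ℝ` -/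
def in2 (p : ℝ × ℝ) : E2 := !₂[p.1, p.2]

lemma in2_zero (p : ℝ × ℝ) : in2 p 0 = p.1 := by simp [in2]
lemma in2_one (p : ℝ × ℝ) : in2 p 1 = p.2 := by simp [in2]

def in2H : ℝ × ℝ ≃ₜ E2 where
  toFun := in2
  invFun x := (x 0, x 1)
  left_inv p := by simp [in2]
  right_inv x := by ext i; fin_cases i <;> simp [in2]
  continuous_toFun := by unfold in2; fun_prop
  continuous_invFun := by fun_prop

lemma in2_mp : MeasurePreserving in2 volume volume := by
  have h1 := (volume_preserving_finTwoArrow ℝ).symm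
  have h3 := ((PiLp.volume_preserving_toLp (Fin 2)).comp h1)
  exact h3

lemma in2_emb : MeasurableEmbedding in2 := in2H.measurableEmbedding

lemma in2_pre_hplane : in2 ⁻¹' hplane = Ioi (0:ℝ) ×ˢ univ := by
  ext p; simp [hplane, in2]

lemma in2_eq (x : E2) : in2 (x 0, x 1) = x := by
  ext i; fin_cases i <;> simp [in2]

lemma single_eq_in2 (t : ℝ) : (EuclideanSpace.single 1 t : E2) = in2 (0, t) := by
  ext i; fin_cases i <;> simp [in2]

end

section
/-! ### Part 3 : `L²` bounds -/

/-- lifted terms -/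
def TT (i : Fin 3) (a : ℝ → ℝ) (K u : E2 → ℝ) (x : E3) : ℝ := a (x i) * AA K u (py i x) (x i)

open scoped ENNReal

lemma cs_weight {α : Type*} [MeasurableSpace α] {μ : Measure α} {k f : α → ℝ≥0∞} (hk : AEMeasurable k μ)
    (hf : AEMeasurable f μ) : (∫⁻ x, k x * f x ∂μ) ^ 2 ≤ (∫⁻ x, k x ∂μ) * ∫⁻ x, k x * f x ^ 2 ∂μ := by
  have h := ENNReal.lintegral_mul_le_Lp_mul_Lq μ (p := 2) (q := 2) (by constructor <;> norm_num)
    (f := fun x => k x ^ (1/2 : ℝ)) (g := fun x => k x ^ (1/2 : ℝ) * f x)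
    (hk.pow_const _) ((hk.pow_const _).mul hf)
  have hh : ∀ t : ℝ≥0∞, t ^ (1/2 : ℝ) * t ^ (1/2 : ℝ) = t := fun t => by
    rw [← ENNReal.rpow_add_of_nonneg _ _ (by norm_num) (by norm_num)]; norm_num
  have e1 : ∀ x, ((fun x => k x ^ (1/2 : ℝ)) * fun x => k x ^ (1/2 : ℝ) * f x) x = k x * f x := by
    intro x; simp only [Pi.mul_apply]; rw [← mul_assoc, hh]
  have e2 : ∀ x, (k x ^ (1/2 : ℝ)) ^ (2:ℝ) = k x := by
    intro x; rw [← ENNReal.rpow_mul]; norm_num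
  have e3 : ∀ x, (k x ^ (1/2 : ℝ) * f x) ^ (2:ℝ) = k x * f x ^ 2 := by
    intro x; rw [ENNReal.mul_rpow_of_nonneg _ _ (by norm_num), e2]; norm_num
  simp only [e1, e2, e3] at h
  calc (∫⁻ x, k x * f x ∂μ) ^ 2 ≤ ((∫⁻ x, k x ∂μ) ^ (1/2 : ℝ) * (∫⁻ x, k x * f x ^ 2 ∂μ) ^ (1/2 : ℝ)) ^ 2 := by gcongr
    _ = _ := by rw [mul_pow, pow_two, pow_two, hh, hh]

lemma AA_rep {u : E2 → ℝ} (hu : L2on hplane u) : ∃ f : E2 → ℝ, Measurable f ∧ MemLp f 2 ∧ f =ᵐ[volume] uz u ∧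
    ∀ (K : E2 → ℝ) (y : E2) (n : ℝ), 0 < n → AA K u y n = ∫ z, K z * f (y + n • z) := by
  have h := memLp_uz hu
  refine ⟨h.1.mk _, h.1.stronglyMeasurable_mk.measurable, h.ae_eq h.1.ae_eq_mk, h.1.ae_eq_mk.symm, ?_⟩
  intro K y n hn
  rw [conv_scale K _ y hn, AA_conv _ _ _ hn]
  apply integral_congr_ae
  filter_upwards [h.1.ae_eq_mk] with w hw
  rw [← hw]; rfl

lemma AA_slice {K f : E2 → ℝ} (hK : Continuous K) (hf : Measurable f) (n : ℝ) :
    ∫⁻ y, ‖∫ z, K z * f (y + n • z)‖ₑ ^ 2 ≤ (∫⁻ z, ‖K z‖ₑ) ^ 2 * ∫⁻ w, ‖f w‖ₑ ^ 2 := by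
  have hKm : Measurable K := hK.measurable
  calc ∫⁻ y, ‖∫ z, K z * f (y + n • z)‖ₑ ^ 2
      ≤ ∫⁻ y, (∫⁻ z, ‖K z‖ₑ) * ∫⁻ z, ‖K z‖ₑ * ‖f (y + n • z)‖ₑ ^ 2 := by
        apply lintegral_mono; intro y
        refine le_trans ?_ (cs_weight (by fun_prop) (by fun_prop))
        refine pow_le_pow_left' ?_ 2
        refine (enorm_integral_le_lintegral_enorm _).trans (le_of_eq ?_)
        simp [enorm_mul]
    _ = (∫⁻ z, ‖K z‖ₑ) * ∫⁻ y, ∫⁻ z, ‖K z‖ₑ * ‖f (y + n • z)‖ₑ ^ 2 := by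
        rw [lintegral_const_mul]
        exact Measurable.lintegral_prod_right' (f := fun p : E2 × E2 => ‖K p.2‖ₑ * ‖f (p.1 + n • p.2)‖ₑ ^ 2) (by fun_prop)
    _ = (∫⁻ z, ‖K z‖ₑ) * ∫⁻ z, ∫⁻ y, ‖K z‖ₑ * ‖f (y + n • z)‖ₑ ^ 2 := by
        rw [lintegral_lintegral_swap]
        exact (by fun_prop : Measurable (fun p : E2 × E2 => ‖K p.2‖ₑ * ‖f (p.1 + n • p.2)‖ₑ ^ 2)).aemeasurable
    _ = (∫⁻ z, ‖K z‖ₑ) * ∫⁻ z, ‖K z‖ₑ * ∫⁻ w, ‖f w‖ₑ ^ 2 := by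
        congr 1; apply lintegral_congr; intro z
        rw [lintegral_const_mul _ (by fun_prop)]
        rw [lintegral_add_right_eq_self (fun w => ‖f w‖ₑ ^ 2)]
    _ = _ := by
        rw [lintegral_mul_const _ (by fun_prop)]; ring

lemma memLp2_iff {α : Type*} [MeasurableSpace α] {μ : Measure α} {f : α → ℝ} :
    MemLp f 2 μ ↔ AEStronglyMeasurable f μ ∧ ∫⁻ x, ‖f x‖ₑ ^ 2 ∂μ < ∞ := by
  unfold MemLp
  rw [eLpNorm_lt_top_iff_lintegral_rpow_enorm_lt_top (by norm_num) (by norm_num)]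
  simp

lemma TT_continuousOn (i : Fin 3) {a : ℝ → ℝ} (ha : Continuous a) {K u : E2 → ℝ} (hu : L2on hplane u) (hK : ContDiff ℝ (⊤ : ℕ∞) K)
    (hKc : HasCompactSupport K) : ContinuousOn (TT i a K u) {x | 0 < x i} := by
  intro x hx
  apply ContinuousAt.continuousWithinAt
  have h1 : ContinuousAt (fun x : E3 => ((x i, py i x) : ℝ × E2)) x := by
    have := continuous_py i
    fun_prop
  have h2 := ContinuousAt.comp (g := fun q : ℝ × E2 => AA K u q.2 q.1) (f := fun x : E3 => ((x i, py i x) : ℝ × E2)) (x := x)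
    (AA_continuousAt hu hK hKc (x i, py i x) hx) h1
  have h3 : ContinuousAt (fun x : E3 => a (x i)) x := by fun_prop
  exact h3.mul h2

lemma isOpen_W (i : Fin 3) : IsOpen {x : E3 | 0 < x i} :=
  isOpen_lt continuous_const (EuclideanSpace.proj (𝕜 := ℝ) i).continuous

lemma TT_L2W (i : Fin 3) {a : ℝ → ℝ} (ha : Continuous a) (hac : HasCompactSupport a) {K u : E2 → ℝ} (hu : L2on hplane u)
    (hK : ContDiff ℝ (⊤ : ℕ∞) K) (hKc : HasCompactSupport K) : L2on {x | 0 < x i} (TT i a K u) := by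
  refine memLp2_iff.2 ⟨(TT_continuousOn i ha hu hK hKc).aestronglyMeasurable (isOpen_W i).measurableSet, ?_⟩
  obtain ⟨f, hfm, hf2, -, hf⟩ := AA_rep hu
  rw [← (ins_mp i).setLIntegral_comp_preimage_emb (ins_emb i)]
  have e : ins i ⁻¹' {x | 0 < x i} = Ioi (0:ℝ) ×ˢ univ := by ext p; simp [ins_same]
  rw [e, show (volume : Measure (ℝ × E2)) = (volume : Measure ℝ).prod volume from rfl, ← Measure.prod_restrict, Measure.restrict_univ]
  have hfin : (∫⁻ z, ‖K z‖ₑ) ^ 2 * ∫⁻ w, ‖f w‖ₑ ^ 2 < ∞ := by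
    refine ENNReal.mul_lt_top (ENNReal.pow_lt_top ?_) (memLp2_iff.1 hf2).2
    exact (hK.continuous.integrable_of_hasCompactSupport hKc).2
  have ha2 : ∫⁻ n, ‖a n‖ₑ ^ 2 < ∞ := (memLp2_iff.1 (ha.memLp_of_hasCompactSupport hac)).2
  calc _ ≤ ∫⁻ n in Ioi (0:ℝ), ∫⁻ y, ‖TT i a K u (ins i (n, y))‖ₑ ^ 2 := lintegral_prod_le _
    _ ≤ ∫⁻ n in Ioi (0:ℝ), ‖a n‖ₑ ^ 2 * ((∫⁻ z, ‖K z‖ₑ) ^ 2 * ∫⁻ w, ‖f w‖ₑ ^ 2) := by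
        apply setLIntegral_mono' measurableSet_Ioi
        intro n hn
        refine le_trans ?_ (mul_le_mul_right (AA_slice hK.continuous hfm n) _)
        rw [← lintegral_const_mul]
        · apply lintegral_mono; intro y
          simp only [TT, ins_same, py_ins, enorm_mul, mul_pow]
          rw [hf K y n hn]
        · have h : StronglyMeasurable (fun y => ∫ z, K z * f (y + n • z)) := by
            apply StronglyMeasurable.integral_prod_right' (f := fun p : E2 × E2 => K p.2 * f (p.1 + n • p.2))
            have := hK.continuous.measurable
            exact Measurable.stronglyMeasurable (by fun_prop)
          exact h.measurable.enorm.pow_const 2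
    _ = (∫⁻ n in Ioi (0:ℝ), ‖a n‖ₑ ^ 2) * ((∫⁻ z, ‖K z‖ₑ) ^ 2 * ∫⁻ w, ‖f w‖ₑ ^ 2) := by
        rw [lintegral_mul_const]; fun_prop
    _ < ∞ := ENNReal.mul_lt_top (lt_of_le_of_lt (setLIntegral_le_lintegral _ _) ha2) hfin

lemma wedge_sub_W (i : Fin 2) : wedge ⊆ {x | 0 < x i.castSucc} := by
  intro x hx
  fin_cases i
  · exact hx.1
  · exact hx.2

lemma TT_L2 (i : Fin 2) {a : ℝ → ℝ} (ha : Continuous a) (hac : HasCompactSupport a) {K u : E2 → ℝ} (hu : L2on hplane u)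
    (hK : ContDiff ℝ (⊤ : ℕ∞) K) (hKc : HasCompactSupport K) : L2on wedge (TT i.castSucc a K u) :=
  (TT_L2W i.castSucc ha hac hu hK hKc).mono_measure (Measure.restrict_mono (wedge_sub_W i) le_rfl)

end

section
/-! ### Part 4 : the Gagliardo bound -/

open scoped ENNReal FourierTransform SchwartzMap

lemma lint_sq {f : E2 → ℂ} (hf : Integrable (fun x => ‖f x‖ ^ 2)) :
    ∫⁻ x, ‖f x‖ₑ ^ 2 = ENNReal.ofReal (∫ x, ‖f x‖ ^ 2) := by
  rw [ofReal_integral_eq_lintegral_ofReal hf (Filter.Eventually.of_forall fun x => by positivity)]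
  congr 1; ext x
  rw [ENNReal.ofReal_pow (norm_nonneg _), ofReal_norm]

lemma schwartz_sq_int (f : 𝓢(E2, ℂ)) : Integrable (fun x => ‖f x‖ ^ 2) := by
  have := (f.memLp 2 volume).integrable_norm_pow (by norm_num)
  simpa using this

lemma schwartz_planch (f : 𝓢(E2, ℂ)) : ∫⁻ x, ‖f x‖ₑ ^ 2 = ∫⁻ x, ‖(𝓕 f) x‖ₑ ^ 2 := by
  rw [lint_sq (schwartz_sq_int f), lint_sq (schwartz_sq_int (𝓕 f)), SchwartzMap.integral_norm_sq_fourier]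

/-- complexification of a test function -/
def cS (g : E2 → ℝ) (hg : ContDiff ℝ (⊤ : ℕ∞) g) (hc : HasCompactSupport g) : 𝓢(E2, ℂ) :=
  HasCompactSupport.toSchwartzMap (f := fun x => (g x : ℂ)) (hc.comp_left (g := fun t : ℝ => (t : ℂ)) Complex.ofReal_zero)
    (Complex.ofRealCLM.contDiff.comp hg)

lemma cS_apply (g : E2 → ℝ) (hg : ContDiff ℝ (⊤ : ℕ∞) g) (hc : HasCompactSupport g) (x : E2) :
    cS g hg hc x = (g x : ℂ) := rfl

lemma planch_conv (g k : E2 → ℝ) (hg : ContDiff ℝ (⊤ : ℕ∞) g) (hgc : HasCompactSupport g)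
    (hk : ContDiff ℝ (⊤ : ℕ∞) k) (hkc : HasCompactSupport k) :
    ∫⁻ y, ‖∫ w, g w * k (y - w)‖ₑ ^ 2 = ∫⁻ ξ, ‖𝓕 (cS g hg hgc) ξ‖ₑ ^ 2 * ‖𝓕 (fun x => (k x : ℂ)) ξ‖ₑ ^ 2 := by
  set F := SchwartzMap.convolution (ContinuousLinearMap.mul ℂ ℂ) (cS g hg hgc) (cS k hk hkc) with hF
  have h1 : ∀ y, F y = ((∫ w, g w * k (y - w) : ℝ) : ℂ) := by
    intro y
    rw [hF, SchwartzMap.convolution_apply, MeasureTheory.convolution_def]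
    simp only [ContinuousLinearMap.mul_apply', cS_apply]
    rw [← integral_complex_ofReal]; simp
  have h2 := schwartz_planch F
  simp only [h1] at h2
  have h3 : ∀ t : ℝ, ‖(t : ℂ)‖ₑ = ‖t‖ₑ := fun t => by
    rw [← ofReal_norm, ← ofReal_norm, Complex.norm_real]
  simp only [h3] at h2
  rw [h2]
  congr 1; ext ξ
  rw [hF, SchwartzMap.fourier_convolution]
  simp only [SchwartzMap.pairing_apply_apply, ContinuousLinearMap.mul_apply', enorm_mul, mul_pow]
  rfl

lemma planch_g (g : E2 → ℝ) (hg : ContDiff ℝ (⊤ : ℕ∞) g) (hgc : HasCompactSupport g) :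
    ∫⁻ ξ, ‖𝓕 (cS g hg hgc) ξ‖ₑ ^ 2 = ∫⁻ x, ‖g x‖ₑ ^ 2 := by
  have h2 := schwartz_planch (cS g hg hgc)
  rw [← h2]
  congr 1; ext x
  rw [cS_apply, ← ofReal_norm, ← ofReal_norm, Complex.norm_real]

/-- the multiplier -/
def mK (K : E2 → ℝ) (η : E2) : ℂ := 𝓕 (fun x => (K x : ℂ)) (-η)

lemma fourier_gk (K : E2 → ℝ) {n : ℝ} (hn : 0 < n) (h ξ : E2) :
    𝓕 (fun x => (gk K n (x + h) : ℂ)) ξ = (𝐞 (inner ℝ h ξ) : ℂ) * mK K (n • ξ) := by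
  unfold mK
  rw [Real.fourier_eq, Real.fourier_eq]
  have e1 := integral_add_right_eq_self (μ := (volume : Measure E2)) (fun v => 𝐞 (-inner ℝ (v - h) ξ) • (gk K n v : ℂ)) h
  simp only [add_sub_cancel_right] at e1
  rw [e1, ← integral_neg_eq_self]
  have e2 := conv_scale (fun z => (K z : ℂ)) (fun x => (𝐞 (inner ℝ (x + h) ξ) : ℂ)) 0 hn
  have e3 : ∫ (x : E2), 𝐞 (-inner ℝ (-x - h) ξ) • (gk K n (-x) : ℂ) = 
      ∫ (w : E2), (𝐞 (inner ℝ (w + h) ξ) : ℂ) * (((n ^ 2)⁻¹ : ℝ) * (K (-(n⁻¹ • (0 - w))) : ℂ)) := by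
    congr 1; ext x
    rw [Circle.smul_def, smul_eq_mul, gk]
    rw [show -x - h = -(x + h) by abel, inner_neg_left, neg_neg]; push_cast; simp
  erw [e3, ← e2, ← integral_const_mul]
  congr 1; ext z
  rw [Circle.smul_def, smul_eq_mul, inner_neg_right, neg_neg, inner_smul_right, zero_add, inner_add_left, inner_smul_left]
  rw [AddChar.map_add_eq_mul]; push_cast; simp; ring

lemma mK_bound {K : E2 → ℝ} (hK : ContDiff ℝ (⊤ : ℕ∞) K) (hc : HasCompactSupport K) :
    ∃ C : ℝ, 0 < C ∧ ContDiff ℝ 1 (mK K) ∧ (∀ η, (1 + ‖η‖) * ‖mK K η‖ ≤ C) ∧ ∀ η, (1 + ‖η‖) * ‖fderiv ℝ (mK K) η‖ ≤ C := by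
  set f := 𝓕 (cS K hK hc) with hf
  have e : mK K = fun η => f (-η) := by
    ext η; rfl
  have hd : ∀ η, ‖fderiv ℝ (mK K) η‖ = ‖fderiv ℝ f (-η)‖ := by
    intro η
    have h1 : HasFDerivAt (fun x : E2 => -x) (-ContinuousLinearMap.id ℝ E2) η := (hasFDerivAt_id η).fun_neg
    have h2 := (f.differentiableAt (x := -η)).hasFDerivAt.comp η h1
    have h3 : fderiv ℝ (mK K) η = fderiv ℝ (⇑f) (-η) ∘SL (-ContinuousLinearMap.id ℝ E2) := by rw [e]; exact h2.fderiv
    rw [h3, ContinuousLinearMap.comp_neg, norm_neg, ContinuousLinearMap.comp_id]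
  obtain ⟨C0, h0, hC0⟩ := f.decay 0 0
  obtain ⟨C1, h1, hC1⟩ := f.decay 1 0
  obtain ⟨C2, h2, hC2⟩ := f.decay 0 1
  obtain ⟨C3, h3, hC3⟩ := f.decay 1 1
  simp only [norm_iteratedFDeriv_zero, norm_iteratedFDeriv_one, pow_zero, pow_one, one_mul] at hC0 hC1 hC2 hC3
  refine ⟨C0 + C1 + C2 + C3, by positivity, ?_, ?_, ?_⟩
  · rw [e]; exact ((f.smooth 1).comp contDiff_neg)
  · intro η
    have a1 := hC0 (-η); have a2 := hC1 (-η)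
    rw [norm_neg] at a2
    rw [e]; simp only; rw [add_mul, one_mul]; linarith
  · intro η
    have a1 := hC2 (-η); have a2 := hC3 (-η)
    rw [norm_neg] at a2
    rw [hd, add_mul, one_mul]; linarith

/-- abbreviation for the time-dependent multiplier -/
def MM (a : ℝ → ℝ) (K : E2 → ℝ) (ξ : E2) (n : ℝ) : ℂ := (a n : ℂ) * mK K (n • ξ)

lemma MM_bound {a : ℝ → ℝ} (ha : ContDiff ℝ (⊤ : ℕ∞) a) (hac : HasCompactSupport a)
    {K : E2 → ℝ} (hK : ContDiff ℝ (⊤ : ℕ∞) K) (hc : HasCompactSupport K) :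
    ∃ C : ℝ, 0 < C ∧ (∀ ξ : E2, ∀ n : ℝ, 0 ≤ n → ‖MM a K ξ n‖ ≤ C / (1 + n * (1 + ‖ξ‖))) ∧
      (∀ ξ : E2, ∀ n n' : ℝ, 0 ≤ n → n ≤ n' →
        ‖MM a K ξ n' - MM a K ξ n‖ ≤ C * (1 + ‖ξ‖) / (1 + n * (1 + ‖ξ‖)) * (n' - n)) := by
  obtain ⟨C, hC, hm, hm1, hm2⟩ := mK_bound hK hc
  obtain ⟨R, hR⟩ := hac.isCompact.isBounded.subset_closedBall (0 : ℝ)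
  obtain ⟨A0, hA0⟩ := ha.continuous.bounded_above_of_compact_support hac
  have had : Continuous (deriv a) := ha.continuous_deriv (by simp)
  obtain ⟨A1, hA1⟩ := had.bounded_above_of_compact_support hac.deriv
  set A := |A0| + |A1| + 1
  set R' := |R| 
  have hA : 0 < A := by positivity
  have hA0' : ∀ x, ‖a x‖ ≤ A := fun x => (hA0 x).trans (by have := le_abs_self A0; have := abs_nonneg A1; simp only [A]; linarith)
  have hA1' : ∀ x, ‖deriv a x‖ ≤ A := fun x => (hA1 x).trans (by have := le_abs_self A1; have := abs_nonneg A0; simp only [A]; linarith)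
  have hR' : 0 ≤ R' := abs_nonneg R
  have hz : ∀ x, R' < x → a x = 0 ∧ deriv a x = 0 := by
    intro x hx
    have hn : x ∉ tsupport a := fun h => by
      have := hR h
      rw [mem_closedBall_zero_iff] at this
      have h1 := le_abs_self R
      have h2 := le_abs_self x
      rw [Real.norm_eq_abs] at this
      simp only [R'] at hx; linarith
    exact ⟨image_eq_zero_of_notMem_tsupport hn, by
      have := fun h => hn (tsupport_deriv_subset h)
      exact image_eq_zero_of_notMem_tsupport this⟩
  -- basic comparison
  have hcmp : ∀ ξ : E2, ∀ n, 0 ≤ n → n ≤ R' → 1 + n * (1 + ‖ξ‖) ≤ (1 + R') * (1 + ‖n • ξ‖) := by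
    intro ξ n h0 h1
    rw [norm_smul, Real.norm_of_nonneg h0]
    have : 0 ≤ n * ‖ξ‖ := by positivity
    nlinarith
  have hder : ∀ ξ : E2, ∀ n, HasDerivAt (MM a K ξ) (((deriv a n : ℝ) : ℂ) * mK K (n • ξ) + a n * fderiv ℝ (mK K) (n • ξ) ξ) n := by
    intro ξ n
    have h1 : HasDerivAt (fun n => (a n : ℂ)) ((deriv a n : ℝ) : ℂ) n :=
      ((ha.differentiable (by simp)) n).hasDerivAt.ofReal_comp
    have h2 : HasDerivAt (fun n : ℝ => n • ξ) ξ n := by simpa using (hasDerivAt_id n).smul_const ξ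
    have h3 := ((hm.differentiable (by simp)) (n • ξ)).hasFDerivAt.comp_hasDerivAt n h2
    exact h1.mul h3
  refine ⟨2 * (1 + R') * A * C, by positivity, ?_, ?_⟩
  · intro ξ n hn
    have hp : 0 < 1 + n * (1 + ‖ξ‖) := by positivity
    rw [le_div_iff₀ hp, MM, norm_mul, Complex.norm_real]
    by_cases h : n ≤ R'
    · have h1 := hm1 (n • ξ)
      have h2 := hcmp ξ n hn h
      have h3 := hA0' n
      calc ‖a n‖ * ‖mK K (n • ξ)‖ * (1 + n * (1 + ‖ξ‖)) ≤ A * ‖mK K (n • ξ)‖ * ((1 + R') * (1 + ‖n • ξ‖)) := by gcongr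
        _ = (1 + R') * A * ((1 + ‖n • ξ‖) * ‖mK K (n • ξ)‖) := by ring
        _ ≤ (1 + R') * A * C := by gcongr
        _ ≤ 2 * (1 + R') * A * C := by have : 0 ≤ (1 + R') * A * C := by positivity
                                       linarith
    · rw [(hz n (not_le.1 h)).1]; simp; positivity
  · intro ξ n n' hn hnn
    have hp : 0 < 1 + n * (1 + ‖ξ‖) := by positivity
    have key : ∀ x ∈ Icc n n', ‖((deriv a x : ℝ) : ℂ) * mK K (x • ξ) + a x * fderiv ℝ (mK K) (x • ξ) ξ‖ ≤
        2 * (1 + R') * A * C * (1 + ‖ξ‖) / (1 + n * (1 + ‖ξ‖)) := by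
      intro x hx
      have hx0 : 0 ≤ x := hn.trans hx.1
      have hp' : 0 < 1 + x * (1 + ‖ξ‖) := by positivity
      have : 1 + n * (1 + ‖ξ‖) ≤ 1 + x * (1 + ‖ξ‖) := by have := hx.1; gcongr
      refine le_trans ?_ (div_le_div_of_nonneg_left (by positivity) hp this)
      rw [le_div_iff₀ hp']
      by_cases h : x ≤ R'
      · have h1 := hm1 (x • ξ)
        have h1' := hm2 (x • ξ)
        have h2 := hcmp ξ x hx0 h
        have h3 := hA0' x
        have h3' := hA1' x
        have h4 : ‖fderiv ℝ (mK K) (x • ξ) ξ‖ ≤ ‖fderiv ℝ (mK K) (x • ξ)‖ * ‖ξ‖ := ContinuousLinearMap.le_opNorm _ _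
        calc _ ≤ (‖deriv a x‖ * ‖mK K (x • ξ)‖ + ‖a x‖ * (‖fderiv ℝ (mK K) (x • ξ)‖ * ‖ξ‖)) * (1 + x * (1 + ‖ξ‖)) := by
                gcongr
                refine (norm_add_le _ _).trans ?_
                rw [norm_mul, norm_mul, Complex.norm_real, Complex.norm_real]
                gcongr
          _ ≤ (A * ‖mK K (x • ξ)‖ + A * (‖fderiv ℝ (mK K) (x • ξ)‖ * ‖ξ‖)) * ((1 + R') * (1 + ‖x • ξ‖)) := by gcongr
          _ = (1 + R') * A * (((1 + ‖x • ξ‖) * ‖mK K (x • ξ)‖) + ((1 + ‖x • ξ‖) * ‖fderiv ℝ (mK K) (x • ξ)‖) * ‖ξ‖) := by ring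
          _ ≤ (1 + R') * A * (C + C * ‖ξ‖) := by gcongr
          _ ≤ 2 * (1 + R') * A * C * (1 + ‖ξ‖) := by
              have : 0 ≤ (1 + R') * A * C * (1 + ‖ξ‖) := by positivity
              nlinarith
      · rw [(hz x (not_le.1 h)).1, (hz x (not_le.1 h)).2]; simp; positivity
    have := (convex_Icc n n').norm_image_sub_le_of_norm_hasDerivWithin_le (f := MM a K ξ)
      (fun x _ => (hder ξ x).hasDerivWithinAt) key (left_mem_Icc.2 hnn) (right_mem_Icc.2 hnn)
    rwa [Real.norm_of_nonneg (sub_nonneg.2 hnn)] at this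

lemma char_sub_one (t : ℝ) : ‖(𝐞 t : ℂ) - 1‖ ≤ 2 * π * |t| := by
  rw [Real.fourierChar_apply]
  have := Real.norm_exp_I_mul_ofReal_sub_one_le (x := 2 * π * t)
  rw [mul_comm]
  refine this.trans (le_of_eq ?_)
  rw [Real.norm_eq_abs, abs_mul, abs_of_pos (by positivity)]

lemma MM_key {a : ℝ → ℝ} (ha : ContDiff ℝ (⊤ : ℕ∞) a) (hac : HasCompactSupport a)
    {K : E2 → ℝ} (hK : ContDiff ℝ (⊤ : ℕ∞) K) (hc : HasCompactSupport K) :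
    ∃ C : ℝ, 0 < C ∧ ∀ ξ h : E2, ∀ n n' : ℝ, 0 < n → 0 < n' →
      ‖(𝐞 (inner ℝ h ξ) : ℂ) * MM a K ξ n' - MM a K ξ n‖ ^ 2 ≤
        C * min 1 ((1 + ‖ξ‖) ^ 2 * ((n' - n) ^ 2 + ‖h‖ ^ 2)) *
          (((1 + n * (1 + ‖ξ‖)) ^ 2)⁻¹ + ((1 + n' * (1 + ‖ξ‖)) ^ 2)⁻¹) := by
  obtain ⟨C, hC, h1, h2⟩ := MM_bound ha hac hK hc
  refine ⟨128 * C ^ 2, by positivity, ?_⟩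
  intro ξ h n n' hn hn'
  set N := 1 + ‖ξ‖ with hN
  have hN1 : 1 ≤ N := by simp [hN]
  set q := (1 + min n n' * N)⁻¹ with hq
  have hmin : 0 < min n n' := lt_min hn hn'
  have hq0 : 0 < q := by positivity
  have hq2 : q ^ 2 ≤ ((1 + n * N) ^ 2)⁻¹ + ((1 + n' * N) ^ 2)⁻¹ := by
    rw [hq, inv_pow]
    rcases min_choice n n' with h | h <;> rw [h]
    · have : 0 ≤ ((1 + n' * N) ^ 2)⁻¹ := by positivity
      linarith
    · have : 0 ≤ ((1 + n * N) ^ 2)⁻¹ := by positivity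
      linarith
  have hMn : ‖MM a K ξ n‖ ≤ C * q := by
    refine (h1 ξ n hn.le).trans ?_
    rw [div_eq_mul_inv]
    have : (1 + n * N)⁻¹ ≤ q := by rw [hq]; gcongr; exact min_le_left _ _
    gcongr
  have hMn' : ‖MM a K ξ n'‖ ≤ C * q := by
    refine (h1 ξ n' hn'.le).trans ?_
    rw [div_eq_mul_inv]
    have : (1 + n' * N)⁻¹ ≤ q := by rw [hq]; gcongr; exact min_le_right _ _
    gcongr
  have hd : ‖MM a K ξ n' - MM a K ξ n‖ ≤ C * N * q * |n' - n| := by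
    rcases le_total n n' with hh | hh
    · rw [hq, min_eq_left hh, abs_of_nonneg (sub_nonneg.2 hh), ← div_eq_mul_inv]
      exact h2 ξ n n' hn.le hh
    · rw [hq, min_eq_right hh, norm_sub_rev, abs_sub_comm, abs_of_nonneg (sub_nonneg.2 hh), ← div_eq_mul_inv]
      exact h2 ξ n' n hn'.le hh
  set e : ℂ := (𝐞 (inner ℝ h ξ) : ℂ) with he
  have hen : ‖e‖ = 1 := Circle.norm_coe _
  have he1 : ‖e - 1‖ ≤ 8 * (N * ‖h‖) := by
    refine (char_sub_one _).trans ?_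
    have h3 : |inner ℝ h ξ| ≤ ‖h‖ * ‖ξ‖ := abs_real_inner_le_norm h ξ
    have h4 : ‖h‖ * ‖ξ‖ ≤ N * ‖h‖ := by rw [mul_comm]; gcongr; simp [hN]
    have := Real.pi_le_four
    have hpi := Real.pi_pos
    calc 2 * π * |inner ℝ h ξ| ≤ 2 * 4 * (N * ‖h‖) := by gcongr; exact h3.trans h4
      _ = _ := by ring
  set X := ‖e * MM a K ξ n' - MM a K ξ n‖ with hX
  have hX0 : 0 ≤ X := norm_nonneg _
  have b1 : X ≤ 2 * (C * q) := by
    refine (norm_sub_le _ _).trans ?_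
    rw [norm_mul, hen, one_mul]; linarith
  have b2 : X ≤ 8 * (C * q) * (N * (‖h‖ + |n' - n|)) := by
    have : e * MM a K ξ n' - MM a K ξ n = (e - 1) * MM a K ξ n' + (MM a K ξ n' - MM a K ξ n) := by ring
    rw [hX, this]
    refine (norm_add_le _ _).trans ?_
    rw [norm_mul]
    have : ‖e - 1‖ * ‖MM a K ξ n'‖ ≤ 8 * (N * ‖h‖) * (C * q) := by gcongr
    have h5 : 0 ≤ C * N * q * |n' - n| := by positivity
    nlinarith
  have hf1 : X ^ 2 ≤ 128 * C ^ 2 * 1 * q ^ 2 := by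
    calc X ^ 2 ≤ (2 * (C * q)) ^ 2 := by gcongr
      _ ≤ _ := by nlinarith [sq_nonneg (C * q)]
  have hf2 : X ^ 2 ≤ 128 * C ^ 2 * (N ^ 2 * ((n' - n) ^ 2 + ‖h‖ ^ 2)) * q ^ 2 := by
    calc X ^ 2 ≤ (8 * (C * q) * (N * (‖h‖ + |n' - n|))) ^ 2 := by gcongr
      _ = 64 * C ^ 2 * N ^ 2 * q ^ 2 * (‖h‖ + |n' - n|) ^ 2 := by ring
      _ ≤ 64 * C ^ 2 * N ^ 2 * q ^ 2 * (2 * (‖h‖ ^ 2 + |n' - n| ^ 2)) := by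
          gcongr
          nlinarith [sq_nonneg (‖h‖ - |n' - n|)]
      _ = _ := by rw [sq_abs]; ring
  have hf3 : X ^ 2 ≤ 128 * C ^ 2 * min 1 (N ^ 2 * ((n' - n) ^ 2 + ‖h‖ ^ 2)) * q ^ 2 := by
    rcases min_choice 1 (N ^ 2 * ((n' - n) ^ 2 + ‖h‖ ^ 2)) with hh | hh <;> rw [hh]
    · exact hf1
    · exact hf2
  exact hf3.trans (by gcongr)

end

section
open scoped ENNReal FourierTransform SchwartzMap

lemma gk_smooth {K : E2 → ℝ} (hK : ContDiff ℝ (⊤ : ℕ∞) K) (n : ℝ) (h : E2) :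
    ContDiff ℝ (⊤ : ℕ∞) (fun x => gk K n (x + h)) := by
  unfold gk
  exact contDiff_const.mul (hK.comp ((contDiff_id.add contDiff_const).const_smul _).neg)

lemma gk_cpt {K : E2 → ℝ} (hK : HasCompactSupport K) {n : ℝ} (hn : 0 < n) (h : E2) :
    HasCompactSupport (fun x => gk K n (x + h)) := by
  obtain ⟨k, hkc, hks⟩ := gk_supp hK (n + 1)
  have : HasCompactSupport (gk K n) :=
    HasCompactSupport.intro hkc (fun x hx => hks n x ⟨hn, by simp⟩ hx)
  exact this.comp_homeomorph (Homeomorph.addRight h)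

/-- unbundled lifted term -/
def VV (a : ℝ → ℝ) (K g : E2 → ℝ) (n : ℝ) (y : E2) : ℝ := a n * ∫ z, K z * g (y + n • z)

lemma VV_slice {a : ℝ → ℝ} {K : E2 → ℝ} (hK : ContDiff ℝ (⊤ : ℕ∞) K) (hc : HasCompactSupport K)
    {g : E2 → ℝ} (hg : ContDiff ℝ (⊤ : ℕ∞) g) (hgc : HasCompactSupport g) (h : E2) {n n' : ℝ} (hn : 0 < n) (hn' : 0 < n') :
    ∫⁻ y, ‖VV a K g n' (y + h) - VV a K g n y‖ₑ ^ 2 = ∫⁻ ξ, ‖𝓕 (cS g hg hgc) ξ‖ₑ ^ 2 *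
      ‖(𝐞 (inner ℝ h ξ) : ℂ) * MM a K ξ n' - MM a K ξ n‖ₑ ^ 2 := by
  set k1 : E2 → ℝ := fun x => gk K n' (x + h) with hk1
  set k2 : E2 → ℝ := fun x => gk K n (x + 0) with hk2
  have s1 : ContDiff ℝ (⊤ : ℕ∞) k1 := gk_smooth hK n' h
  have s2 : ContDiff ℝ (⊤ : ℕ∞) k2 := gk_smooth hK n 0
  have c1 : HasCompactSupport k1 := gk_cpt hc hn' h
  have c2 : HasCompactSupport k2 := gk_cpt hc hn 0
  set k : E2 → ℝ := fun x => a n' * k1 x - a n * k2 x with hk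
  have s : ContDiff ℝ (⊤ : ℕ∞) k := (contDiff_const.mul s1).sub (contDiff_const.mul s2)
  have cc : HasCompactSupport k := (c1.mul_left).sub (c2.mul_left)
  have e1 : ∀ y, VV a K g n' (y + h) - VV a K g n y = ∫ w, g w * k (y - w) := by
    intro y
    have i1 : ∀ {q : E2 → ℝ}, ContDiff ℝ (⊤ : ℕ∞) q → HasCompactSupport q → Integrable (fun w => g w * q (y - w)) := by
      intro q hq hqc
      refine Continuous.integrable_of_hasCompactSupport ?_ hgc.mul_right
      have := hq.continuous; have := hg.continuous; fun_prop
    unfold VV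
    rw [conv_scale K g _ hn, conv_scale K g _ hn', ← integral_const_mul, ← integral_const_mul, ← integral_sub]
    · congr 1; ext w; simp only [hk, hk1, hk2, gk, add_zero, show y + h - w = y - w + h by abel]; simp; ring
    · refine (((i1 s1 c1).const_mul (a n'))).congr (Filter.Eventually.of_forall fun w => ?_)
      simp only [hk1, gk, show y + h - w = y - w + h by abel]; simp
    · refine (((i1 s2 c2).const_mul (a n))).congr (Filter.Eventually.of_forall fun w => ?_)
      simp only [hk2, gk, add_zero]; simp
  simp only [e1]
  rw [planch_conv g k hg hgc s cc]
  congr 1; ext ξ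
  congr 3
  have e2 : cS k s cc = (a n' : ℂ) • cS k1 s1 c1 + (-(a n : ℂ)) • cS k2 s2 c2 := by
    ext x; simp [cS_apply, hk]; ring
  have e3 : 𝓕 (fun x => (k x : ℂ)) ξ = 𝓕 (cS k s cc) ξ := rfl
  have e4 : 𝓕 (cS k1 s1 c1) ξ = (𝐞 (inner ℝ h ξ) : ℂ) * mK K (n' • ξ) := fourier_gk K hn' h ξ
  have e5 : 𝓕 (cS k2 s2 c2) ξ = (𝐞 (inner ℝ (0 : E2) ξ) : ℂ) * mK K (n • ξ) := fourier_gk K hn 0 ξ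
  rw [e3, e2, FourierTransform.fourier_add, FourierTransform.fourier_smul, FourierTransform.fourier_smul,
    SchwartzMap.add_apply, SchwartzMap.smul_apply, SchwartzMap.smul_apply, e4, e5]
  simp [MM]; ring

lemma J1_int {N : ℝ} (hN : 0 < N) :
    ∫⁻ n in Ioi (0:ℝ), ENNReal.ofReal (((1 + n * N) ^ 2)⁻¹) = ENNReal.ofReal N⁻¹ := by
  have hd : ∀ x ∈ Ici (0:ℝ), HasDerivAt (fun n : ℝ => -(N⁻¹ * (1 + n * N)⁻¹)) (((1 + x * N) ^ 2)⁻¹) x := by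
    intro x hx
    have hx' : (0:ℝ) ≤ x := hx
    have hp : 1 + x * N ≠ 0 := by positivity
    have h1 : HasDerivAt (fun n : ℝ => 1 + n * N) N x := by simpa using ((hasDerivAt_id x).mul_const N).const_add 1
    have h2 := ((h1.inv hp).const_mul N⁻¹).neg
    refine h2.congr_deriv ?_
    field_simp
  have hpos : ∀ x ∈ Ioi (0:ℝ), 0 ≤ ((1 + x * N) ^ 2)⁻¹ := fun x _ => by positivity
  have ht : Filter.Tendsto (fun n : ℝ => -(N⁻¹ * (1 + n * N)⁻¹)) Filter.atTop (nhds 0) := by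
    have : Filter.Tendsto (fun n : ℝ => 1 + n * N) Filter.atTop Filter.atTop :=
      Filter.tendsto_atTop_add_const_left _ _ (Filter.tendsto_id.atTop_mul_const hN)
    have := (this.inv_tendsto_atTop.const_mul N⁻¹).neg
    simpa using this
  rw [← ofReal_integral_eq_lintegral_ofReal (integrableOn_Ioi_deriv_of_nonneg' hd hpos ht)]
  · rw [integral_Ioi_of_hasDerivAt_of_nonneg' hd hpos ht]; simp
  · exact Filter.Eventually.of_forall fun x => by positivity

def ph (w : E3) : ℝ := min 1 (‖w‖ ^ 2) / ‖w‖ ^ 4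

lemma ph_int : Integrable ph := by
  have := (integrable_fun_norm_addHaar (volume : Measure E3) (f := fun r : ℝ => min 1 (r ^ 2) / r ^ 4)).2 ?_
  · exact this
  · have h1 : IntegrableOn (fun r : ℝ => 2 * (1 + r ^ 2)⁻¹) (Ioi 0) := (integrable_inv_one_add_sq.const_mul 2).integrableOn
    refine h1.mono' ?_ ?_
    · apply Measurable.aestronglyMeasurable; fun_prop
    · refine (ae_restrict_iff' measurableSet_Ioi).2 (Filter.Eventually.of_forall fun r hr => ?_)
      have hr : 0 < r := hr
      simp only [finrank_euclideanSpace, Fintype.card_fin, smul_eq_mul, Nat.add_one_sub_one]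
      rw [Real.norm_of_nonneg (by positivity)]
      have : r ^ (3 - 1) * (min 1 (r ^ 2) / r ^ 4) = min 1 (r ^ 2) / r ^ 2 := by
        norm_num; field_simp
      rw [this, ← div_eq_mul_inv, div_le_div_iff₀ (by positivity) (by positivity)]
      rcases min_cases 1 (r ^ 2) with ⟨h, h'⟩ | ⟨h, h'⟩ <;> rw [h] <;> nlinarith [sq_nonneg r]

lemma J2_int {N : ℝ} (hN : 0 < N) :
    ∫⁻ w : E3, ENNReal.ofReal (min 1 (N ^ 2 * ‖w‖ ^ 2) / ‖w‖ ^ 4) = ENNReal.ofReal N * ∫⁻ w, ENNReal.ofReal (ph w) := by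
  have hm : Measurable (fun w : E3 => ENNReal.ofReal (ph w)) := by unfold ph; fun_prop
  have h1 : ∀ w : E3, ENNReal.ofReal (min 1 (N ^ 2 * ‖w‖ ^ 2) / ‖w‖ ^ 4) = ENNReal.ofReal (N ^ 4) * ENNReal.ofReal (ph (N • w)) := by
    intro w
    rw [← ENNReal.ofReal_mul (by positivity)]
    congr 1
    rw [ph, norm_smul, Real.norm_of_nonneg hN.le, mul_pow, mul_pow]
    field_simp
  simp only [h1]
  rw [lintegral_const_mul]
  · have h2 : ∫⁻ w : E3, ENNReal.ofReal (ph (N • w)) = ∫⁻ w, ENNReal.ofReal (ph w) ∂(Measure.map (fun w : E3 => N • w) volume) := by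
      rw [lintegral_map hm (by fun_prop)]
    rw [h2]
    have := Measure.map_addHaar_smul (volume : Measure E3) hN.ne'
    simp only [finrank_euclideanSpace, Fintype.card_fin] at this
    erw [this]
    rw [lintegral_smul_measure, smul_eq_mul, ← mul_assoc, ← ENNReal.ofReal_mul (by positivity)]
    congr 2
    rw [abs_of_pos (by positivity)]; field_simp
  · unfold ph; fun_prop

end

section
open scoped ENNReal FourierTransform SchwartzMap

lemma VV_meas {a : ℝ → ℝ} (ha : Continuous a) {K f : E2 → ℝ} (hK : Continuous K) (hf : Measurable f) :
    Measurable (fun p : ℝ × E2 => VV a K f p.1 p.2) := by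
  unfold VV
  have h : StronglyMeasurable (fun p : ℝ × E2 => ∫ z, K z * f (p.2 + p.1 • z)) := by
    apply StronglyMeasurable.integral_prod_right' (f := fun q : (ℝ × E2) × E2 => K q.2 * f (q.1.2 + q.1.1 • q.2))
    have := hK.measurable
    exact Measurable.stronglyMeasurable (by fun_prop)
  have := h.measurable
  have := ha.measurable
  fun_prop

/-- indicator of positive reals -/
def ip (n : ℝ) : ℝ≥0∞ := (Ioi (0:ℝ)).indicator (fun _ => 1) n

lemma ip_meas : Measurable ip := measurable_const.indicator measurableSet_Ioi

lemma Gag_w {a : ℝ → ℝ} (ha : ContDiff ℝ (⊤ : ℕ∞) a) (hac : HasCompactSupport a)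
    {K : E2 → ℝ} (hK : ContDiff ℝ (⊤ : ℕ∞) K) (hc : HasCompactSupport K) : ∃ C : ℝ, 0 < C ∧
    ∀ {g : E2 → ℝ} (hg : ContDiff ℝ (⊤ : ℕ∞) g) (hgc : HasCompactSupport g) (δ : ℝ) (h : E2),
    ∫⁻ n, ∫⁻ y, ip n * ip (n + δ) * ‖VV a K g (n + δ) (y + h) - VV a K g n y‖ₑ ^ 2 ≤
     ∫⁻ ξ, ‖𝓕 (cS g hg hgc) ξ‖ₑ ^ 2 * ENNReal.ofReal (C * min 1 ((1 + ‖ξ‖) ^ 2 * (δ ^ 2 + ‖h‖ ^ 2)) * (2 * (1 + ‖ξ‖)⁻¹)) := by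
  obtain ⟨C, hC, hk⟩ := MM_key ha hac hK hc
  refine ⟨C, hC, ?_⟩
  intro g hg hgc δ h
  have hip := ip_meas
  set F : E2 → ℝ≥0∞ := fun ξ => ‖𝓕 (cS g hg hgc) ξ‖ₑ ^ 2 with hF
  have hFm : Measurable F := by
    have : Continuous (fun ξ => 𝓕 (cS g hg hgc) ξ) := (𝓕 (cS g hg hgc)).continuous
    have := this.measurable
    fun_prop
  have s1 : ∀ n, ∫⁻ y, ip n * ip (n + δ) * ‖VV a K g (n + δ) (y + h) - VV a K g n y‖ₑ ^ 2 ≤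
      ∫⁻ ξ, F ξ * (ENNReal.ofReal (C * min 1 ((1 + ‖ξ‖) ^ 2 * (δ ^ 2 + ‖h‖ ^ 2))) *
        (ip n * ENNReal.ofReal (((1 + n * (1 + ‖ξ‖)) ^ 2)⁻¹) + ip (n + δ) * ENNReal.ofReal (((1 + (n + δ) * (1 + ‖ξ‖)) ^ 2)⁻¹))) := by
    intro n
    by_cases h1 : 0 < n
    swap
    · simp [ip, h1]
    by_cases h2 : 0 < n + δ
    swap
    · simp [ip, h2]
    simp only [ip, mem_Ioi, h1, h2, indicator_of_mem, one_mul]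
    rw [VV_slice hK hc hg hgc h h1 h2]
    apply lintegral_mono; intro ξ
    refine mul_le_mul' le_rfl ?_
    have := hk ξ h n (n + δ) h1 h2
    rw [← ENNReal.ofReal_add (by positivity) (by positivity), ← ENNReal.ofReal_mul (by positivity), ← ofReal_norm, ← ENNReal.ofReal_pow (by positivity)]
    apply ENNReal.ofReal_le_ofReal
    refine this.trans (le_of_eq ?_)
    simp
  refine (lintegral_mono s1).trans ?_
  rw [lintegral_lintegral_swap]
  swap
  · apply Measurable.aemeasurable
    dsimp only [Function.uncurry_def]
    fun_prop
  apply lintegral_mono; intro ξ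
  have hN : 0 < 1 + ‖ξ‖ := by positivity
  dsimp only
  rw [lintegral_const_mul _ (by fun_prop), lintegral_const_mul _ (by fun_prop)]
  refine mul_le_mul' le_rfl ?_
  rw [ENNReal.ofReal_mul (p := C * min 1 ((1 + ‖ξ‖) ^ 2 * (δ ^ 2 + ‖h‖ ^ 2))) (by positivity)]
  refine mul_le_mul' le_rfl ?_
  rw [lintegral_add_left (by fun_prop)]
  have t1 : ∫⁻ n, ip n * ENNReal.ofReal (((1 + n * (1 + ‖ξ‖)) ^ 2)⁻¹) = ENNReal.ofReal (1 + ‖ξ‖)⁻¹ := by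
    rw [← J1_int hN, ← lintegral_indicator measurableSet_Ioi]
    congr 1; ext n
    by_cases hn : 0 < n <;> simp [ip, hn]
  rw [lintegral_add_right_eq_self (fun n => ip n * ENNReal.ofReal (((1 + n * (1 + ‖ξ‖)) ^ 2)⁻¹)), t1, ← ENNReal.ofReal_add (by positivity) (by positivity)]
  exact le_of_eq (by congr 1; ring)

/-- weighted double integral -/
def GG (i : Fin 3) (V : E3 → ℝ) : ℝ≥0∞ :=
  ∫⁻ x, ∫⁻ x', ip (x i) * ip (x' i) * ‖V x' - V x‖ₑ ^ 2 * ENNReal.ofReal (1 / ‖x' - x‖ ^ 4)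

lemma Gag_smooth (i : Fin 3) {a : ℝ → ℝ} (ha : ContDiff ℝ (⊤ : ℕ∞) a) (hac : HasCompactSupport a)
    {K : E2 → ℝ} (hK : ContDiff ℝ (⊤ : ℕ∞) K) (hc : HasCompactSupport K) : ∃ C : ℝ≥0∞, C ≠ ∞ ∧
    ∀ {g : E2 → ℝ} (hg : ContDiff ℝ (⊤ : ℕ∞) g) (hgc : HasCompactSupport g),
    GG i (fun x => VV a K g (x i) (py i x)) ≤ C * ∫⁻ y, ‖g y‖ₑ ^ 2 := by
  obtain ⟨C, hC, hk⟩ := Gag_w ha hac hK hc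
  refine ⟨ENNReal.ofReal (2 * C) * ∫⁻ w, ENNReal.ofReal (ph w), ENNReal.mul_ne_top ENNReal.ofReal_ne_top ?_, ?_⟩
  · have := ph_int.2
    rw [hasFiniteIntegral_iff_norm] at this
    refine ne_of_lt (lt_of_le_of_lt (lintegral_mono fun w => ?_) this)
    exact ENNReal.ofReal_le_ofReal (le_abs_self _)
  intro g hg hgc
  have hip := ip_meas
  have hVm := VV_meas ha.continuous hK.continuous hg.continuous.measurable (f := g)
  set F : E2 → ℝ≥0∞ := fun ξ => ‖𝓕 (cS g hg hgc) ξ‖ₑ ^ 2 with hF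
  have hFm : Measurable F := by
    have : Continuous (fun ξ => 𝓕 (cS g hg hgc) ξ) := (𝓕 (cS g hg hgc)).continuous
    have := this.measurable
    fun_prop
  set V : E3 → ℝ := fun x => VV a K g (x i) (py i x) with hV
  have hpm : Measurable (py i) := (continuous_py i).measurable
  have hVm' : Measurable V := by
    have : Measurable (fun x : E3 => ((x i, py i x) : ℝ × E2)) := by fun_prop
    exact hVm.comp this
  calc GG i V = ∫⁻ x, ∫⁻ w, ENNReal.ofReal (1 / ‖w‖ ^ 4) * (ip (x i) * ip ((x + w) i) * ‖V (x + w) - V x‖ₑ ^ 2) := by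
        unfold GG
        congr 1; ext x
        rw [← lintegral_add_left_eq_self _ x]
        congr 1; ext w
        rw [add_sub_cancel_left, mul_comm]
    _ = ∫⁻ w, ENNReal.ofReal (1 / ‖w‖ ^ 4) * ∫⁻ x, (ip (x i) * ip ((x + w) i) * ‖V (x + w) - V x‖ₑ ^ 2) := by
        rw [lintegral_lintegral_swap]
        · congr 1; ext w
          rw [lintegral_const_mul]
          fun_prop
        · apply Measurable.aemeasurable
          dsimp only [Function.uncurry_def]
          fun_prop
    _ ≤ ∫⁻ w, ENNReal.ofReal (1 / ‖w‖ ^ 4) * ∫⁻ ξ, F ξ * ENNReal.ofReal (C * min 1 ((1 + ‖ξ‖) ^ 2 * ‖w‖ ^ 2) * (2 * (1 + ‖ξ‖)⁻¹)) := by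
        apply lintegral_mono; intro w
        refine mul_le_mul' le_rfl ?_
        have e := hk hg hgc (w i) (py i w)
        rw [show (w i) ^ 2 + ‖py i w‖ ^ 2 = ‖w‖ ^ 2 by rw [← norm_ins_sq i (w i, py i w), ins_py]] at e
        refine le_trans (le_of_eq ?_) e
        rw [← (ins_mp i).lintegral_comp_emb (ins_emb i), show (volume : Measure (ℝ × E2)) = (volume : Measure ℝ).prod volume from rfl, lintegral_prod]
        · congr 1; ext n; congr 1; ext y
          have : ins i (n, y) + w = ins i (n + w i, y + py i w) := by
            conv_lhs => rw [← ins_py i w, ← ins_add]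
            rfl
          simp only [hV, this, ins_same, py_ins]
        · apply Measurable.aemeasurable
          have := (continuous_ins i).measurable
          fun_prop
    _ = ∫⁻ ξ, ∫⁻ w : E3, ENNReal.ofReal (1 / ‖w‖ ^ 4) * (F ξ * ENNReal.ofReal (C * min 1 ((1 + ‖ξ‖) ^ 2 * ‖w‖ ^ 2) * (2 * (1 + ‖ξ‖)⁻¹))) := by
        rw [lintegral_lintegral_swap (μ := volume) (ν := volume)]
        · congr 1; ext w
          rw [lintegral_const_mul]
          fun_prop
        · apply Measurable.aemeasurable
          dsimp only [Function.uncurry_def]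
          fun_prop
    _ = ∫⁻ ξ, F ξ * (ENNReal.ofReal (2 * C) * ∫⁻ w, ENNReal.ofReal (ph w)) := by
        congr 1; ext ξ
        have hN : 0 < 1 + ‖ξ‖ := by positivity
        have e : ∀ w : E3, ENNReal.ofReal (1 / ‖w‖ ^ 4) * (F ξ * ENNReal.ofReal (C * min 1 ((1 + ‖ξ‖) ^ 2 * ‖w‖ ^ 2) * (2 * (1 + ‖ξ‖)⁻¹)))
            = F ξ * (ENNReal.ofReal (2 * C * (1 + ‖ξ‖)⁻¹) * ENNReal.ofReal (min 1 ((1 + ‖ξ‖) ^ 2 * ‖w‖ ^ 2) / ‖w‖ ^ 4)) := by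
          intro w
          rw [mul_left_comm, ← ENNReal.ofReal_mul (by positivity), ← ENNReal.ofReal_mul (by positivity)]
          congr 2; ring
        simp only [e]
        rw [lintegral_const_mul _ (by fun_prop), lintegral_const_mul _ (by fun_prop), J2_int hN, ← mul_assoc (ENNReal.ofReal _),
          ← ENNReal.ofReal_mul (by positivity)]
        congr 3; field_simp
    _ = _ := by
        rw [lintegral_mul_const _ hFm, mul_comm, planch_g]

lemma lint2 {α : Type*} [MeasurableSpace α] {μ : Measure α} (f : α → ℝ) : ∫⁻ x, ‖f x‖ₑ ^ 2 ∂μ = eLpNorm f 2 μ ^ 2 := by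
  rw [eLpNorm_eq_lintegral_rpow_enorm_toReal (by norm_num) (by norm_num), ← ENNReal.rpow_natCast, ← ENNReal.rpow_mul]
  simp

lemma VV_tendsto {a : ℝ → ℝ} {K : E2 → ℝ} (hK : ContDiff ℝ (⊤ : ℕ∞) K) (hc : HasCompactSupport K)
    {f : E2 → ℝ} (hf : MemLp f 2) {g : ℕ → E2 → ℝ} (hg : ∀ k, MemLp (g k) 2)
    (hgf : Filter.Tendsto (fun k => eLpNorm (f - g k) 2) Filter.atTop (nhds 0)) {n : ℝ} (hn : 0 < n) (y : E2) :
    Filter.Tendsto (fun k => VV a K (g k) n y) Filter.atTop (nhds (VV a K f n y)) := by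
  unfold VV
  apply Filter.Tendsto.const_mul
  simp only [conv_scale K _ _ hn]
  set q : E2 → ℝ := fun w => (((n ^ 2)⁻¹ : ℝ) : ℝ) * K (-(n⁻¹ • (y - w))) with hq
  have hqL : MemLp q 2 := by
    have c1 : Continuous q := by have := hK.continuous; fun_prop
    refine c1.memLp_of_hasCompactSupport ?_
    have := gk_cpt hc hn 0
    simp only [add_zero] at this
    have := this.comp_homeomorph (Homeomorph.subLeft y)
    exact this
  have hI : ∀ {h : E2 → ℝ}, MemLp h 2 → Integrable (fun w => h w * q w) := fun hh => hh.integrable_mul hqL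
  refine tendsto_integral_of_L1' _ (hI hf).1 (Filter.Eventually.of_forall fun k => hI (hg k)) ?_
  refine tendsto_of_tendsto_of_tendsto_of_le_of_le tendsto_const_nhds (h := fun k => eLpNorm (f - g k) 2 * eLpNorm q 2) ?_ (fun _ => zero_le) ?_
  · have := ENNReal.Tendsto.mul_const hgf (Or.inr hqL.2.ne)
    simpa using this
  · intro k
    have h1 := eLpNorm_smul_le_mul_eLpNorm (r := 1) (p := 2) (q := 2) hqL.1 (hf.sub (hg k)).1
    refine le_trans (le_of_eq ?_) h1
    have e : (fun x => g k x * q x) - (fun w => f w * q w) = -((f - g k) • q) := by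
      funext w
      show g k w * q w - f w * q w = -((f w - g k w) * q w)
      ring
    exact (congrArg (fun t => eLpNorm t 1 volume) e).trans (eLpNorm_neg _ _ _)

lemma GG_L2 (i : Fin 3) {a : ℝ → ℝ} (ha : ContDiff ℝ (⊤ : ℕ∞) a) (hac : HasCompactSupport a)
    {K : E2 → ℝ} (hK : ContDiff ℝ (⊤ : ℕ∞) K) (hc : HasCompactSupport K) {f : E2 → ℝ} (hfm : Measurable f)
    (hf : MemLp f 2) : GG i (fun x => VV a K f (x i) (py i x)) < ∞ := by
  obtain ⟨C, hC, hk⟩ := Gag_smooth i ha hac hK hc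
  choose g hgc hgs hge using fun k : ℕ => hf.exist_eLpNorm_sub_le (by norm_num) (by norm_num) (ε := 1 / ((k : ℝ) + 1)) (by positivity)
  have hg2 : ∀ k, MemLp (g k) 2 := fun k => (hgs k).continuous.memLp_of_hasCompactSupport (hgc k)
  have hgf : Filter.Tendsto (fun k => eLpNorm (f - g k) 2) Filter.atTop (nhds 0) := by
    refine tendsto_of_tendsto_of_tendsto_of_le_of_le tendsto_const_nhds (h := fun k : ℕ => ENNReal.ofReal (1 / ((k : ℝ) + 1))) ?_ (fun _ => zero_le) hge
    have := ENNReal.tendsto_ofReal (tendsto_one_div_add_atTop_nhds_zero_nat (𝕜 := ℝ))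
    simpa using this
  have hip := ip_meas
  have hpm : Measurable (py i) := (continuous_py i).measurable
  have hVm : ∀ {h : E2 → ℝ}, Measurable h → Measurable (fun x : E3 => VV a K h (x i) (py i x)) := by
    intro h hh
    have : Measurable (fun x : E3 => ((x i, py i x) : ℝ × E2)) := by fun_prop
    exact (VV_meas ha.continuous hK.continuous hh).comp this
  set D : (E2 → ℝ) → E3 × E3 → ℝ≥0∞ := fun h p => ip (p.1 i) * ip (p.2 i) *
    ‖VV a K h (p.2 i) (py i p.2) - VV a K h (p.1 i) (py i p.1)‖ₑ ^ 2 * ENNReal.ofReal (1 / ‖p.2 - p.1‖ ^ 4) with hD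
  have hDm : ∀ {h : E2 → ℝ}, Measurable h → Measurable (D h) := by
    intro h hh
    have := hVm hh
    have h1 : Measurable (fun p : E3 × E3 => VV a K h (p.2 i) (py i p.2)) := this.comp measurable_snd
    have h2 : Measurable (fun p : E3 × E3 => VV a K h (p.1 i) (py i p.1)) := this.comp measurable_fst
    simp only [hD]
    fun_prop
  have hDG : ∀ {h : E2 → ℝ}, Measurable h → GG i (fun x => VV a K h (x i) (py i x)) = ∫⁻ p, D h p ∂(volume.prod volume) := by
    intro h hh
    rw [lintegral_prod _ (hDm hh).aemeasurable]
    rfl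
  have hlim : ∀ p, D f p ≤ Filter.liminf (fun k => D (g k) p) Filter.atTop := by
    intro p
    by_cases h1 : 0 < p.1 i
    swap
    · simp [hD, ip, h1]
    by_cases h2 : 0 < p.2 i
    swap
    · simp [hD, ip, h2]
    apply le_of_eq
    symm
    apply Filter.Tendsto.liminf_eq
    simp only [hD, ip, mem_Ioi, h1, h2, indicator_of_mem, one_mul]
    refine ENNReal.Tendsto.mul_const ?_ (Or.inr ENNReal.ofReal_ne_top)
    refine ((ENNReal.continuous_pow 2).tendsto _).comp ?_
    exact (continuous_enorm.tendsto _).comp ((VV_tendsto hK hc hf hg2 hgf h2 _).sub (VV_tendsto hK hc hf hg2 hgf h1 _))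
  have hb : ∀ k, ∫⁻ p, D (g k) p ∂(volume.prod volume) ≤ C * (eLpNorm f 2 + 1) ^ 2 := by
    intro k
    rw [← hDG (hgs k).continuous.measurable]
    refine (hk (hgs k) (hgc k)).trans ?_
    rw [lint2]
    have h1 : eLpNorm (g k) 2 ≤ eLpNorm f 2 + 1 := by
      have e : g k = f - (f - g k) := by simp
      have h2 : eLpNorm (g k) 2 ≤ eLpNorm f 2 + eLpNorm (f - g k) 2 := by
        conv_lhs => rw [e]
        exact eLpNorm_sub_le hf.1 (hf.sub (hg2 k)).1 (by norm_num)
      refine h2.trans (add_le_add le_rfl ((hge k).trans ?_))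
      rw [← ENNReal.ofReal_one]
      apply ENNReal.ofReal_le_ofReal
      rw [div_le_one (by positivity)]; linarith [(Nat.cast_nonneg k : (0:ℝ) ≤ k)]
    gcongr
  rw [hDG hfm]
  have h1 : ∫⁻ p, D f p ∂(volume.prod volume) ≤ ∫⁻ p, Filter.liminf (fun k => D (g k) p) Filter.atTop ∂(volume.prod volume) := lintegral_mono hlim
  have h2 := lintegral_liminf_le (μ := (volume : Measure E3).prod volume) (u := Filter.atTop) (f := fun k : ℕ => D (g k)) (fun k => hDm (hgs k).continuous.measurable)
  have h3 : Filter.liminf (fun k => ∫⁻ p, D (g k) p ∂(volume.prod volume)) Filter.atTop ≤ C * (eLpNorm f 2 + 1) ^ 2 :=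
    Filter.liminf_le_of_le (by isBoundedDefault) (fun b hb' => by
      obtain ⟨k, hk'⟩ := hb'.exists
      exact hk'.trans (hb k))
  have hfin : C * (eLpNorm f 2 + 1) ^ 2 < ∞ := ENNReal.mul_lt_top hC.lt_top (ENNReal.pow_lt_top (ENNReal.add_lt_top.2 ⟨hf.2, ENNReal.one_lt_top⟩))
  exact lt_of_le_of_lt (h1.trans (h2.trans h3)) hfin

lemma TT_Gag (i : Fin 2) {a : ℝ → ℝ} (ha : ContDiff ℝ (⊤ : ℕ∞) a) (hac : HasCompactSupport a) {K u : E2 → ℝ} (hu : L2on hplane u)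
    (hK : ContDiff ℝ (⊤ : ℕ∞) K) (hKc : HasCompactSupport K) : GagH12 wedge (TT i.castSucc a K u) := by
  obtain ⟨f, hfm, hf2, -, hf⟩ := AA_rep hu
  have hG := GG_L2 i.castSucc ha hac hK hKc hfm hf2
  set V : E3 → ℝ := fun x => VV a K f (x i.castSucc) (py i.castSucc x) with hV
  have hVm : Measurable V := by
    have := (continuous_py i.castSucc).measurable
    have : Measurable (fun x : E3 => ((x i.castSucc, py i.castSucc x) : ℝ × E2)) := by fun_prop
    exact (VV_meas ha.continuous hK.continuous hfm).comp this
  have hpos := wedge_sub_W i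
  have hTV : ∀ x ∈ wedge, TT i.castSucc a K u x = V x := by
    intro x hx
    simp only [TT, hV, VV]
    rw [hf K _ _ (hpos hx)]
  unfold GagH12
  have key : Integrable (fun q : E3 × E3 => (V q.1 - V q.2) ^ 2 / ‖q.1 - q.2‖ ^ (3 + 1)) ((volume.restrict wedge).prod (volume.restrict wedge)) := by
    have hm : Measurable (fun q : E3 × E3 => (V q.1 - V q.2) ^ 2 / ‖q.1 - q.2‖ ^ (3 + 1)) := by fun_prop
    refine ⟨hm.aestronglyMeasurable, ?_⟩
    unfold HasFiniteIntegral
    rw [lintegral_prod _ (by fun_prop)]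
    refine lt_of_le_of_lt ?_ hG
    unfold GG
    rw [← lintegral_indicator measurableSet_wedge]
    apply lintegral_mono; intro x
    by_cases hx : x ∈ wedge
    swap
    · simp [hx]
    rw [indicator_of_mem hx, ← lintegral_indicator measurableSet_wedge]
    apply lintegral_mono; intro x'
    by_cases hx' : x' ∈ wedge
    swap
    · simp [hx']
    rw [indicator_of_mem hx']
    have h1 : 0 < x i.castSucc := hpos hx
    have h2 : 0 < x' i.castSucc := hpos hx'
    simp only [ip, mem_Ioi, h1, h2, indicator_of_mem, one_mul]
    rw [← ofReal_norm, ← ofReal_norm, ← ENNReal.ofReal_pow (by positivity), ← ENNReal.ofReal_mul (by positivity)]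
    apply le_of_eq
    congr 1
    rw [norm_div, norm_pow, norm_pow, norm_norm, norm_sub_rev, norm_sub_rev x x']
    ring
  refine key.congr ?_
  rw [Measure.prod_restrict]
  refine (ae_restrict_iff' (measurableSet_wedge.prod measurableSet_wedge)).2 (Filter.Eventually.of_forall fun q hq => ?_)
  show _ = _
  dsimp only
  rw [hTV _ hq.1, hTV _ hq.2]

end

section
/-! ### Part 7 : traces of lifted terms on the wedge -/

open Filter Topology

lemma hasDerivAt_ins (d : Fin 3) (κ : E3 → ℝ) (hκ : ContDiff ℝ (⊤ : ℕ∞) κ) (y : E2) (t : ℝ) :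
    HasDerivAt (fun t => κ (ins d (t, y))) (fderiv ℝ κ (ins d (t, y)) (stdb3 d)) t := by
  have h1 : HasDerivAt (fun t : ℝ => ins d (t, y)) (stdb3 d) t := by
    simp only [ins]
    simpa using ((hasDerivAt_id t).smul_const (stdb3 d)).const_add (embFace d y)
  exact (((hκ.differentiable (by simp)) (ins d (t, y))).hasFDerivAt).comp_hasDerivAt t h1

lemma kappa_zero_far (d : Fin 3) {κ : E3 → ℝ} (hc : HasCompactSupport κ) (y : E2) :
    ∃ R : ℝ, ∀ t : ℝ, R < |t| → κ (ins d (t, y)) = 0 := by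
  obtain ⟨R, hR⟩ := hc.isBounded.subset_closedBall (0 : E3)
  refine ⟨R, fun t ht => ?_⟩
  apply image_eq_zero_of_notMem_tsupport
  intro hm
  have h1 := hR hm
  simp only [Metric.mem_closedBall, dist_zero_right] at h1
  have h2 := norm_ins_sq d (t, y)
  have h3 : |t| ≤ ‖ins d (t, y)‖ := by
    have h4 : t ^ 2 ≤ ‖ins d (t, y)‖ ^ 2 := by simp only at h2; nlinarith [sq_nonneg ‖y‖]
    exact abs_le_of_sq_le_sq h4 (norm_nonneg _)
  linarith

lemma wedge_integrable {F DF κ : E3 → ℝ} (hκ : ContDiff ℝ (⊤ : ℕ∞) κ) (hc : HasCompactSupport κ) (hF : L2on wedge F)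
    (hDF : L2on wedge DF) (d : Fin 3) : IntegrableOn (fun x => F x * fderiv ℝ κ x (stdb3 d) + DF x * κ x) wedge := by
  refine Integrable.add (integrable_mul_test hF ?_ ?_) (integrable_mul_test hDF hκ.continuous hc)
  · exact ((hκ.continuous_fderiv (by simp)).clm_apply continuous_const)
  · exact hc.fderiv_apply (𝕜 := ℝ) _

lemma ftc_face (d : Fin 2) {F DF : E3 → ℝ} {b : E2 → ℝ} {κ : E3 → ℝ} (hκ : ContDiff ℝ (⊤ : ℕ∞) κ) (hc : HasCompactSupport κ)
    (hF : L2on wedge F) (hDF : L2on wedge DF)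
    (hder : ∀ y ∈ hplane, ∀ t : ℝ, 0 < t → HasDerivAt (fun t => F (ins d.castSucc (t, y))) (DF (ins d.castSucc (t, y))) t)
    (hlim : ∀ᵐ y, y ∈ hplane → Tendsto (fun t => F (ins d.castSucc (t, y))) (𝓝[>] 0) (𝓝 (b y))) :
    ∫ x in wedge, (F x * fderiv ℝ κ x (stdb3 d.castSucc) + DF x * κ x) = - ∫ y in hplane, b y * κ (embFace d.castSucc y) := by
  have hI := wedge_integrable hκ hc hF hDF d.castSucc
  rw [← (ins_mp d.castSucc).integrableOn_comp_preimage (ins_emb _), ins_pre_wedge] at hI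
  rw [← (ins_mp d.castSucc).setIntegral_preimage_emb (ins_emb _), ins_pre_wedge]
  unfold IntegrableOn at hI
  rw [show (volume : Measure (ℝ × E2)) = (volume : Measure ℝ).prod volume from rfl, ← Measure.prod_restrict] at hI ⊢
  simp only [Function.comp_def] at hI
  rw [integral_prod_symm _ hI, ← integral_neg]
  apply integral_congr_ae
  filter_upwards [hI.prod_left_ae, ae_restrict_mem measurableSet_hplane, ae_restrict_of_ae hlim] with y hy hyh hl
  have hl := hl hyh
  obtain ⟨R, hR⟩ := kappa_zero_far d.castSucc hc y
  have := integral_Ioi_deriv_mul_eq_sub (a := 0) (a' := b y * κ (embFace d.castSucc y)) (b' := 0)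
    (u := fun t => F (ins d.castSucc (t, y))) (u' := fun t => DF (ins d.castSucc (t, y)))
    (v := fun t => κ (ins d.castSucc (t, y))) (v' := fun t => fderiv ℝ κ (ins d.castSucc (t, y)) (stdb3 d.castSucc))
    (fun t ht => hder y hyh t ht) (fun t _ => hasDerivAt_ins _ κ hκ y t) ?_ ?_ ?_
  · rw [zero_sub] at this
    rw [← this]
    congr 1; ext t; simp [add_comm]
  · refine Integrable.congr hy (Eventually.of_forall fun t => ?_)
    simp [add_comm]
  · refine hl.mul ?_
    rw [← ins_zero]
    have h1 : ContinuousAt (fun t : ℝ => κ (ins d.castSucc (t, y))) 0 := by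
      have := hκ.continuous; have := continuous_ins d.castSucc
      fun_prop
    exact h1.tendsto.mono_left nhdsWithin_le_nhds
  · refine tendsto_const_nhds.congr' ?_
    filter_upwards [eventually_gt_atTop (max R 0)] with t ht
    simp only [Pi.mul_apply]
    rw [hR t, mul_zero]
    have := le_max_left R 0; have := le_max_right R 0
    rw [abs_of_pos (by linarith)]; linarith

lemma ins_pre_wedge2 : ins 2 ⁻¹' wedge = univ ×ˢ {y : E2 | 0 < y 0 ∧ 0 < y 1} := by
  ext p
  have h0 : ins 2 p 0 = p.2 0 := ins_succAbove 2 p 0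
  have h1 : ins 2 p 1 = p.2 1 := ins_succAbove 2 p 1
  simp [wedge, h0, h1]

lemma ftc_edge {F DF : E3 → ℝ} {κ : E3 → ℝ} (hκ : ContDiff ℝ (⊤ : ℕ∞) κ) (hc : HasCompactSupport κ)
    (hF : L2on wedge F) (hDF : L2on wedge DF)
    (hder : ∀ y : E2, 0 < y 0 → 0 < y 1 → ∀ t : ℝ, HasDerivAt (fun t => F (ins 2 (t, y))) (DF (ins 2 (t, y))) t) :
    ∫ x in wedge, (F x * fderiv ℝ κ x (stdb3 2) + DF x * κ x) = 0 := by
  have hI := wedge_integrable hκ hc hF hDF 2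
  rw [← (ins_mp 2).integrableOn_comp_preimage (ins_emb _), ins_pre_wedge2] at hI
  rw [← (ins_mp 2).setIntegral_preimage_emb (ins_emb _), ins_pre_wedge2]
  unfold IntegrableOn at hI
  rw [show (volume : Measure (ℝ × E2)) = (volume : Measure ℝ).prod volume from rfl, ← Measure.prod_restrict, Measure.restrict_univ] at hI ⊢
  simp only [Function.comp_def] at hI
  rw [integral_prod_symm _ hI]
  have hm : MeasurableSet {y : E2 | 0 < y 0 ∧ 0 < y 1} := by measurability
  apply integral_eq_zero_of_ae
  filter_upwards [hI.prod_left_ae, ae_restrict_mem hm] with y hy hyh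
  obtain ⟨R, hR⟩ := kappa_zero_far 2 hc y
  have := integral_of_hasDerivAt_of_tendsto (f := fun t => F (ins 2 (t, y)) * κ (ins 2 (t, y))) (m := 0) (n := 0)
    (f' := fun t => DF (ins 2 (t, y)) * κ (ins 2 (t, y)) + F (ins 2 (t, y)) * fderiv ℝ κ (ins 2 (t, y)) (stdb3 2))
    (fun t => (hder y hyh.1 hyh.2 t).mul (hasDerivAt_ins _ κ hκ y t)) ?_ ?_ ?_
  · simp only [sub_zero] at this
    simp only [Pi.zero_apply, Function.comp]
    rw [← this]; congr 1; ext t; ring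
  · refine Integrable.congr hy (Eventually.of_forall fun t => ?_)
    simp [add_comm]
  · refine tendsto_const_nhds.congr' ?_
    filter_upwards [eventually_lt_atBot (min (-R) 0)] with t ht
    rw [hR t, mul_zero]
    have := min_le_left (-R) 0; have := min_le_right (-R) 0
    rw [abs_of_neg (by linarith)]; linarith
  · refine tendsto_const_nhds.congr' ?_
    filter_upwards [eventually_gt_atTop (max R 0)] with t ht
    rw [hR t, mul_zero]
    have := le_max_left R 0; have := le_max_right R 0
    rw [abs_of_pos (by linarith)]; linarith

lemma AA_lim {K u : E2 → ℝ} (hu : L2on hplane u) (hK : Continuous K) (hc : HasCompactSupport K) :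
    ∀ᵐ y, Tendsto (fun n => AA K u y n) (𝓝[>] 0) (𝓝 ((∫ z, K z) * uz u y)) := by
  have hL := locInt_uz hu
  obtain ⟨R0, hR0⟩ := hc.isBounded.subset_closedBall (0 : E2)
  set R := max R0 1 with hRd
  have hR1 : 1 ≤ R := le_max_right _ _
  have hR : ∀ z, K z ≠ 0 → ‖z‖ ≤ R := by
    intro z hz
    have := hR0 (subset_tsupport K hz)
    simp only [Metric.mem_closedBall, dist_zero_right] at this
    exact this.trans (le_max_left _ _)
  obtain ⟨M, hM⟩ := hK.bounded_above_of_compact_support hc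
  filter_upwards [IsUnifLocDoublingMeasure.ae_tendsto_average_norm_sub (volume : Measure E2) hL 1] with y hy
  have hδ : Tendsto (fun n : ℝ => n * R) (𝓝[>] 0) (𝓝[>] 0) := by
    refine tendsto_nhdsWithin_iff.2 ⟨?_, ?_⟩
    · have : Tendsto (fun n : ℝ => n * R) (𝓝 0) (𝓝 (0 * R)) := (continuous_id.mul continuous_const).tendsto 0
      rw [zero_mul] at this
      exact this.mono_left nhdsWithin_le_nhds
    · filter_upwards [self_mem_nhdsWithin] with n hn
      have : (0:ℝ) < n := hn
      exact mul_pos this (by linarith)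
  have h1 := hy (fun _ : ℝ => y) (fun n : ℝ => n * R) hδ (by
    filter_upwards [self_mem_nhdsWithin] with n hn
    have : (0:ℝ) < n := hn
    have : 0 ≤ n * R := by positivity
    simpa using this)
  set c : ℝ := volume.real (Metric.ball (0:E2) 1) with hcd
  have hcpos : 0 < c := by
    rw [hcd, measureReal_def]
    exact ENNReal.toReal_pos (Metric.measure_ball_pos _ _ one_pos).ne' measure_ball_lt_top.ne
  have h2 := h1.const_mul (M * R ^ 2 * c)
  rw [mul_zero] at h2
  rw [tendsto_iff_norm_sub_tendsto_zero]
  refine tendsto_of_tendsto_of_tendsto_of_le_of_le' tendsto_const_nhds h2 (Eventually.of_forall fun _ => norm_nonneg _) ?_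
  filter_upwards [self_mem_nhdsWithin] with n hn
  have hn : (0:ℝ) < n := hn
  set B : E2 → ℝ := (Metric.closedBall (0:E2) R).indicator (fun _ => 1) with hB
  set g : E2 → ℝ := fun w => ‖uz u w - uz u y‖ with hg
  have hgl : LocallyIntegrable g := by
    have h0 : LocallyIntegrable (uz u - fun _ => uz u y) := hL.sub (locallyIntegrable_const _)
    exact fun x => (h0 x).norm
  have comp : ∀ {f : E2 → ℝ}, LocallyIntegrable f → LocallyIntegrable (fun z => f (y + n • z)) := by
    intro f hf
    rw [locallyIntegrable_iff] at hf ⊢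
    intro k hk
    have hcont : Continuous (fun z : E2 => y + n • z) := by fun_prop
    have h3 := (hf _ (hk.image hcont)).integrable_indicator (hk.image hcont).isClosed.measurableSet
    have h4 := (h3.comp_add_left y).comp_smul hn.ne'
    refine h4.integrableOn.congr_fun (fun z hz => ?_) hk.isClosed.measurableSet
    have : y + n • z ∈ (fun z : E2 => y + n • z) '' k := ⟨z, hz, rfl⟩
    simp only [indicator_of_mem this]
  have i1 : Integrable (fun z => K z * uz u (y + n • z)) :=
    ((comp hL).integrable_smul_left_of_hasCompactSupport hK hc)
  have i2 : Integrable (fun z => K z * uz u y) := (hK.integrable_of_hasCompactSupport hc).mul_const _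
  have i3 : Integrable (fun z => B z * g (y + n • z)) := by
    have : (fun z => B z * g (y + n • z)) = (Metric.closedBall (0:E2) R).indicator (fun z => g (y + n • z)) := by
      ext z; by_cases hz : z ∈ Metric.closedBall (0:E2) R <;> simp [hB, hz]
    rw [this, integrable_indicator_iff Metric.isClosed_closedBall.measurableSet]
    exact (comp hgl).integrableOn_isCompact (isCompact_closedBall _ _)
  have e1 : AA K u y n - (∫ z, K z) * uz u y = ∫ z, (K z * uz u (y + n • z) - K z * uz u y) := by
    rw [integral_sub i1 i2, integral_mul_const]; rfl
  rw [e1]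
  calc ‖∫ z, (K z * uz u (y + n • z) - K z * uz u y)‖ ≤ ∫ z, M * (B z * g (y + n • z)) := by
        refine norm_integral_le_of_norm_le (i3.const_mul M) (Eventually.of_forall fun z => ?_)
        rw [← mul_sub, norm_mul]
        by_cases hz : K z = 0
        · have hM0 : 0 ≤ M := (norm_nonneg _).trans (hM 0)
          have hB0 : 0 ≤ B z := by simp only [hB]; exact indicator_nonneg (by simp) _
          simp only [hz, norm_zero, zero_mul]; positivity
        · have : B z = 1 := by simp [hB, hR z hz]
          rw [this, one_mul]
          exact mul_le_mul_of_nonneg_right (hM z) (norm_nonneg _)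
    _ = M * ((n ^ 2)⁻¹ * ∫ w in Metric.closedBall y (n * R), g w) := by
        rw [integral_const_mul, conv_scale B g y hn, ← integral_indicator Metric.isClosed_closedBall.measurableSet]
        congr 1
        rw [← integral_const_mul]
        apply integral_congr_ae; refine Eventually.of_forall fun w => ?_
        simp only
        have : (-(n⁻¹ • (y - w)) ∈ Metric.closedBall (0:E2) R) ↔ w ∈ Metric.closedBall y (n * R) := by
          rw [mem_closedBall_zero_iff, norm_neg, norm_smul, norm_inv, Real.norm_of_nonneg hn.le, Metric.mem_closedBall, dist_comm, dist_eq_norm, inv_mul_le_iff₀ hn]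
        by_cases hw : w ∈ Metric.closedBall y (n * R)
        · rw [indicator_of_mem hw, hB, indicator_of_mem (this.2 hw)]; simp; ring
        · rw [indicator_of_notMem hw, hB, indicator_of_notMem (fun h => hw (this.1 h))]; simp
    _ = M * R ^ 2 * c * ⨍ w in Metric.closedBall y (n * R), ‖uz u w - uz u y‖ := by
        rw [setAverage_eq, measureReal_def, Measure.addHaar_closedBall _ _ (by positivity), ENNReal.toReal_mul, ← measureReal_def, ← hcd,
          ENNReal.toReal_ofReal (by positivity)]
        simp only [finrank_euclideanSpace, Fintype.card_fin, smul_eq_mul, hg]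
        field_simp
    _ ≤ _ := le_rfl

end

section
/-! ### Part 8 : differentiation rule and the class of good functions -/

open Filter Topology

lemma wedgeTrace_of {F : E3 → ℝ} {DF : Fin 3 → E3 → ℝ} {b : Fin 2 → E2 → ℝ}
    (h1 : ∀ κ : E3 → ℝ, ContDiff ℝ (⊤ : ℕ∞) κ → HasCompactSupport κ → ∀ e : Fin 2,
      ∫ x in wedge, (F x * fderiv ℝ κ x (stdb3 e.castSucc) + DF e.castSucc x * κ x) = - ∫ y in hplane, b e y * κ (embFace e.castSucc y))
    (h2 : ∀ κ : E3 → ℝ, ContDiff ℝ (⊤ : ℕ∞) κ → HasCompactSupport κ →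
      ∫ x in wedge, (F x * fderiv ℝ κ x (stdb3 2) + DF 2 x * κ x) = 0) : WedgeTrace F DF b := by
  intro κ hκ hc d
  fin_cases d
  · simpa using h1 κ hκ hc 0
  · simpa using h1 κ hκ hc 1
  · simpa using h2 κ hκ hc

/-- derivatives of a lifted term -/
def TTD (i : Fin 3) (a : ℝ → ℝ) (K u : E2 → ℝ) (v : Fin 2 → E2 → ℝ) (d : Fin 3) (x : E3) : ℝ :=
  if d = i then TT i (deriv a) K u x + ∑ j, TT i a (Kz K j) (v j) x
  else if d = i.succAbove 0 then TT i a K (v 0) x else TT i a K (v 1) x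

/-- traces of a lifted term -/
def TTb (i : Fin 2) (a : ℝ → ℝ) (K u : E2 → ℝ) (j : Fin 2) (y : E2) : ℝ :=
  if j = i then a 0 * (∫ z, K z) * u y else TT i.castSucc a K u (embFace j.castSucc y)

lemma TT_deriv_n (i : Fin 3) {a : ℝ → ℝ} (ha : ContDiff ℝ (⊤ : ℕ∞) a) {D : Set E2} {K u : E2 → ℝ} {v : Fin 2 → E2 → ℝ}
    (hu : H1 D u v) (hK : KC D K) {y : E2} (hy : 0 ≤ y 0) {t : ℝ} (ht : 0 < t) :
    HasDerivAt (fun t => TT i a K u (ins i (t, y))) (TTD i a K u v i (ins i (t, y))) t := by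
  have h1 := ((ha.differentiable (by simp)) t).hasDerivAt.mul (AA_hasDeriv_n hu hK hy ht)
  simp only [TTD, if_true, TT, ins_same, py_ins]
  refine h1.congr_deriv ?_
  simp [Fin.sum_univ_two]; ring

lemma TT_deriv_y (i : Fin 3) {a : ℝ → ℝ} {D : Set E2} {K u : E2 → ℝ} {v : Fin 2 → E2 → ℝ}
    (hu : H1 D u v) (hK : KC D K) {x : E3} (hx : 0 < x i) (hx0 : 0 ≤ x (i.succAbove 0)) (j : Fin 2) :
    HasDerivAt (fun t : ℝ => TT i a K u (x + t • stdb3 (i.succAbove j))) (TT i a K (v j) x) 0 := by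
  have h1 := (AA_hasDeriv_y hu hK (y := py i x) (by rw [py_apply]; exact hx0) hx j).const_mul (a (x i))
  refine HasDerivAt.congr_of_eventuallyEq h1 (Eventually.of_forall fun t => ?_)
  have e1 : (x + t • stdb3 (i.succAbove j)) i = x i := by
    simp [stdb3, (Fin.succAbove_ne i j).symm]
  have e2 : py i (x + t • stdb3 (i.succAbove j)) = py i x + t • stdb2 j := by
    ext k
    rw [py_apply]
    simp only [PiLp.add_apply, PiLp.smul_apply, py_apply, stdb3, stdb2]
    simp [PiLp.single_apply]
  simp only [TT, e1, e2]

lemma TT_deriv_ins (i d : Fin 3) (j : Fin 2) (hd : d = i.succAbove j) {a : ℝ → ℝ} {D : Set E2} {K u : E2 → ℝ} {v : Fin 2 → E2 → ℝ}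
    (hu : H1 D u v) (hK : KC D K) {y : E2} {t : ℝ} (hx : 0 < ins d (t, y) i) (hx0 : 0 ≤ ins d (t, y) (i.succAbove 0)) :
    HasDerivAt (fun t : ℝ => TT i a K u (ins d (t, y))) (TT i a K (v j) (ins d (t, y))) t := by
  have h1 := TT_deriv_y (a := a) i hu hK hx hx0 j
  rw [← hd] at h1
  have h2 : HasDerivAt (fun s : ℝ => s - t) 1 t := (hasDerivAt_id t).sub_const t
  have h3 := HasDerivAt.comp_of_eq t h1 h2 (by simp)
  rw [mul_one] at h3
  refine HasDerivAt.congr_of_eventuallyEq h3 (Eventually.of_forall fun s => ?_)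
  simp only [Function.comp, ins]
  congr 1
  rw [sub_smul]; abel

lemma csA (i : Fin 2) : i.castSucc.succAbove 0 = (1 - i).castSucc := by fin_cases i <;> rfl
lemma csA1 (i : Fin 2) : i.castSucc.succAbove 1 = 2 := by fin_cases i <;> rfl

lemma TTD_o (i : Fin 2) (a : ℝ → ℝ) (K u : E2 → ℝ) (v : Fin 2 → E2 → ℝ) :
    TTD i.castSucc a K u v (1 - i).castSucc = TT i.castSucc a K (v 0) := by
  ext x
  have : (1 - i).castSucc ≠ i.castSucc := by fin_cases i <;> decide
  simp [TTD, this, csA]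

lemma TTD_2 (i : Fin 2) (a : ℝ → ℝ) (K u : E2 → ℝ) (v : Fin 2 → E2 → ℝ) :
    TTD i.castSucc a K u v 2 = TT i.castSucc a K (v 1) := by
  ext x
  have h1 : (2 : Fin 3) ≠ i.castSucc := by fin_cases i <;> decide
  have h2 : (2 : Fin 3) ≠ (1 - i).castSucc := by fin_cases i <;> decide
  simp [TTD, h1, h2, csA]

lemma TTD_i (i : Fin 3) (a : ℝ → ℝ) (K u : E2 → ℝ) (v : Fin 2 → E2 → ℝ) :
    TTD i a K u v i = fun x => TT i (deriv a) K u x + ∑ j, TT i a (Kz K j) (v j) x := by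
  ext x
  simp [TTD]

lemma fin3_cases (i : Fin 2) (d : Fin 3) : d = i.castSucc ∨ d = (1 - i).castSucc ∨ d = 2 := by
  fin_cases i <;> fin_cases d <;> decide

lemma GagH12.add' {n : ℕ} {Ω : Set (EuclideanSpace ℝ (Fin n))} {u v : EuclideanSpace ℝ (Fin n) → ℝ}
    (hΩ : MeasurableSet Ω) (mu : AEStronglyMeasurable u (volume.restrict Ω)) (mv : AEStronglyMeasurable v (volume.restrict Ω))
    (hu : GagH12 Ω u) (hv : GagH12 Ω v) : GagH12 Ω (fun x => u x + v x) := by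
  unfold GagH12 at *
  refine Integrable.mono' ((hu.const_mul 2).add (hv.const_mul 2)) ?_ (Eventually.of_forall fun q => ?_)
  · have m : ∀ {w : EuclideanSpace ℝ (Fin n) → ℝ}, AEStronglyMeasurable w (volume.restrict Ω) →
        AEStronglyMeasurable (fun q : EuclideanSpace ℝ (Fin n) × EuclideanSpace ℝ (Fin n) => w q.1 - w q.2)
          ((volume.restrict Ω).prod (volume.restrict Ω)) := fun h => h.comp_fst.sub h.comp_snd
    have h1 := ((m (mu.add mv)).pow 2).aemeasurable
    have h2 : Measurable (fun q : EuclideanSpace ℝ (Fin n) × EuclideanSpace ℝ (Fin n) => ‖q.1 - q.2‖ ^ (n + 1)) := by fun_prop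
    exact (h1.div h2.aemeasurable).aestronglyMeasurable
  · rw [Real.norm_of_nonneg (by positivity)]
    simp only [Pi.add_apply]
    rw [← mul_div_assoc, ← mul_div_assoc, ← add_div]
    gcongr
    nlinarith [sq_nonneg ((u q.1 - u q.2) - (v q.1 - v q.2))]

lemma GagH12.neg' {n : ℕ} {Ω : Set (EuclideanSpace ℝ (Fin n))} {u : EuclideanSpace ℝ (Fin n) → ℝ}
    (hu : GagH12 Ω u) : GagH12 Ω (fun x => - u x) := by
  unfold GagH12 at *
  refine hu.congr (Eventually.of_forall fun q => ?_)
  simp only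
  congr 1; ring

lemma GagH12.congr' {n : ℕ} {Ω : Set (EuclideanSpace ℝ (Fin n))} {u v : EuclideanSpace ℝ (Fin n) → ℝ}
    (hΩ : MeasurableSet Ω) (h : ∀ x ∈ Ω, u x = v x)
    (hu : GagH12 Ω u) : GagH12 Ω v := by
  unfold GagH12 at *
  refine hu.congr ?_
  rw [Measure.prod_restrict]
  filter_upwards [ae_restrict_mem (hΩ.prod hΩ)] with q hq
  rw [h _ hq.1, h _ hq.2]

structure Good (F : E3 → ℝ) (DF : Fin 3 → E3 → ℝ) (b : Fin 2 → E2 → ℝ) : Prop where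
  l2 : L2on wedge F
  l2d : ∀ d, L2on wedge (DF d)
  lb : ∀ i, L2on hplane (b i)
  gag : ∀ d, GagH12 wedge (DF d)
  tr : WedgeTrace F DF b

lemma Good.congr {F F' : E3 → ℝ} {DF DF' : Fin 3 → E3 → ℝ} {b b' : Fin 2 → E2 → ℝ} (h : Good F DF b)
    (h1 : ∀ x ∈ wedge, F x = F' x) (h2 : ∀ d, ∀ x ∈ wedge, DF d x = DF' d x) (h3 : ∀ i, b i =ᵐ[volume.restrict hplane] b' i) :
    Good F' DF' b' where
  l2 := (memLp_congr_ae (by filter_upwards [ae_restrict_mem measurableSet_wedge] with x hx using h1 x hx)).1 h.l2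
  l2d d := (memLp_congr_ae (by filter_upwards [ae_restrict_mem measurableSet_wedge] with x hx using h2 d x hx)).1 (h.l2d d)
  lb i := (memLp_congr_ae (h3 i)).1 (h.lb i)
  gag d := (h.gag d).congr' measurableSet_wedge (h2 d)
  tr := by
    intro κ hκ hc d
    have := h.tr κ hκ hc d
    rw [setIntegral_congr_fun (g := fun x => F x * fderiv ℝ κ x (stdb3 d) + DF d x * κ x) measurableSet_wedge
      (fun x hx => by simp only [h1 x hx, h2 d x hx]), this]
    have e : ∀ i : Fin 2, ∫ y in hplane, b i y * κ (embFace i.castSucc y) = ∫ y in hplane, b' i y * κ (embFace i.castSucc y) :=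
      fun i => integral_congr_ae (by filter_upwards [h3 i] with y hy; rw [hy])
    have e0 := e 0
    have e1 := e 1
    simp only [Fin.castSucc_zero, Fin.castSucc_one] at e0 e1
    rw [e0, e1]

lemma emb_cpt {κ : E3 → ℝ} (hc : HasCompactSupport κ) (d : Fin 3) : HasCompactSupport (fun y => κ (embFace d y)) := by
  obtain ⟨R, hR⟩ := hc.isBounded.subset_closedBall (0 : E3)
  refine HasCompactSupport.of_support_subset_isCompact (isCompact_closedBall (0 : E2) R) (fun y hy => ?_)
  have h1 := hR (subset_tsupport κ hy)
  simp only [Metric.mem_closedBall, dist_zero_right] at h1 ⊢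
  have h2 := norm_ins_sq d (0, y)
  rw [ins_zero] at h2
  simp only [ne_eq, OfNat.ofNat_ne_zero, not_false_eq_true, zero_pow, zero_add] at h2
  rw [← (pow_left_inj₀ (norm_nonneg _) (norm_nonneg _) two_ne_zero).1 h2]; exact h1

lemma Good.add {F F' : E3 → ℝ} {DF DF' : Fin 3 → E3 → ℝ} {b b' : Fin 2 → E2 → ℝ} (h : Good F DF b) (h' : Good F' DF' b') :
    Good (fun x => F x + F' x) (fun d x => DF d x + DF' d x) (fun i y => b i y + b' i y) where
  l2 := h.l2.add h'.l2
  l2d d := (h.l2d d).add (h'.l2d d)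
  lb i := (h.lb i).add (h'.lb i)
  gag d := (h.gag d).add' measurableSet_wedge (h.l2d d).1 (h'.l2d d).1 (h'.gag d)
  tr := by
    have eb : ∀ (κ : E3 → ℝ), ContDiff ℝ (⊤ : ℕ∞) κ → HasCompactSupport κ → ∀ i : Fin 2,
        ∫ y in hplane, (b i y + b' i y) * κ (embFace i.castSucc y) =
        (∫ y in hplane, b i y * κ (embFace i.castSucc y)) + ∫ y in hplane, b' i y * κ (embFace i.castSucc y) := by
      intro κ hκ hc i
      have hcc : Continuous (fun y => κ (embFace i.castSucc y)) := hκ.continuous.comp (continuous_embFace _)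
      rw [← integral_add (integrable_mul_test (h.lb i) hcc (emb_cpt hc _)) (integrable_mul_test (h'.lb i) hcc (emb_cpt hc _))]
      congr 1; ext y; ring
    have ea : ∀ (κ : E3 → ℝ), ContDiff ℝ (⊤ : ℕ∞) κ → HasCompactSupport κ → ∀ d : Fin 3,
        ∫ x in wedge, ((F x + F' x) * fderiv ℝ κ x (stdb3 d) + (DF d x + DF' d x) * κ x) =
        (∫ x in wedge, (F x * fderiv ℝ κ x (stdb3 d) + DF d x * κ x)) + ∫ x in wedge, (F' x * fderiv ℝ κ x (stdb3 d) + DF' d x * κ x) := by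
      intro κ hκ hc d
      rw [← integral_add (wedge_integrable hκ hc h.l2 (h.l2d d) d) (wedge_integrable hκ hc h'.l2 (h'.l2d d) d)]
      congr 1; ext y; ring
    apply wedgeTrace_of
    · intro κ hκ hc e
      rw [ea κ hκ hc, eb κ hκ hc, neg_add]
      have := h.tr κ hκ hc e.castSucc
      have := h'.tr κ hκ hc e.castSucc
      fin_cases e <;> simp_all
    · intro κ hκ hc
      rw [ea κ hκ hc]
      have := h.tr κ hκ hc 2
      have := h'.tr κ hκ hc 2
      simp_all

lemma Good.neg {F : E3 → ℝ} {DF : Fin 3 → E3 → ℝ} {b : Fin 2 → E2 → ℝ} (h : Good F DF b) :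
    Good (fun x => - F x) (fun d x => - DF d x) (fun i y => - b i y) where
  l2 := h.l2.neg
  l2d d := (h.l2d d).neg
  lb i := (h.lb i).neg
  gag d := (h.gag d).neg'
  tr := by
    intro κ hκ hc d
    have := h.tr κ hκ hc d
    have e : ∀ x, (-F x * fderiv ℝ κ x (stdb3 d) + -DF d x * κ x) = -(F x * fderiv ℝ κ x (stdb3 d) + DF d x * κ x) := fun x => by ring
    simp only [e]
    rw [integral_neg, this]
    simp only [neg_mul, integral_neg]
    split_ifs <;> simp

lemma Good.weak {F : E3 → ℝ} {DF : Fin 3 → E3 → ℝ} {b : Fin 2 → E2 → ℝ} (h : Good F DF b) (d : Fin 3) :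
    IsWeakD wedge F (DF d) (EuclideanSpace.single d 1) := by
  intro κ hκ hc hs
  have h1 := h.tr κ hκ hc d
  have hz : ∀ i : Fin 2, ∀ y, κ (embFace i.castSucc y) = 0 := by
    intro i y
    apply image_eq_zero_of_notMem_tsupport
    intro hm
    have := wedge_sub_W i (hs hm)
    simp only [mem_setOf_eq, embFace_same, lt_irrefl] at this
  have h0 := hz 0
  have h1' := hz 1
  simp only [Fin.castSucc_zero, Fin.castSucc_one] at h0 h1'
  simp only [h0, h1', mul_zero, integral_zero, ite_self, neg_zero] at h1
  rw [integral_add] at h1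
  · have : stdb3 d = EuclideanSpace.single d 1 := rfl
    rw [← this]; linarith
  · exact integrable_mul_test h.l2 ((hκ.continuous_fderiv (by simp)).clm_apply continuous_const) (hc.fderiv_apply (𝕜 := ℝ) _)
  · exact integrable_mul_test (h.l2d d) hκ.continuous hc

lemma TT_good (i : Fin 2) {a : ℝ → ℝ} (ha : ContDiff ℝ (⊤ : ℕ∞) a) (hac : HasCompactSupport a) {D : Set E2} {K u : E2 → ℝ}
    {v : Fin 2 → E2 → ℝ} (hu : H1 D u v) (hK : KC D K)
    (hs : L2on hplane (fun y => TT i.castSucc a K u (embFace (1 - i).castSucc y))) :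
    Good (TT i.castSucc a K u) (TTD i.castSucc a K u v) (TTb i a K u) := by
  have hda : ContDiff ℝ (⊤ : ℕ∞) (deriv a) := ha.iterate_deriv 1
  have hdc : HasCompactSupport (deriv a) := hac.deriv
  have l2 : L2on wedge (TT i.castSucc a K u) := TT_L2 i ha.continuous hac hu.l2u hK.smooth hK.cpt
  have l2d : ∀ d, L2on wedge (TTD i.castSucc a K u v d) := by
    intro d
    rcases fin3_cases i d with rfl | rfl | rfl
    · rw [TTD_i]
      simp only [Fin.sum_univ_two]
      exact (TT_L2 i hda.continuous hdc hu.l2u hK.smooth hK.cpt).add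
        ((TT_L2 i ha.continuous hac (hu.l2v 0) (hK.z 0).smooth (hK.z 0).cpt).add (TT_L2 i ha.continuous hac (hu.l2v 1) (hK.z 1).smooth (hK.z 1).cpt))
    · rw [TTD_o]; exact TT_L2 i ha.continuous hac (hu.l2v 0) hK.smooth hK.cpt
    · rw [TTD_2]; exact TT_L2 i ha.continuous hac (hu.l2v 1) hK.smooth hK.cpt
  have ne : (1 - i) ≠ i := by fin_cases i <;> decide
  have fc : ∀ e : Fin 2, e = i ∨ e = 1 - i := by intro e; fin_cases i <;> fin_cases e <;> decide
  refine ⟨l2, l2d, ?_, ?_, ?_⟩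
  · intro e
    rcases fc e with rfl | rfl
    · have : TTb e a K u e = fun y => a 0 * (∫ z, K z) * u y := by ext y; simp [TTb]
      rw [this]; exact hu.l2u.const_mul _
    · have : TTb i a K u (1 - i) = fun y => TT i.castSucc a K u (embFace (1 - i).castSucc y) := by ext y; simp [TTb, ne]
      rw [this]; exact hs
  · intro d
    rcases fin3_cases i d with rfl | rfl | rfl
    · rw [TTD_i]
      simp only [Fin.sum_univ_two]
      have g1 := TT_Gag i hda hdc hu.l2u hK.smooth hK.cpt
      have g2 := TT_Gag i ha hac (hu.l2v 0) (hK.z 0).smooth (hK.z 0).cpt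
      have g3 := TT_Gag i ha hac (hu.l2v 1) (hK.z 1).smooth (hK.z 1).cpt
      have l1 := (TT_L2 i hda.continuous hdc hu.l2u hK.smooth hK.cpt).1
      have l2 := (TT_L2 i ha.continuous hac (hu.l2v 0) (hK.z 0).smooth (hK.z 0).cpt).1
      have l3 := (TT_L2 i ha.continuous hac (hu.l2v 1) (hK.z 1).smooth (hK.z 1).cpt).1
      exact g1.add' measurableSet_wedge l1 (l2.add l3) (g2.add' measurableSet_wedge l2 l3 g3)
    · rw [TTD_o]; exact TT_Gag i ha hac (hu.l2v 0) hK.smooth hK.cpt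
    · rw [TTD_2]; exact TT_Gag i ha hac (hu.l2v 1) hK.smooth hK.cpt
  · apply wedgeTrace_of
    · intro κ hκ hc e
      rcases fc e with rfl | rfl
      · apply ftc_face e hκ hc l2 (l2d _)
        · intro y hy t ht
          exact TT_deriv_n _ ha hu hK (le_of_lt hy) ht
        · filter_upwards [AA_lim hu.l2u hK.smooth.continuous hK.cpt] with y hy hyh
          have hyh' : 0 ≤ y 0 := le_of_lt hyh
          simp only [TT, ins_same, py_ins, TTb, if_true]
          have e1 : uz u y = u y := by simp [uz, hyh']
          rw [e1] at hy
          rw [mul_assoc]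
          exact ((ha.continuous.tendsto 0).mono_left nhdsWithin_le_nhds).mul hy
      · have hcs : i.castSucc = (1 - i).castSucc.succAbove 0 := by fin_cases i <;> rfl
        apply ftc_face (1 - i) hκ hc l2 (l2d _)
        · intro y hy t ht
          rw [TTD_o]
          apply TT_deriv_ins i.castSucc (1 - i).castSucc 0 (csA i).symm hu hK
          · rw [hcs, ins_succAbove]; exact hy
          · rw [csA, ins_same]; exact ht.le
        · refine Eventually.of_forall fun y hy => ?_
          have hcont := TT_continuousOn i.castSucc ha.continuous hu.l2u hK.smooth hK.cpt
          have hx : embFace (1 - i).castSucc y ∈ {x : E3 | 0 < x i.castSucc} := by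
            rw [mem_setOf_eq, hcs, embFace_succAbove]; exact hy
          have h1 := hcont.continuousAt ((isOpen_W _).mem_nhds hx)
          simp only [TTb, if_neg ne]
          rw [← ins_zero] at h1 ⊢
          have h2 : ContinuousAt (fun t : ℝ => ins (1 - i).castSucc (t, y)) 0 := by
            have := continuous_ins (1 - i).castSucc
            fun_prop
          have h3 := ContinuousAt.comp_of_eq (g := TT i.castSucc a K u) h1 h2 rfl
          exact h3.tendsto.mono_left nhdsWithin_le_nhds
    · intro κ hκ hc
      apply ftc_edge hκ hc l2 (l2d 2)
      intro y h0 h1 t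
      rw [TTD_2]
      have e0 : ins 2 (t, y) 0 = y 0 := ins_succAbove 2 (t, y) 0
      have e1 : ins 2 (t, y) 1 = y 1 := ins_succAbove 2 (t, y) 1
      apply TT_deriv_ins i.castSucc 2 1 (csA1 i).symm hu hK
      · fin_cases i
        · simpa [e0] using h0
        · simpa [e1] using h1
      · rw [csA]
        fin_cases i
        · simpa [e1] using h1.le
        · simpa [e0] using h0.le

end

section
/-! ### Part 9 : restriction of lifted terms to the side face -/

open Filter Topology
open scoped ENNReal

/-- functional form of the trace on the boundary line of the half plane -/
def HPT (u : E2 → ℝ) (v : Fin 2 → E2 → ℝ) (J : (ℝ → ℝ) → ℝ) : Prop :=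
  ∀ κ : E2 → ℝ, ContDiff ℝ (⊤ : ℕ∞) κ → HasCompactSupport κ → ∀ d : Fin 2,
    ∫ x in hplane, (u x * fderiv ℝ κ x (stdb2 d) + v d x * κ x)
      = -(if d = 0 then J (fun t => κ (EuclideanSpace.single 1 t)) else 0)

/-- the linear change of variables on the side face -/
def LsE (z : E2) (hz : z 0 ≠ 0) : E2 ≃ₗ[ℝ] E2 where
  toFun y := in2 (y 0 * z 0, y 1 + y 0 * z 1)
  invFun w := in2 (w 0 / z 0, w 1 - w 0 / z 0 * z 1)
  left_inv y := by
    ext j; fin_cases j <;> simp [in2, hz]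
  right_inv y := by
    ext j; fin_cases j <;> simp [in2, hz]
  map_add' x y := by
    ext j; fin_cases j <;> simp [in2] <;> ring
  map_smul' c y := by
    ext j; fin_cases j <;> simp [in2] <;> ring

def Ls (z y : E2) : E2 := py 1 (embFace 0 y) + y 0 • z

lemma Ls_zero (z y : E2) : Ls z y 0 = y 0 * z 0 := by
  have h1 : (1 : Fin 3).succAbove 0 = 0 := rfl
  simp [Ls, py_apply, h1, embFace_same]

lemma Ls_one (z y : E2) : Ls z y 1 = y 1 + y 0 * z 1 := by
  have h1 : (1 : Fin 3).succAbove 1 = (0 : Fin 3).succAbove 1 := rfl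
  simp only [Ls, PiLp.add_apply, PiLp.smul_apply, py_apply, h1, embFace_succAbove, smul_eq_mul]

lemma Ls_eq (z : E2) (hz : z 0 ≠ 0) (y : E2) : Ls z y = LsE z hz y := by
  rw [← in2_eq (Ls z y), Ls_zero, Ls_one]; rfl

lemma LsE_det (z : E2) (hz : z 0 ≠ 0) : LinearMap.det (LsE z hz : E2 →ₗ[ℝ] E2) = z 0 := by
  rw [← LinearMap.det_toMatrix (EuclideanSpace.basisFun (Fin 2) ℝ).toBasis, Matrix.det_fin_two]
  simp [LinearMap.toMatrix_apply, LsE, in2]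

lemma Ls_map {z : E2} (hz : 0 < z 0) : Measure.map (Ls z) (volume.restrict hplane) = ENNReal.ofReal (z 0)⁻¹ • volume.restrict hplane := by
  have hf : Ls z = LsE z hz.ne' := funext fun y => Ls_eq z hz.ne' y
  have hc : Continuous (Ls z) := by rw [hf]; exact LinearMap.continuous_of_finiteDimensional (LsE z hz.ne' : E2 →ₗ[ℝ] E2)
  have hpre : Ls z ⁻¹' hplane = hplane := by
    ext y; simp [hplane, Ls_zero, hz]
  have h1 : Measure.map (Ls z) volume = ENNReal.ofReal (z 0)⁻¹ • (volume : Measure E2) := by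
    have := Measure.map_linearMap_addHaar_eq_smul_addHaar (volume : Measure E2) (f := (LsE z hz.ne' : E2 →ₗ[ℝ] E2))
      (by rw [LsE_det]; exact hz.ne')
    rw [LsE_det, abs_of_pos (inv_pos.2 hz)] at this
    rw [← this, hf]; rfl
  conv_lhs => rw [← hpre]
  rw [← Measure.restrict_map hc.measurable measurableSet_hplane, h1, Measure.restrict_smul]

lemma Ls_emb {z : E2} (hz : 0 < z 0) : MeasurableEmbedding (Ls z) := by
  have hf : Ls z = LsE z hz.ne' := funext fun y => Ls_eq z hz.ne' y
  have hc : Continuous (Ls z) := by rw [hf]; exact LinearMap.continuous_of_finiteDimensional (LsE z hz.ne' : E2 →ₗ[ℝ] E2)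
  exact hc.measurableEmbedding (by rw [hf]; exact (LsE z hz.ne').injective)

lemma Ls_integral {z : E2} (hz : 0 < z 0) (G : E2 → ℝ) : ∫ y in hplane, G (Ls z y) = (z 0)⁻¹ * ∫ y in hplane, G y := by
  rw [← (Ls_emb hz).integral_map, Ls_map hz, integral_smul_measure, ENNReal.toReal_ofReal (inv_pos.2 hz).le, smul_eq_mul]

lemma Ls_lintegral {z : E2} (hz : 0 < z 0) (G : E2 → ℝ≥0∞) :
    ∫⁻ y in hplane, G (Ls z y) = ENNReal.ofReal (z 0)⁻¹ * ∫⁻ y in hplane, G y := by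
  rw [← (Ls_emb hz).lintegral_map, Ls_map hz, lintegral_smul_measure, smul_eq_mul]

lemma Ls_lintegral_le {z : E2} (hz : 1 ≤ z 0) (G : E2 → ℝ≥0∞) :
    ∫⁻ y in hplane, G (Ls z y) ≤ ∫⁻ y, G y := by
  rw [Ls_lintegral (by linarith)]
  calc _ ≤ 1 * ∫⁻ y in hplane, G y := by
        gcongr
        rw [← ENNReal.ofReal_one]
        exact ENNReal.ofReal_le_ofReal (inv_le_one_of_one_le₀ hz)
    _ ≤ _ := by rw [one_mul]; exact setLIntegral_le_lintegral _ _

lemma continuous_Ls : Continuous (fun p : E2 × E2 => Ls p.2 p.1) := by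
  have := continuous_py 1; have := continuous_embFace 0
  unfold Ls; fun_prop

lemma side_int {K f g : E2 → ℝ} (hK : Continuous K) (hKc : HasCompactSupport K) (hK1 : ∀ z, K z ≠ 0 → 1 ≤ z 0)
    (hf : Measurable f) (hf2 : MemLp f 2) (hg : Continuous g) (hgc : HasCompactSupport g) :
    Integrable (fun p : E2 × E2 => K p.2 * (f (Ls p.2 p.1) * g p.1)) ((volume.restrict hplane).prod volume) := by
  have hfm : Measurable (fun p : E2 × E2 => f (Ls p.2 p.1)) := hf.comp continuous_Ls.measurable
  have hm : Measurable (fun p : E2 × E2 => K p.2 * (f (Ls p.2 p.1) * g p.1)) :=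
    (hK.measurable.comp measurable_snd).mul (hfm.mul (hg.measurable.comp measurable_fst))
  refine ⟨hm.aestronglyMeasurable, ?_⟩
  rw [hasFiniteIntegral_iff_enorm]
  have hg2 : MemLp g 2 (volume : Measure E2) := hg.memLp_of_hasCompactSupport hgc
  have I1 := (memLp2_iff.1 hf2).2
  have I2 := (memLp2_iff.1 hg2).2
  have IK : ∫⁻ z, ‖K z‖ₑ < ∞ := (hK.integrable_of_hasCompactSupport hKc).2
  rw [lintegral_prod_symm _ (hm.enorm.aemeasurable)]
  calc ∫⁻ z, ∫⁻ y in hplane, ‖K z * (f (Ls z y) * g y)‖ₑ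
      ≤ ∫⁻ z, ‖K z‖ₑ * ((∫⁻ w, ‖f w‖ₑ ^ 2) + ∫⁻ w, ‖g w‖ₑ ^ 2) := by
        refine lintegral_mono fun z => ?_
        by_cases hz : K z = 0
        · simp [hz]
        have hz1 := hK1 z hz
        calc ∫⁻ y in hplane, ‖K z * (f (Ls z y) * g y)‖ₑ ≤ ∫⁻ y in hplane, ‖K z‖ₑ * (‖f (Ls z y)‖ₑ ^ 2 + ‖g y‖ₑ ^ 2) := by
              refine lintegral_mono fun y => ?_
              rw [enorm_mul, enorm_mul]
              gcongr
              rcases le_total ‖f (Ls z y)‖ₑ ‖g y‖ₑ with h | h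
              · calc _ ≤ ‖g y‖ₑ * ‖g y‖ₑ := by gcongr
                  _ = ‖g y‖ₑ ^ 2 := (sq _).symm
                  _ ≤ _ := le_add_self
              · calc _ ≤ ‖f (Ls z y)‖ₑ * ‖f (Ls z y)‖ₑ := by gcongr
                  _ = ‖f (Ls z y)‖ₑ ^ 2 := (sq _).symm
                  _ ≤ _ := le_self_add
          _ = ‖K z‖ₑ * ((∫⁻ y in hplane, ‖f (Ls z y)‖ₑ ^ 2) + ∫⁻ y in hplane, ‖g y‖ₑ ^ 2) := by
              rw [lintegral_const_mul' _ _ enorm_ne_top, lintegral_add_right _ (hg.measurable.enorm.pow_const 2)]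
          _ ≤ _ := mul_le_mul' le_rfl (add_le_add (Ls_lintegral_le hz1 (fun w => ‖f w‖ₑ ^ 2)) (setLIntegral_le_lintegral _ _))
    _ < ∞ := by
        rw [lintegral_mul_const _ hK.measurable.enorm]
        exact ENNReal.mul_lt_top IK (ENNReal.add_lt_top.2 ⟨I1, I2⟩)

lemma side_swap {K f g : E2 → ℝ} (hK : Continuous K) (hKc : HasCompactSupport K) (hK1 : ∀ z, K z ≠ 0 → 1 ≤ z 0)
    (hf : Measurable f) (hf2 : MemLp f 2) (hg : Continuous g) (hgc : HasCompactSupport g) :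
    ∫ y in hplane, (∫ z, K z * f (Ls z y)) * g y = ∫ z, K z * ∫ y in hplane, f (Ls z y) * g y := by
  have := integral_integral_swap (f := fun y z => K z * (f (Ls z y) * g y)) (side_int hK hKc hK1 hf hf2 hg hgc)
  simp only [← mul_assoc, integral_mul_const] at this
  rw [this]
  congr 1; ext z
  simp only [mul_assoc, integral_const_mul]

lemma side_eq (a : ℝ → ℝ) (K u : E2 → ℝ) (y : E2) :
    TT 1 a K u (embFace 0 y) = a (y 0) * AA K u (py 1 (embFace 0 y)) (y 0) := by
  have : embFace 0 y 1 = y 0 := embFace_succAbove 0 y 0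
  simp [TT, this]

lemma side_L2 {a : ℝ → ℝ} (ha : Continuous a) (hac : HasCompactSupport a) {K u : E2 → ℝ} (hu : L2on hplane u)
    (hK : ContDiff ℝ (⊤ : ℕ∞) K) (hKc : HasCompactSupport K) (hK1 : ∀ z, K z ≠ 0 → 1 ≤ z 0) :
    L2on hplane (fun y => TT 1 a K u (embFace 0 y)) := by
  obtain ⟨f, fm, f2, fe, fA⟩ := AA_rep hu
  obtain ⟨M, hM⟩ := ha.bounded_above_of_compact_support hac
  unfold L2on
  rw [memLp2_iff]
  constructor
  · refine ContinuousOn.aestronglyMeasurable ?_ measurableSet_hplane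
    refine (TT_continuousOn 1 ha hu hK hKc).comp (continuous_embFace 0).continuousOn (fun y hy => ?_)
    have : embFace 0 y 1 = y 0 := embFace_succAbove 0 y 0
    rw [mem_ofPred_eq, this]; exact hy
  · have I1 := (memLp2_iff.1 f2).2
    have IK : ∫⁻ z, ‖K z‖ₑ < ∞ := (hK.continuous.integrable_of_hasCompactSupport hKc).2
    have hfm : Measurable (fun p : E2 × E2 => ‖K p.2‖ₑ * ‖f (Ls p.2 p.1)‖ₑ ^ 2) :=
      (hK.continuous.measurable.enorm.comp measurable_snd).mul ((fm.comp continuous_Ls.measurable).enorm.pow_const 2)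
    calc ∫⁻ y in hplane, ‖TT 1 a K u (embFace 0 y)‖ₑ ^ 2
        ≤ ∫⁻ y in hplane, ENNReal.ofReal M ^ 2 * ((∫⁻ z, ‖K z‖ₑ) * ∫⁻ z, ‖K z‖ₑ * ‖f (Ls z y)‖ₑ ^ 2) := by
          refine setLIntegral_mono' measurableSet_hplane fun y hy => ?_
          rw [side_eq, fA _ _ _ hy, enorm_mul, mul_pow]
          gcongr
          · rw [← ofReal_norm]; exact ENNReal.ofReal_le_ofReal (hM _)
          · refine le_trans ?_ (cs_weight (f := fun z => ‖f (Ls z y)‖ₑ) hK.continuous.measurable.enorm.aemeasurable ?_)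
            · gcongr
              refine (enorm_integral_le_lintegral_enorm _).trans (le_of_eq ?_)
              congr 1; ext z; rw [enorm_mul]; rfl
            · have : Measurable (fun z => f (Ls z y)) := fm.comp (continuous_Ls.comp (by fun_prop : Continuous fun z : E2 => (y, z))).measurable
              exact this.enorm.aemeasurable
      _ = ENNReal.ofReal M ^ 2 * ((∫⁻ z, ‖K z‖ₑ) * ∫⁻ z, ∫⁻ y in hplane, ‖K z‖ₑ * ‖f (Ls z y)‖ₑ ^ 2) := by
          rw [lintegral_const_mul' _ _ (by simp), lintegral_const_mul' _ _ IK.ne, lintegral_lintegral_swap hfm.aemeasurable]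
      _ ≤ ENNReal.ofReal M ^ 2 * ((∫⁻ z, ‖K z‖ₑ) * ∫⁻ z, ‖K z‖ₑ * ∫⁻ w, ‖f w‖ₑ ^ 2) := by
          gcongr with z
          rw [lintegral_const_mul' _ _ enorm_ne_top]
          by_cases hz : K z = 0
          · simp [hz]
          exact mul_le_mul' le_rfl (Ls_lintegral_le (hK1 z hz) (fun w => ‖f w‖ₑ ^ 2))
      _ < ∞ := by
          rw [lintegral_mul_const _ hK.continuous.measurable.enorm]
          exact ENNReal.mul_lt_top (by simp) (ENNReal.mul_lt_top IK (ENNReal.mul_lt_top IK I1))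

lemma slice_HPT {u : E2 → ℝ} {v : Fin 2 → E2 → ℝ} {J : (ℝ → ℝ) → ℝ} (hu : HPT u v J) {z : E2} (hz : 0 < z 0)
    {A : E2 → ℝ} (hA : ContDiff ℝ (⊤ : ℕ∞) A) (hAc : HasCompactSupport A) :
    ∃ κ : E2 → ℝ, ContDiff ℝ (⊤ : ℕ∞) κ ∧ HasCompactSupport κ ∧ (∀ y, κ (Ls z y) = A y) ∧
     (∀ y, fderiv ℝ A y (stdb2 0) = z 0 * fderiv ℝ κ (Ls z y) (stdb2 0) + z 1 * fderiv ℝ κ (Ls z y) (stdb2 1)) ∧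
     (∀ y, fderiv ℝ A y (stdb2 1) = fderiv ℝ κ (Ls z y) (stdb2 1)) ∧
     (∀ j : Fin 2, ∫ y in hplane, (u (Ls z y) * fderiv ℝ κ (Ls z y) (stdb2 j) + v j (Ls z y) * A y) =
       (z 0)⁻¹ * -(if j = 0 then J (fun t => A (EuclideanSpace.single 1 t)) else 0)) := by
  set e : E2 ≃L[ℝ] E2 := (LsE z hz.ne').toContinuousLinearEquiv with he
  have hLe : ∀ y, Ls z y = e y := fun y => Ls_eq z hz.ne' y
  set κ : E2 → ℝ := fun w => A (e.symm w) with hκ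
  have k1 : ContDiff ℝ (⊤ : ℕ∞) κ := hA.comp e.symm.contDiff
  have k2 : HasCompactSupport κ := hAc.comp_homeomorph e.symm.toHomeomorph
  have k3 : ∀ y, κ (Ls z y) = A y := fun y => by simp [hκ, hLe]
  have k4 : ∀ y d, fderiv ℝ A y d = fderiv ℝ κ (Ls z y) (e d) := by
    intro y d
    have h1 : A = κ ∘ e := by ext w; simp [hκ]
    have h2 : HasFDerivAt A ((fderiv ℝ κ (e y)).comp (e : E2 →L[ℝ] E2)) y := by
      rw [h1]
      exact ((k1.differentiable (by simp)) (e y)).hasFDerivAt.comp y e.hasFDerivAt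
    rw [h2.fderiv, hLe]; rfl
  have e0 : e (stdb2 0) = z 0 • stdb2 0 + z 1 • stdb2 1 := by
    rw [← hLe]
    ext j
    fin_cases j
    · simp [Ls_zero, stdb2]
    · simp [Ls_one, stdb2]
  have e1 : e (stdb2 1) = stdb2 1 := by
    rw [← hLe]
    ext j
    fin_cases j
    · simp [Ls_zero, stdb2]
    · simp [Ls_one, stdb2]
  refine ⟨κ, k1, k2, k3, ?_, ?_, ?_⟩
  · intro y; rw [k4, e0]; simp
  · intro y; rw [k4, e1]
  · intro j
    have h1 := Ls_integral hz (fun w => u w * fderiv ℝ κ w (stdb2 j) + v j w * κ w)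
    simp only [k3] at h1
    rw [h1, hu κ k1 k2 j]
    have : ∀ t : ℝ, κ (EuclideanSpace.single 1 t) = A (EuclideanSpace.single 1 t) := by
      intro t
      rw [← k3 (EuclideanSpace.single 1 t)]
      congr 1
      ext j
      fin_cases j
      · simp [Ls_zero]
      · simp [Ls_one]
    simp only [this]

lemma integral_add3 {α : Type*} [MeasurableSpace α] {μ : Measure α} {f g h : α → ℝ} (hf : Integrable f μ) (hg : Integrable g μ)
    (hh : Integrable h μ) : ∫ x, (f x + (g x + h x)) ∂μ = (∫ x, f x ∂μ) + ((∫ x, g x ∂μ) + ∫ x, h x ∂μ) := by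
  rw [← integral_add hg hh]; exact integral_add hf (hg.add hh)

lemma side_HPT {a : ℝ → ℝ} (ha : ContDiff ℝ (⊤ : ℕ∞) a) {K u : E2 → ℝ} {v : Fin 2 → E2 → ℝ} {J : (ℝ → ℝ) → ℝ}
    (hJ : ∀ (c : ℝ) (f : ℝ → ℝ), J (fun t => c * f t) = c * J f)
    (hu : HPT u v J) (hu2 : L2on hplane u) (hv2 : ∀ j, L2on hplane (v j))
    (hK : ContDiff ℝ (⊤ : ℕ∞) K) (hKc : HasCompactSupport K) (hK1 : ∀ z, K z ≠ 0 → 1 ≤ z 0) :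
    HPT (fun y => TT 1 a K u (embFace 0 y)) (fun m y => TTD 1 a K u v ((0 : Fin 3).succAbove m) (embFace 0 y))
      (fun f => a 0 * (∫ z, K z) * J f) := by
  obtain ⟨f, fm, f2, fe, fA⟩ := AA_rep hu2
  choose g gm g2 ge gA using fun j => AA_rep (hv2 j)
  have fe' : ∀ᵐ w ∂(volume.restrict hplane), f w = u w := by
    filter_upwards [ae_restrict_of_ae fe, ae_restrict_mem measurableSet_hplane] with w hw hwh
    have : 0 ≤ w 0 := le_of_lt hwh
    rw [hw]; simp [uz, this]
  have ge' : ∀ j, ∀ᵐ w ∂(volume.restrict hplane), g j w = v j w := by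
    intro j
    filter_upwards [ae_restrict_of_ae (ge j), ae_restrict_mem measurableSet_hplane] with w hw hwh
    have : 0 ≤ w 0 := le_of_lt hwh
    rw [hw]; simp [uz, this]
  have hfg : HPT f g J := by
    intro κ hκ hc d
    rw [← hu κ hκ hc d]
    apply integral_congr_ae
    filter_upwards [fe', ge' d] with w h1 h2
    rw [h1, h2]
  intro κ hκ hc d
  set A : E2 → ℝ := fun y => a (y 0) * κ y with hAd
  have ha0 : ContDiff ℝ (⊤ : ℕ∞) (fun y : E2 => a (y 0)) := ha.comp (by fun_prop)
  have hA : ContDiff ℝ (⊤ : ℕ∞) A := ha0.mul hκ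
  have hAc : HasCompactSupport A := hc.mul_left
  have dA : ∀ y, ∀ j : Fin 2, HasFDerivAt A (a (y 0) • fderiv ℝ κ y + κ y • (deriv a (y 0) • (EuclideanSpace.proj 0 : E2 →L[ℝ] ℝ))) y := by
    intro y j
    have h1 : HasFDerivAt (fun y : E2 => a (y 0)) (deriv a (y 0) • (EuclideanSpace.proj 0 : E2 →L[ℝ] ℝ)) y :=
      ((ha.differentiable (by simp)) (y 0)).hasDerivAt.comp_hasFDerivAt y (EuclideanSpace.proj 0 : E2 →L[ℝ] ℝ).hasFDerivAt
    exact h1.mul ((hκ.differentiable (by simp)) y).hasFDerivAt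
  have dA0 : ∀ y, fderiv ℝ A y (stdb2 0) = a (y 0) * fderiv ℝ κ y (stdb2 0) + deriv a (y 0) * κ y := by
    intro y; rw [(dA y 0).fderiv]; simp [stdb2]; ring
  have dA1 : ∀ y, fderiv ℝ A y (stdb2 1) = a (y 0) * fderiv ℝ κ y (stdb2 1) := by
    intro y; rw [(dA y 0).fderiv]; simp [stdb2]
  have cdA : ∀ j, Continuous (fun y => fderiv ℝ A y (stdb2 j)) := fun j => (hA.continuous_fderiv (by simp)).clm_apply continuous_const
  have ccA : ∀ j, HasCompactSupport (fun y => fderiv ℝ A y (stdb2 j)) := fun j => hAc.fderiv_apply (𝕜 := ℝ) _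
  have hKz : ∀ j, ContDiff ℝ (⊤ : ℕ∞) (Kz K j) := fun j => Kz_smooth hK j
  have hKzc : ∀ j, HasCompactSupport (Kz K j) := fun j => HasCompactSupport.mul_left (f := fun z : E2 => z j) hKc
  have hKz1 : ∀ j, ∀ z, Kz K j z ≠ 0 → 1 ≤ z 0 := fun j z hz => hK1 z (fun h => hz (by simp [Kz, h]))
  -- integrability facts
  have P1 : ∀ {k h q : E2 → ℝ}, Continuous k → HasCompactSupport k → (∀ z, k z ≠ 0 → 1 ≤ z 0) → Measurable h → MemLp h 2 →
      Continuous q → HasCompactSupport q → IntegrableOn (fun y => (∫ z, k z * h (Ls z y)) * q y) hplane := by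
    intro k h q c1 c2 c3 c4 c5 c6 c7
    have := (side_int c1 c2 c3 c4 c5 c6 c7).integral_prod_left
    refine this.congr (Eventually.of_forall fun y => ?_)
    simp only [← mul_assoc, integral_mul_const]
  have P2 : ∀ {k h q : E2 → ℝ}, Continuous k → HasCompactSupport k → (∀ z, k z ≠ 0 → 1 ≤ z 0) → Measurable h → MemLp h 2 →
      Continuous q → HasCompactSupport q → Integrable (fun z => k z * ∫ y in hplane, h (Ls z y) * q y) := by
    intro k h q c1 c2 c3 c4 c5 c6 c7
    have := (side_int c1 c2 c3 c4 c5 c6 c7).integral_prod_right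
    refine this.congr (Eventually.of_forall fun y => ?_)
    simp only [integral_const_mul]
  have P3 : ∀ {z : E2} {h q : E2 → ℝ}, 0 < z 0 → Measurable h → MemLp h 2 → Continuous q → HasCompactSupport q →
      IntegrableOn (fun y => h (Ls z y) * q y) hplane := by
    intro z h q hz c4 c5 c6 c7
    have m1 : MemLp (fun y => h (Ls z y)) 2 (volume.restrict hplane) := by
      have : MemLp h 2 (Measure.map (Ls z) (volume.restrict hplane)) := by
        rw [Ls_map hz]
        exact (c5.restrict _).smul_measure (by simp)
      exact (Ls_emb hz).memLp_map_measure_iff.1 this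
    exact integrable_mul_test m1 c6 c7
  have kc := hK.continuous
  fin_cases d
  · simp only [Fin.zero_eta, Fin.isValue, if_true]
    have s1 : (0 : Fin 3).succAbove 0 = 1 := rfl
    rw [s1]
    have L : ∫ x in hplane, (TT 1 a K u (embFace 0 x) * fderiv ℝ κ x (stdb2 0) + TTD 1 a K u v 1 (embFace 0 x) * κ x)
        = ∫ y in hplane, ((∫ z, K z * f (Ls z y)) * fderiv ℝ A y (stdb2 0) + ((∫ z, Kz K 0 z * g 0 (Ls z y)) * A y + (∫ z, Kz K 1 z * g 1 (Ls z y)) * A y)) := by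
      refine setIntegral_congr_fun measurableSet_hplane fun y hy => ?_
      simp only [TTD_i, side_eq, Fin.sum_univ_two]
      rw [fA _ _ _ hy, gA _ _ _ _ hy, gA _ _ _ _ hy, dA0]
      simp only [hAd, Ls]; ring
    have i1 := P1 kc hKc hK1 fm f2 (cdA 0) (ccA 0)
    have i2 := P1 (hKz 0).continuous (hKzc 0) (hKz1 0) (gm 0) (g2 0) hA.continuous hAc
    have i3 := P1 (hKz 1).continuous (hKzc 1) (hKz1 1) (gm 1) (g2 1) hA.continuous hAc
    have j1 := P2 kc hKc hK1 fm f2 (cdA 0) (ccA 0)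
    have j2 := P2 (hKz 0).continuous (hKzc 0) (hKz1 0) (gm 0) (g2 0) hA.continuous hAc
    have j3 := P2 (hKz 1).continuous (hKzc 1) (hKz1 1) (gm 1) (g2 1) hA.continuous hAc
    rw [L, integral_add3 i1 i2 i3,
      side_swap kc hKc hK1 fm f2 (cdA 0) (ccA 0), side_swap (hKz 0).continuous (hKzc 0) (hKz1 0) (gm 0) (g2 0) hA.continuous hAc,
      side_swap (hKz 1).continuous (hKzc 1) (hKz1 1) (gm 1) (g2 1) hA.continuous hAc, ← integral_add3 j1 j2 j3]
    have e : ∀ z, K z * (∫ y in hplane, f (Ls z y) * fderiv ℝ A y (stdb2 0)) + (Kz K 0 z * (∫ y in hplane, g 0 (Ls z y) * A y) + Kz K 1 z * (∫ y in hplane, g 1 (Ls z y) * A y))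
        = K z * -(a 0 * J (fun t => κ (EuclideanSpace.single 1 t))) := by
      intro z
      by_cases hz : K z = 0
      · simp [Kz, hz]
      have hz1 := hK1 z hz
      have hz0 : 0 < z 0 := by linarith
      obtain ⟨k, k1, k2, k3, k4, k5, k6⟩ := slice_HPT hfg hz0 hA hAc
      have q : ∀ j, Continuous (fun y => fderiv ℝ k (Ls z y) (stdb2 j)) ∧ HasCompactSupport (fun y => fderiv ℝ k (Ls z y) (stdb2 j)) := by
        intro j
        refine ⟨((k1.continuous_fderiv (by simp)).comp (continuous_Ls.comp (by fun_prop : Continuous fun y : E2 => (y, z)))).clm_apply continuous_const, ?_⟩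
        fin_cases j
        · have : (fun y => fderiv ℝ k (Ls z y) (stdb2 0)) = fun y => (z 0)⁻¹ * (fderiv ℝ A y (stdb2 0) + -(z 1 * fderiv ℝ A y (stdb2 1))) := by
            ext y; rw [k4, k5]; field_simp; ring
          simp only [Fin.zero_eta, Fin.isValue]
          rw [this]
          exact ((ccA 0).add ((ccA 1).mul_left (f := fun _ => z 1)).neg).mul_left
        · simp only [Fin.mk_one, Fin.isValue]
          simp only [← k5]; exact ccA 1
      have h0 := k6 0
      have h1 := k6 1
      rw [integral_add (P3 hz0 fm f2 (q 0).1 (q 0).2) (P3 hz0 (gm 0) (g2 0) hA.continuous hAc)] at h0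
      rw [integral_add (P3 hz0 fm f2 (q 1).1 (q 1).2) (P3 hz0 (gm 1) (g2 1) hA.continuous hAc)] at h1
      have h2 : ∫ y in hplane, f (Ls z y) * fderiv ℝ A y (stdb2 0) = z 0 * (∫ y in hplane, f (Ls z y) * fderiv ℝ k (Ls z y) (stdb2 0))
          + z 1 * (∫ y in hplane, f (Ls z y) * fderiv ℝ k (Ls z y) (stdb2 1)) := by
        rw [← integral_const_mul, ← integral_const_mul, ← integral_add ((P3 hz0 fm f2 (q 0).1 (q 0).2).const_mul _) ((P3 hz0 fm f2 (q 1).1 (q 1).2).const_mul _)]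
        congr 1; ext y; rw [k4]; ring
      have h3 : J (fun t => A (EuclideanSpace.single 1 t)) = a 0 * J (fun t => κ (EuclideanSpace.single 1 t)) := by
        rw [← hJ]; congr 1
      simp only [if_true, one_ne_zero, if_false, neg_zero, mul_zero, h3] at h0 h1
      rw [h2]
      simp only [Kz]
      have h4 : z 0 * ((∫ y in hplane, f (Ls z y) * fderiv ℝ k (Ls z y) (stdb2 0)) + ∫ y in hplane, g 0 (Ls z y) * A y)
          = -(a 0 * J (fun t => κ (EuclideanSpace.single 1 t))) := by
        rw [h0]; field_simp
      linear_combination K z * h4 + K z * z 1 * h1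
    simp only [e]
    rw [integral_mul_const]; ring
  · simp only [Fin.mk_one, Fin.isValue, one_ne_zero, if_false, neg_zero]
    have s1 : (0 : Fin 3).succAbove 1 = 2 := rfl
    rw [s1]
    have t2 := TTD_2 1 a K u v
    simp only [Fin.castSucc_one] at t2
    have L : ∫ x in hplane, (TT 1 a K u (embFace 0 x) * fderiv ℝ κ x (stdb2 1) + TTD 1 a K u v 2 (embFace 0 x) * κ x)
        = ∫ y in hplane, ((∫ z, K z * f (Ls z y)) * fderiv ℝ A y (stdb2 1) + (∫ z, K z * g 1 (Ls z y)) * A y) := by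
      refine setIntegral_congr_fun measurableSet_hplane fun y hy => ?_
      simp only [t2, side_eq]
      rw [fA _ _ _ hy, gA _ _ _ _ hy, dA1]
      simp only [hAd, Ls]; ring
    rw [L, integral_add (P1 kc hKc hK1 fm f2 (cdA 1) (ccA 1)) (P1 kc hKc hK1 (gm 1) (g2 1) hA.continuous hAc),
      side_swap kc hKc hK1 fm f2 (cdA 1) (ccA 1), side_swap kc hKc hK1 (gm 1) (g2 1) hA.continuous hAc,
      ← integral_add (P2 kc hKc hK1 fm f2 (cdA 1) (ccA 1)) (P2 kc hKc hK1 (gm 1) (g2 1) hA.continuous hAc)]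
    apply integral_eq_zero_of_ae
    refine Eventually.of_forall fun z => ?_
    simp only [Pi.zero_apply]
    by_cases hz : K z = 0
    · simp [hz]
    have hz1 := hK1 z hz
    have hz0 : 0 < z 0 := by linarith
    obtain ⟨k, k1, k2, k3, k4, k5, k6⟩ := slice_HPT hfg hz0 hA hAc
    have h1 := k6 1
    simp only [← k5] at h1
    rw [integral_add (P3 hz0 fm f2 (cdA 1) (ccA 1)) (P3 hz0 (gm 1) (g2 1) hA.continuous hAc)] at h1
    simp only [one_ne_zero, if_false, neg_zero, mul_zero] at h1
    rw [← mul_add, h1, mul_zero]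

end

section
/-! ### Part 10 : good functions with traces on the side face; the lift -/

open Filter Topology
open scoped ENNReal

lemma hp_integrable {F DF κ : E2 → ℝ} (hκ : ContDiff ℝ (⊤ : ℕ∞) κ) (hc : HasCompactSupport κ) (hF : L2on hplane F)
    (hDF : L2on hplane DF) (d : Fin 2) : IntegrableOn (fun x => F x * fderiv ℝ κ x (stdb2 d) + DF x * κ x) hplane := by
  refine Integrable.add (integrable_mul_test hF ?_ ?_) (integrable_mul_test hDF hκ.continuous hc)
  · exact ((hκ.continuous_fderiv (by simp)).clm_apply continuous_const)
  · exact hc.fderiv_apply (𝕜 := ℝ) _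

lemma HPT.add {u u' : E2 → ℝ} {v v' : Fin 2 → E2 → ℝ} {J J' : (ℝ → ℝ) → ℝ} (h : HPT u v J) (h' : HPT u' v' J')
    (l : L2on hplane u) (l' : L2on hplane u') (lv : ∀ j, L2on hplane (v j)) (lv' : ∀ j, L2on hplane (v' j)) :
    HPT (fun y => u y + u' y) (fun j y => v j y + v' j y) (fun f => J f + J' f) := by
  intro κ hκ hc d
  have e : ∀ x, (u x + u' x) * fderiv ℝ κ x (stdb2 d) + (v d x + v' d x) * κ x =
    (u x * fderiv ℝ κ x (stdb2 d) + v d x * κ x) + (u' x * fderiv ℝ κ x (stdb2 d) + v' d x * κ x) := fun x => by ring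
  simp only [e]
  rw [integral_add (hp_integrable hκ hc l (lv d) d) (hp_integrable hκ hc l' (lv' d) d), h κ hκ hc d, h' κ hκ hc d]
  split_ifs <;> ring

lemma HPT.neg {u : E2 → ℝ} {v : Fin 2 → E2 → ℝ} {J : (ℝ → ℝ) → ℝ} (h : HPT u v J) :
    HPT (fun y => - u y) (fun j y => - v j y) (fun f => - J f) := by
  intro κ hκ hc d
  have e : ∀ x, (- u x) * fderiv ℝ κ x (stdb2 d) + (- v d x) * κ x =
    -(u x * fderiv ℝ κ x (stdb2 d) + v d x * κ x) := fun x => by ring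
  simp only [e]
  rw [integral_neg, h κ hκ hc d]
  split_ifs <;> ring

lemma HPT.congr {u u' : E2 → ℝ} {v v' : Fin 2 → E2 → ℝ} {J : (ℝ → ℝ) → ℝ} (h : HPT u v J)
    (h1 : ∀ y ∈ hplane, u y = u' y) (h2 : ∀ j, ∀ y ∈ hplane, v j y = v' j y) : HPT u' v' J := by
  intro κ hκ hc d
  rw [← h κ hκ hc d]
  refine setIntegral_congr_fun measurableSet_hplane fun y hy => ?_
  simp only [h1 y hy, h2 d y hy]

lemma L2on_congr_hp {u u' : E2 → ℝ} (h : L2on hplane u) (h1 : ∀ y ∈ hplane, u y = u' y) : L2on hplane u' :=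
  (memLp_congr_ae (by filter_upwards [ae_restrict_mem measurableSet_hplane] with x hx using h1 x hx)).1 h

/-- the set where lifted terms may be compared -/
def Wi (i o : Fin 2) : Set E3 := {x | 0 < x i.castSucc ∧ 0 ≤ x o.castSucc}

structure Gd (i o : Fin 2) (F : E3 → ℝ) (DF : Fin 3 → E3 → ℝ) (b : E2 → ℝ) (J : (ℝ → ℝ) → ℝ) : Prop where
  good : Good F DF (fun j y => if j = i then b y else F (embFace o.castSucc y))
  sd : ∀ m, L2on hplane (fun y => DF (o.castSucc.succAbove m) (embFace o.castSucc y))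
  hpt : HPT (fun y => F (embFace o.castSucc y)) (fun m y => DF (o.castSucc.succAbove m) (embFace o.castSucc y)) J

lemma Gd.sl {i o : Fin 2} (hio : o ≠ i) {F : E3 → ℝ} {DF : Fin 3 → E3 → ℝ} {b : E2 → ℝ} {J : (ℝ → ℝ) → ℝ} (h : Gd i o F DF b J) :
    L2on hplane (fun y => F (embFace o.castSucc y)) := by
  have := h.good.lb o
  simpa [hio] using this

lemma Gd.congr {i o : Fin 2} (hio : o ≠ i) {F F' : E3 → ℝ} {DF DF' : Fin 3 → E3 → ℝ} {b b' : E2 → ℝ} {J J' : (ℝ → ℝ) → ℝ} (h : Gd i o F DF b J)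
    (h1 : ∀ x ∈ Wi i o, F x = F' x) (h2 : ∀ d, ∀ x ∈ Wi i o, DF d x = DF' d x) (h3 : ∀ y, b y = b' y) (h4 : ∀ f, J f = J' f) :
    Gd i o F' DF' b' J' := by
  have hw : ∀ x ∈ wedge, x ∈ Wi i o := by
    intro x hx
    exact ⟨wedge_sub_W i hx, le_of_lt (wedge_sub_W o hx)⟩
  have hcs : i.castSucc = o.castSucc.succAbove 0 := by
    fin_cases i <;> fin_cases o <;> first | rfl | (exact absurd rfl hio)
  have he : ∀ y ∈ hplane, embFace o.castSucc y ∈ Wi i o := by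
    intro y hy
    refine ⟨?_, ?_⟩
    · rw [hcs, embFace_succAbove]; exact hy
    · rw [embFace_same]
  have e : J = J' := funext h4
  subst e
  refine ⟨h.good.congr (fun x hx => h1 x (hw x hx)) (fun d x hx => h2 d x (hw x hx)) ?_, ?_, ?_⟩
  · intro j
    filter_upwards [ae_restrict_mem measurableSet_hplane] with y hy
    rw [h3, h1 _ (he y hy)]
  · exact fun m => L2on_congr_hp (h.sd m) fun y hy => h2 _ _ (he y hy)
  · exact h.hpt.congr (fun y hy => h1 _ (he y hy)) fun m y hy => h2 _ _ (he y hy)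

lemma Gd.add {i o : Fin 2} (hio : o ≠ i) {F F' : E3 → ℝ} {DF DF' : Fin 3 → E3 → ℝ} {b b' : E2 → ℝ} {J J' : (ℝ → ℝ) → ℝ}
    (h : Gd i o F DF b J) (h' : Gd i o F' DF' b' J') :
    Gd i o (fun x => F x + F' x) (fun d x => DF d x + DF' d x) (fun y => b y + b' y) (fun f => J f + J' f) := by
  refine ⟨(h.good.add h'.good).congr (fun _ _ => rfl) (fun _ _ _ => rfl) ?_, ?_, ?_⟩
  · intro j
    refine Eventually.of_forall fun y => ?_
    by_cases hj : j = i <;> simp [hj]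
  · exact fun m => (h.sd m).add (h'.sd m)
  · exact h.hpt.add h'.hpt (h.sl hio) (h'.sl hio) h.sd h'.sd

lemma Gd.neg {i o : Fin 2} {F : E3 → ℝ} {DF : Fin 3 → E3 → ℝ} {b : E2 → ℝ} {J : (ℝ → ℝ) → ℝ}
    (h : Gd i o F DF b J) :
    Gd i o (fun x => - F x) (fun d x => - DF d x) (fun y => - b y) (fun f => - J f) := by
  refine ⟨(h.good.neg).congr (fun _ _ => rfl) (fun _ _ _ => rfl) ?_, ?_, ?_⟩
  · intro j
    refine Eventually.of_forall fun y => ?_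
    by_cases hj : j = i <;> simp [hj]
  · exact fun m => (h.sd m).neg
  · exact h.hpt.neg

/-- data for lifting -/
structure Dat (D : Set E2) (u : E2 → ℝ) (v : Fin 2 → E2 → ℝ) (J : (ℝ → ℝ) → ℝ) : Prop where
  h1 : H1 D u v
  hpt : HPT u v J
  hom : ∀ (c : ℝ) (f : ℝ → ℝ), J (fun t => c * f t) = c * J f

/-- the basic property of a lifting procedure -/
def Base (i o : Fin 2) (D : Set E2) (ρ : E2 → ℝ) : Prop :=
  ∀ (a : ℝ → ℝ) (K u : E2 → ℝ) (v : Fin 2 → E2 → ℝ) (J : (ℝ → ℝ) → ℝ), ContDiff ℝ (⊤ : ℕ∞) a → HasCompactSupport a →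
    KC D K → tsupport K ⊆ tsupport ρ → Dat D u v J →
    Gd i o (TT i.castSucc a K u) (TTD i.castSucc a K u v) (fun y => a 0 * (∫ z, K z) * u y) (fun f => a 0 * (∫ z, K z) * J f)

lemma base_in {ρ : E2 → ℝ} (hρ : ∀ z ∈ tsupport ρ, 1 ≤ z 0) : Base 1 0 hplane ρ := by
  intro a K u v J ha hac hK hKs hu
  have hK1 : ∀ z, K z ≠ 0 → 1 ≤ z 0 := fun z hz => hρ z (hKs (subset_tsupport K hz))
  have hKz1 : ∀ j, ∀ z, Kz K j z ≠ 0 → 1 ≤ z 0 := fun j z hz => hK1 z (fun h => hz (by simp [Kz, h]))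
  have hda : ContDiff ℝ (⊤ : ℕ∞) (deriv a) := ha.iterate_deriv 1
  refine ⟨(TT_good 1 ha hac hu.h1 hK (side_L2 ha.continuous hac hu.h1.l2u hK.smooth hK.cpt hK1)).congr (fun _ _ => rfl) (fun _ _ _ => rfl) ?_, ?_, ?_⟩
  · intro j
    refine Eventually.of_forall fun y => ?_
    fin_cases j
    · simp [TTb]
    · simp [TTb]
  · intro m
    fin_cases m
    · have : (Fin.castSucc (0 : Fin 2)).succAbove 0 = (1 : Fin 2).castSucc := rfl
      simp only [Fin.zero_eta, Fin.isValue]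
      rw [this, TTD_i]
      simp only [Fin.sum_univ_two]
      exact (side_L2 hda.continuous hac.deriv hu.h1.l2u hK.smooth hK.cpt hK1).add
        ((side_L2 ha.continuous hac (hu.h1.l2v 0) (hK.z 0).smooth (hK.z 0).cpt (hKz1 0)).add
         (side_L2 ha.continuous hac (hu.h1.l2v 1) (hK.z 1).smooth (hK.z 1).cpt (hKz1 1)))
    · have : (Fin.castSucc (0 : Fin 2)).succAbove 1 = 2 := rfl
      simp only [Fin.mk_one, Fin.isValue]
      rw [this, TTD_2]
      exact side_L2 ha.continuous hac (hu.h1.l2v 1) hK.smooth hK.cpt hK1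
  · exact side_HPT ha hu.hom hu.hpt hu.h1.l2u hu.h1.l2v hK.smooth hK.cpt hK1

lemma AA_out {K u : E2 → ℝ} (hK1 : ∀ z, K z ≠ 0 → z 0 < 0) {y : E2} (hy : y 0 = 0) {n : ℝ} (hn : 0 < n) : AA K u y n = 0 := by
  unfold AA
  apply integral_eq_zero_of_ae
  refine Eventually.of_forall fun z => ?_
  by_cases hz : K z = 0
  · simp [hz]
  have h1 := hK1 z hz
  have : ¬ (0 ≤ (y + n • z) 0) := by
    simp only [PiLp.add_apply, PiLp.smul_apply, hy, smul_eq_mul, zero_add, not_le]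
    exact mul_neg_of_pos_of_neg hn h1
  simp only [uz, Pi.zero_apply]
  have h2 : (y + n • z) ∉ {y : E2 | 0 ≤ y 0} := this
  first
    | rw [indicator_of_notMem h2, mul_zero]
    | (have h3 : (y + n • z) ∉ hplane := fun h => this (le_of_lt h)
       rw [indicator_of_notMem h3, mul_zero])

lemma TT_out {a : ℝ → ℝ} {K u : E2 → ℝ} (hK1 : ∀ z, K z ≠ 0 → z 0 < 0) {y : E2} (hy : y ∈ hplane) : TT 0 a K u (embFace 1 y) = 0 := by
  have e1 : embFace 1 y 0 = y 0 := embFace_succAbove 1 y 0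
  have e2 : py 0 (embFace 1 y) 0 = 0 := by rw [py_apply]; exact embFace_same 1 y
  rw [TT, e1, AA_out hK1 e2 hy, mul_zero]

lemma base_out {ρ : E2 → ℝ} (hρ : ∀ z ∈ tsupport ρ, z 0 < 0) : ∀ (a : ℝ → ℝ) (K u : E2 → ℝ) (v : Fin 2 → E2 → ℝ), ContDiff ℝ (⊤ : ℕ∞) a → HasCompactSupport a →
    KC univ K → tsupport K ⊆ tsupport ρ → H1 univ u v →
    Gd 0 1 (TT 0 a K u) (TTD 0 a K u v) (fun y => a 0 * (∫ z, K z) * u y) (fun f => 0) := by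
  intro a K u v ha hac hK hKs hu
  have hK1 : ∀ z, K z ≠ 0 → z 0 < 0 := fun z hz => hρ z (hKs (subset_tsupport K hz))
  have hKz1 : ∀ j, ∀ z, Kz K j z ≠ 0 → z 0 < 0 := fun j z hz => hK1 z (fun h => hz (by simp [Kz, h]))
  have l0 : L2on hplane (fun _ => (0:ℝ)) := MemLp.zero
  have zd : ∀ m, ∀ y ∈ hplane, TTD 0 a K u v ((1 : Fin 3).succAbove m) (embFace 1 y) = 0 := by
    intro m y hy
    fin_cases m
    · have : (1 : Fin 3).succAbove 0 = 0 := rfl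
      simp only [Fin.zero_eta, Fin.isValue]
      rw [this, TTD_i]
      simp only [Fin.sum_univ_two]
      rw [TT_out hK1 hy, TT_out (hKz1 0) hy, TT_out (hKz1 1) hy]; simp
    · have : (1 : Fin 3).succAbove 1 = 2 := rfl
      simp only [Fin.mk_one, Fin.isValue]
      have t2 := TTD_2 0 a K u v
      simp only [Fin.castSucc_zero] at t2
      rw [this, t2, TT_out hK1 hy]
  refine ⟨(TT_good 0 ha hac hu hK (L2on_congr_hp l0 fun y hy => (TT_out hK1 hy).symm)).congr (fun _ _ => rfl) (fun _ _ _ => rfl) ?_, ?_, ?_⟩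
  · intro j
    refine Eventually.of_forall fun y => ?_
    fin_cases j
    · simp [TTb]
    · simp [TTb]
  · exact fun m => L2on_congr_hp l0 fun y hy => (zd m y hy).symm
  · have h0 : HPT (fun _ => 0) (fun _ _ => 0) (fun _ => 0) := by
      intro κ _ _ d; simp
    exact h0.congr (fun y hy => (TT_out hK1 hy).symm) (fun m y hy => (zd m y hy).symm)

lemma base_out' {ρ : E2 → ℝ} (hρ : ∀ z ∈ tsupport ρ, z 0 < 0) {a : ℝ → ℝ} {K u : E2 → ℝ} {v : Fin 2 → E2 → ℝ} {J : (ℝ → ℝ) → ℝ} (h : ∀ f, J f = 0)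
    (ha : ContDiff ℝ (⊤ : ℕ∞) a) (hac : HasCompactSupport a) (hK : KC univ K) (hs : tsupport K ⊆ tsupport ρ) (hu : H1 univ u v) :
    Gd 0 1 (TT 0 a K u) (TTD 0 a K u v) (fun y => a 0 * (∫ z, K z) * u y) (fun f => a 0 * (∫ z, K z) * J f) :=
  (base_out hρ a K u v ha hac hK hs hu).congr (by decide) (fun _ _ => rfl) (fun _ _ _ => rfl) (fun _ => rfl) (fun f => by simp [h])

end

section
/-! ### Part 11 : the lift of a pair (φ, ψ) -/

open Filter Topology
open scoped ENNReal

lemma int_Kd {K : E2 → ℝ} (hK : ContDiff ℝ (⊤ : ℕ∞) K) (hc : HasCompactSupport K) (j : Fin 2) : ∫ z, Kd K j z = 0 := by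
  have h := integral_mul_fderiv_eq_neg_fderiv_mul_of_integrable (𝕜 := ℝ) (μ := (volume : Measure E2)) (f := fun _ : E2 => (1:ℝ)) (g := K) (v := stdb2 j)
    (by simp) (by
      simp only [one_mul]
      exact ((Kd_smooth hK j).continuous).integrable_of_hasCompactSupport (hc.fderiv_apply (𝕜 := ℝ) _))
    (by simpa using hK.continuous.integrable_of_hasCompactSupport hc)
    (fun _ _ => differentiableAt_const _) (fun x _ => (hK.differentiable (by simp)) x)
  simpa [Kd] using h

/-- basic lifting property for a given datum -/
def BaseFor (i o : Fin 2) (D : Set E2) (ρ u : E2 → ℝ) (v : Fin 2 → E2 → ℝ) (J : (ℝ → ℝ) → ℝ) : Prop :=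
  ∀ (a : ℝ → ℝ) (K : E2 → ℝ), ContDiff ℝ (⊤ : ℕ∞) a → HasCompactSupport a →
    KC D K → tsupport K ⊆ tsupport ρ →
    Gd i o (TT i.castSucc a K u) (TTD i.castSucc a K u v) (fun y => a 0 * (∫ z, K z) * u y) (fun f => a 0 * (∫ z, K z) * J f)

/-- splitting of directions -/
def cs3 (i : Fin 2) {α : Type} (N T0 T1 : α) (d : Fin 3) : α :=
  if d = i.castSucc then N else if d = i.castSucc.succAbove 0 then T0 else T1

lemma cs3_n (i : Fin 2) {α : Type} (N T0 T1 : α) : cs3 i N T0 T1 i.castSucc = N := by simp [cs3]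
lemma cs3_0 (i : Fin 2) {α : Type} (N T0 T1 : α) : cs3 i N T0 T1 (i.castSucc.succAbove 0) = T0 := by
  have : i.castSucc.succAbove 0 ≠ i.castSucc := Fin.succAbove_ne _ _
  rw [cs3, if_neg this, if_pos rfl]
lemma cs3_1 (i : Fin 2) {α : Type} (N T0 T1 : α) : cs3 i N T0 T1 (i.castSucc.succAbove 1) = T1 := by
  have : i.castSucc.succAbove 1 ≠ i.castSucc := Fin.succAbove_ne _ _
  have h2 : i.castSucc.succAbove 1 ≠ i.castSucc.succAbove 0 := fun h => by
    simpa using Fin.succAbove_right_injective h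
  rw [cs3, if_neg this, if_neg h2]
lemma cs3_ex (i : Fin 2) (d : Fin 3) : d = i.castSucc ∨ d = i.castSucc.succAbove 0 ∨ d = i.castSucc.succAbove 1 := by
  fin_cases i <;> fin_cases d <;> decide

/-- the one-dimensional profiles -/
structure Prof (c : ℝ → ℝ) : Prop where
  sm : ContDiff ℝ (⊤ : ℕ∞) c
  cp : HasCompactSupport c
  c0 : c 0 = 1
  d0 : deriv c 0 = 0

def nc (c : ℝ → ℝ) (n : ℝ) : ℝ := n * c n

lemma Prof.nsm {c : ℝ → ℝ} (h : Prof c) : ContDiff ℝ (⊤ : ℕ∞) (nc c) := contDiff_id.mul h.sm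
lemma Prof.ncp {c : ℝ → ℝ} (h : Prof c) : HasCompactSupport (nc c) := h.cp.mul_left
lemma Prof.nd0 {c : ℝ → ℝ} (h : Prof c) : deriv (nc c) 0 = 1 := by
  have h1 : HasDerivAt (nc c) (1 * c 0 + 0 * deriv c 0) 0 :=
    (hasDerivAt_id (0:ℝ)).mul ((h.sm.differentiable (by simp)) 0).hasDerivAt
  rw [h1.deriv, h.c0]; simp

lemma TT_nc {i o : Fin 2} (hio : o ≠ i) {D : Set E2} {K u : E2 → ℝ} {v : Fin 2 → E2 → ℝ} (hu : H1 D u v) (hK : KC D K) (c : ℝ → ℝ)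
    {x : E3} (hx : x ∈ Wi i o) (j : Fin 2) :
    TT i.castSucc (nc c) K (v j) x = - TT i.castSucc c (Kd K j) u x := by
  have hcs : i.castSucc.succAbove 0 = o.castSucc := by
    fin_cases i <;> fin_cases o <;> first | rfl | (exact absurd rfl hio)
  have hy : 0 ≤ (py i.castSucc x) 0 := by rw [py_apply, hcs]; exact hx.2
  simp only [TT, nc]
  rw [AA_ibp hu hK hy hx.1 j]; ring

lemma lift {i o : Fin 2} (hio : o ≠ i) {D : Set E2} {ρ : E2 → ℝ} {c : ℝ → ℝ} (hc : Prof c) (hρ : KC D ρ) (hρ1 : ∫ z, ρ z = 1)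
    (hρz : ∀ j, ∫ z, Kz ρ j z = 0) {φ ψ : E2 → ℝ} {Gφ Gψ : Fin 2 → E2 → ℝ} {Hφ : Fin 2 → Fin 2 → E2 → ℝ}
    {Jφ Jψ : (ℝ → ℝ) → ℝ} {JG : Fin 2 → (ℝ → ℝ) → ℝ} (hψ : H1 D ψ Gψ)
    (bφ : BaseFor i o D ρ φ Gφ Jφ) (bψ : BaseFor i o D ρ ψ Gψ Jψ) (bG : ∀ j, BaseFor i o D ρ (Gφ j) (Hφ j) (JG j)) :
    ∃ (G : Fin 3 → E3 → ℝ) (H : Fin 3 → Fin 3 → E3 → ℝ), Gd i o (fun x => TT i.castSucc c ρ φ x + TT i.castSucc (nc c) ρ ψ x) G φ Jφ ∧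
      Gd i o (G i.castSucc) (H i.castSucc) ψ Jψ ∧
      (∀ j, Gd i o (G (i.castSucc.succAbove j)) (H (i.castSucc.succAbove j)) (Gφ j) (JG j)) ∧
      ∀ x, (∀ (a : ℝ → ℝ) (K u : E2 → ℝ), tsupport K ⊆ tsupport ρ → TT i.castSucc a K u x = 0) → ∀ d, G d x = 0 := by
  have hdc : ContDiff ℝ (⊤ : ℕ∞) (deriv c) := hc.sm.iterate_deriv 1
  have hdn : ContDiff ℝ (⊤ : ℕ∞) (deriv (nc c)) := hc.nsm.iterate_deriv 1
  have r0 : tsupport ρ ⊆ tsupport ρ := subset_rfl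
  have kz := hρ.z
  have kd := hρ.d
  have kzd := fun j => (hρ.z j).d j
  have sz := Kz_tsupport ρ
  have sd := Kd_tsupport ρ
  have szd := fun j => (Kd_tsupport (Kz ρ j) j).trans (Kz_tsupport ρ j)
  -- tangential pieces
  have gt : ∀ j, Gd i o (fun x => TT i.castSucc c ρ (Gφ j) x + - TT i.castSucc c (Kd ρ j) ψ x) _ _ _ := fun j =>
    ((bG j) c ρ hc.sm hc.cp hρ r0).add hio (bψ c _ hc.sm hc.cp (kd j) (sd j)).neg
  have gn : Gd i o (fun x => (TT i.castSucc (deriv c) ρ φ x + TT i.castSucc (deriv (nc c)) ρ ψ x) +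
      ((TT i.castSucc c (Kz ρ 0) (Gφ 0) x + TT i.castSucc c (Kz ρ 1) (Gφ 1) x) +
       -(TT i.castSucc c (Kd (Kz ρ 0) 0) ψ x + TT i.castSucc c (Kd (Kz ρ 1) 1) ψ x))) _ _ _ :=
    ((bφ _ ρ hdc hc.cp.deriv hρ r0).add hio (bψ _ ρ hdn hc.ncp.deriv hρ r0)).add hio
      (((bG 0 c _ hc.sm hc.cp (kz 0) (sz 0)).add hio (bG 1 c _ hc.sm hc.cp (kz 1) (sz 1))).add hio
        ((bψ c _ hc.sm hc.cp (kzd 0) (szd 0)).add hio (bψ c _ hc.sm hc.cp (kzd 1) (szd 1))).neg)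
  have gz := (bφ c ρ hc.sm hc.cp hρ r0).add hio (bψ (nc c) ρ hc.nsm hc.ncp hρ r0)
  have ik : ∀ j, ∫ z, Kd ρ j z = 0 := int_Kd hρ.smooth hρ.cpt
  have ikz : ∀ j, ∫ z, Kd (Kz ρ j) j z = 0 := fun j => int_Kd (kz j).smooth (kz j).cpt j
  have n0 : nc c 0 = 0 := by simp [nc]
  have tnc : ∀ j, ∀ x ∈ Wi i o, TT i.castSucc (nc c) ρ (Gψ j) x = - TT i.castSucc c (Kd ρ j) ψ x := fun j x hx =>
    TT_nc hio hψ hρ c hx j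
  have tncz : ∀ j, ∀ x ∈ Wi i o, TT i.castSucc (nc c) (Kz ρ j) (Gψ j) x = - TT i.castSucc c (Kd (Kz ρ j) j) ψ x := fun j x hx =>
    TT_nc hio hψ (kz j) c hx j
  have gt' : ∀ j, ∃ HT, Gd i o (fun x => TT i.castSucc c ρ (Gφ j) x + - TT i.castSucc c (Kd ρ j) ψ x) HT (Gφ j) (JG j) := fun j =>
    ⟨_, (gt j).congr hio (fun _ _ => rfl) (fun _ _ _ => rfl) (fun y => by simp [hc.c0, hρ1, ik]) (fun f => by simp [hc.c0, hρ1, ik])⟩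
  choose HT hT using gt'
  obtain ⟨HN, hN⟩ : ∃ HN, Gd i o (fun x => (TT i.castSucc (deriv c) ρ φ x + TT i.castSucc (deriv (nc c)) ρ ψ x) +
      ((TT i.castSucc c (Kz ρ 0) (Gφ 0) x + TT i.castSucc c (Kz ρ 1) (Gφ 1) x) +
       -(TT i.castSucc c (Kd (Kz ρ 0) 0) ψ x + TT i.castSucc c (Kd (Kz ρ 1) 1) ψ x))) HN ψ Jψ :=
    ⟨_, gn.congr hio (fun _ _ => rfl) (fun _ _ _ => rfl) (fun y => by simp [hc.c0, hc.d0, hc.nd0, hρ1, ikz, hρz])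
      (fun f => by simp [hc.c0, hc.d0, hc.nd0, hρ1, ikz, hρz])⟩
  refine ⟨cs3 i (fun x => (TT i.castSucc (deriv c) ρ φ x + TT i.castSucc (deriv (nc c)) ρ ψ x) +
      ((TT i.castSucc c (Kz ρ 0) (Gφ 0) x + TT i.castSucc c (Kz ρ 1) (Gφ 1) x) +
       -(TT i.castSucc c (Kd (Kz ρ 0) 0) ψ x + TT i.castSucc c (Kd (Kz ρ 1) 1) ψ x))) (fun x => TT i.castSucc c ρ (Gφ 0) x + - TT i.castSucc c (Kd ρ 0) ψ x) (fun x => TT i.castSucc c ρ (Gφ 1) x + - TT i.castSucc c (Kd ρ 1) ψ x),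
    cs3 i HN (HT 0) (HT 1), ?_, ?_, ?_, ?_⟩
  rotate_left
  · rw [cs3_n, cs3_n]
    exact hN
  · rw [Fin.forall_fin_two, cs3_0, cs3_0, cs3_1, cs3_1]
    exact ⟨hT 0, hT 1⟩
  · intro x hx d
    rcases cs3_ex i d with h | h | h
    · rw [h, cs3_n, hx _ _ _ r0, hx _ _ _ r0, hx _ _ _ (sz 0), hx _ _ _ (sz 1), hx _ _ _ (szd 0), hx _ _ _ (szd 1)]
      simp
    · rw [h, cs3_0, hx _ _ _ r0, hx _ _ _ (sd 0)]; simp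
    · rw [h, cs3_1, hx _ _ _ r0, hx _ _ _ (sd 1)]; simp
  · refine gz.congr hio (fun _ _ => rfl) ?_ (fun y => by simp [hc.c0, hρ1, n0]) (fun y => by simp [hc.c0, hρ1, n0])
    intro d x hx
    have q : ∀ a u v, TTD i.castSucc a ρ u v = cs3 i (TTD i.castSucc a ρ u v i.castSucc) (TT i.castSucc a ρ (v 0)) (TT i.castSucc a ρ (v 1)) := by
      intro a u v
      ext d x
      rw [TTD_i]
      simp only [TTD, cs3]
      split_ifs <;> rfl
    rcases cs3_ex i d with h | h | h
    · rw [h, cs3_n, TTD_i, TTD_i]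
      simp only [Fin.sum_univ_two]
      rw [tncz 0 x hx, tncz 1 x hx]; ring
    · rw [h, cs3_0, q c, q (nc c), cs3_0, cs3_0]
      rw [tnc 0 x hx]
    · rw [h, cs3_1, q c, q (nc c), cs3_1, cs3_1]
      rw [tnc 1 x hx]

end

section
/-! ### Part 12 : traces of continuous functions -/

open Filter Topology
open scoped ENNReal

lemma mem_closure_hplane {y : E2} (hy : 0 ≤ y 0) : y ∈ closure hplane := by
  have h1 : Tendsto (fun ε : ℝ => y + ε • stdb2 0) (𝓝[>] 0) (𝓝 y) := by
    have : ContinuousAt (fun ε : ℝ => y + ε • stdb2 0) 0 := by fun_prop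
    have h := this.tendsto
    simp only [zero_smul, add_zero] at h
    exact h.mono_left nhdsWithin_le_nhds
  refine mem_closure_of_tendsto h1 ?_
  filter_upwards [self_mem_nhdsWithin] with ε hε
  have : (0:ℝ) < ε := hε
  simp only [hplane, mem_ofPred_eq, PiLp.add_apply, PiLp.smul_apply, stdb2, smul_eq_mul]
  simp; linarith

/-- continuous extension -/
def uh (u : E2 → ℝ) (y : E2) : ℝ := u (in2 (max (y 0) 0, y 1))

lemma uh_eq {u : E2 → ℝ} {y : E2} (hy : 0 ≤ y 0) : uh u y = u y := by
  rw [uh, max_eq_left hy, in2_eq]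

lemma uh_cont {u : E2 → ℝ} (hu : ContinuousOn u (closure hplane)) : Continuous (uh u) := by
  have h1 : Continuous (fun y : E2 => in2 (max (y 0) 0, y 1)) := in2H.continuous.comp (by fun_prop)
  refine hu.comp_continuous h1 fun y => mem_closure_hplane ?_
  rw [in2_zero]; exact le_max_right _ _

def S1 (t : ℝ) : ℝ := smoothTransition (t - 1)

lemma S1_sm : ContDiff ℝ (⊤ : ℕ∞) S1 := smoothTransition.contDiff.comp (contDiff_id.sub contDiff_const)
lemma S1_zero {t : ℝ} (h : t ≤ 1) : S1 t = 0 := smoothTransition.zero_of_nonpos (by linarith)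
lemma S1_one {t : ℝ} (h : 2 ≤ t) : S1 t = 1 := smoothTransition.one_of_one_le (by linarith)
lemma S1_le (t : ℝ) : |S1 t| ≤ 1 := by
  unfold S1
  rw [abs_of_nonneg (smoothTransition.nonneg _)]; exact smoothTransition.le_one _
lemma dS1_cont : Continuous (deriv S1) := S1_sm.continuous_deriv (by simp)
lemma dS1_out {t : ℝ} (h : t ∉ Icc (1:ℝ) 2) : deriv S1 t = 0 := by
  rw [mem_Icc, not_and_or, not_le, not_le] at h
  rcases h with h | h
  · have : S1 =ᶠ[𝓝 t] fun _ => 0 := by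
      filter_upwards [Iio_mem_nhds h] with s hs using S1_zero (le_of_lt hs)
    rw [this.deriv_eq, deriv_const]
  · have : S1 =ᶠ[𝓝 t] fun _ => 1 := by
      filter_upwards [Ioi_mem_nhds h] with s hs using S1_one (le_of_lt hs)
    rw [this.deriv_eq, deriv_const]
lemma dS1_cpt : HasCompactSupport (deriv S1) := HasCompactSupport.intro isCompact_Icc fun t ht => dS1_out ht
lemma dS1_int : ∫ t in Ioi (0:ℝ), deriv S1 t = 1 := by
  rw [integral_Ioi_of_hasDerivAt_of_tendsto' (f := S1) (m := 1) (fun x _ => ((S1_sm.differentiable (by simp)) x).hasDerivAt)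
    ((dS1_cont.integrable_of_hasCompactSupport dS1_cpt).integrableOn) ?_, S1_zero (by norm_num)]
  · simp
  · refine tendsto_const_nhds.congr' ?_
    filter_upwards [eventually_ge_atTop 2] with t ht using (S1_one ht).symm

lemma hp_fubini {G : E2 → ℝ} (hG : IntegrableOn G hplane) : ∫ y in hplane, G y = ∫ n in Ioi (0:ℝ), ∫ r, G (in2 (n, r)) := by
  rw [← in2_mp.setIntegral_preimage_emb in2_emb, in2_pre_hplane, Measure.volume_eq_prod, setIntegral_prod]
  · simp
  · have := (in2_mp.integrableOn_comp_preimage in2_emb).2 hG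
    rw [in2_pre_hplane] at this
    exact this

lemma bdry_lim {G : E2 → ℝ} (hG : Continuous G) (hc : HasCompactSupport G) :
    Tendsto (fun ε : ℝ => ∫ y in hplane, G y * (ε⁻¹ * deriv S1 (ε⁻¹ * y 0))) (𝓝[>] 0) (𝓝 (∫ r, G (in2 (0, r)))) := by
  obtain ⟨R, hR⟩ := hc.isBounded.subset_closedBall (0 : E2)
  have hz : ∀ n r : ℝ, r ∉ Icc (-R) R → G (in2 (n, r)) = 0 := by
    intro n r hr
    by_contra h
    have h1 := hR (subset_tsupport G h)
    rw [mem_closedBall_zero_iff] at h1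
    have h2 := (PiLp.norm_apply_le (in2 (n,r)) 1).trans h1
    rw [in2_one, Real.norm_eq_abs, abs_le] at h2
    exact hr h2
  set h : ℝ → ℝ := fun n => ∫ r, G (in2 (n, r)) with hh
  have hcont : Continuous h := by
    have e : h = fun n => ∫ r in Icc (-R) R, G (in2 (n, r)) := by
      ext n
      exact (setIntegral_eq_integral_of_forall_compl_eq_zero fun r hr => hz n r hr).symm
    rw [e]
    exact continuous_parametric_integral_of_continuous (f := fun n r => G (in2 (n, r))) (hG.comp in2H.continuous) isCompact_Icc
  have key : ∀ ε : ℝ, 0 < ε → ∫ y in hplane, G y * (ε⁻¹ * deriv S1 (ε⁻¹ * y 0)) = ∫ t in Ioi (0:ℝ), h (ε * t) * deriv S1 t := by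
    intro ε hε
    rw [hp_fubini]
    · have := integral_comp_mul_left_Ioi (fun n => h n * deriv S1 (ε⁻¹ * n)) 0 hε
      simp only [mul_zero, smul_eq_mul] at this
      have e2 : ∀ t, ε⁻¹ * (ε * t) = t := fun t => by field_simp
      simp only [e2] at this
      rw [this, ← integral_const_mul]
      refine setIntegral_congr_fun measurableSet_Ioi fun n _ => ?_
      simp only [in2_zero]
      rw [integral_mul_const]; simp only [hh]; ring
    · refine Integrable.integrableOn (Continuous.integrable_of_hasCompactSupport ?_ hc.mul_right)
      have := dS1_cont
      fun_prop
  have hb : ∃ C, ∀ n ∈ Icc (0:ℝ) 2, ‖h n‖ ≤ C := isCompact_Icc.exists_bound_of_continuousOn hcont.continuousOn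
  obtain ⟨C, hC⟩ := hb
  have lim : Tendsto (fun ε : ℝ => ∫ t in Ioi (0:ℝ), h (ε * t) * deriv S1 t) (𝓝[>] 0) (𝓝 (∫ t in Ioi (0:ℝ), h 0 * deriv S1 t)) := by
    refine tendsto_integral_filter_of_dominated_convergence (fun t => C * |deriv S1 t|) ?_ ?_ ?_ ?_
    · refine Eventually.of_forall fun ε => Continuous.aestronglyMeasurable ?_
      have := dS1_cont
      fun_prop
    · filter_upwards [Ioo_mem_nhdsGT (zero_lt_one)] with ε hε
      refine Eventually.of_forall fun t => ?_
      by_cases ht : t ∈ Icc (1:ℝ) 2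
      · rw [norm_mul, Real.norm_eq_abs (deriv S1 t)]
        refine mul_le_mul_of_nonneg_right (hC _ ⟨?_, ?_⟩) (abs_nonneg _)
        · exact mul_nonneg hε.1.le (by linarith [ht.1])
        · nlinarith [hε.1, hε.2, ht.1, ht.2]
      · simp [dS1_out ht]
    · exact ((dS1_cont.integrable_of_hasCompactSupport dS1_cpt).integrableOn.abs).const_mul C
    · refine Eventually.of_forall fun t => ?_
      have : ContinuousAt (fun ε : ℝ => h (ε * t) * deriv S1 t) 0 := by fun_prop
      have h := this.tendsto
      simp only [zero_mul] at h
      exact h.mono_left nhdsWithin_le_nhds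
  rw [integral_const_mul, dS1_int, mul_one] at lim
  refine lim.congr' ?_
  filter_upwards [self_mem_nhdsWithin] with ε hε using (key ε hε).symm

lemma wk_cont_HPT {u : E2 → ℝ} {v : Fin 2 → E2 → ℝ} (hu : L2on hplane u) (hv : ∀ j, L2on hplane (v j))
    (hw : ∀ j, IsWeakD hplane u (v j) (EuclideanSpace.single j 1)) (hc : ContinuousOn u (closure hplane)) :
    HPT u v (fun f => ∫ t, u (EuclideanSpace.single 1 t) * f t) := by
  intro κ hκ hκc d
  have hintg := hp_integrable hκ hκc hu (hv d) d
  have huκ : Continuous (fun y => uh u y * κ y) := (uh_cont hc).mul hκ.continuous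
  have huκc : HasCompactSupport (fun y => uh u y * κ y) := hκc.mul_left
  -- the cut-off
  set X : ℝ → E2 → ℝ := fun ε y => S1 (ε⁻¹ * y 0) with hX
  have p0 : ContDiff ℝ (⊤ : ℕ∞) (fun y : E2 => y 0) := (EuclideanSpace.proj (𝕜 := ℝ) (0 : Fin 2)).contDiff
  have hXs : ∀ ε, ContDiff ℝ (⊤ : ℕ∞) (X ε) := fun ε => S1_sm.comp (contDiff_const.mul p0)
  have hXd : ∀ ε y, fderiv ℝ (X ε) y (stdb2 d) = if d = 0 then ε⁻¹ * deriv S1 (ε⁻¹ * y 0) else 0 := by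
    intro ε y
    have h1 : HasFDerivAt (fun y : E2 => ε⁻¹ * y 0) (ε⁻¹ • (EuclideanSpace.proj (𝕜 := ℝ) (0 : Fin 2))) y :=
      ((EuclideanSpace.proj (𝕜 := ℝ) (0 : Fin 2)).hasFDerivAt).const_mul ε⁻¹
    have h2 := (((S1_sm.differentiable (by simp)) (ε⁻¹ * y 0)).hasDerivAt).comp_hasFDerivAt y h1
    have h3 : fderiv ℝ (X ε) y = _ := h2.fderiv
    rw [h3]
    fin_cases d <;> simp [stdb2, mul_comm]
  have main : ∀ ε : ℝ, 0 < ε → (∫ y in hplane, X ε y * (u y * fderiv ℝ κ y (stdb2 d) + v d y * κ y)) +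
      (if d = 0 then ∫ y in hplane, (uh u y * κ y) * (ε⁻¹ * deriv S1 (ε⁻¹ * y 0)) else 0) = 0 := by
    intro ε hε
    have hs : ContDiff ℝ (⊤ : ℕ∞) (fun y => X ε y * κ y) := (hXs ε).mul hκ
    have hsc : HasCompactSupport (fun y => X ε y * κ y) := hκc.mul_left
    have hsub : tsupport (fun y => X ε y * κ y) ⊆ hplane := by
      have : tsupport (fun y => X ε y * κ y) ⊆ {y : E2 | ε ≤ y 0} := by
        refine closure_minimal ?_ (isClosed_le continuous_const p0.continuous)
        intro y hy
        by_contra hlt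
        simp only [mem_ofPred_eq, not_le] at hlt
        apply hy
        have : X ε y = 0 := S1_zero (by rw [inv_mul_le_iff₀ hε]; linarith)
        simp [this]
      exact fun y hy => lt_of_lt_of_le hε (this hy)
    have h := hw d _ hs hsc hsub
    have hd : ∀ y, fderiv ℝ (fun y => X ε y * κ y) y (stdb2 d) = X ε y * fderiv ℝ κ y (stdb2 d) + κ y * fderiv ℝ (X ε) y (stdb2 d) := by
      intro y
      have := (((hXs ε).differentiable (by simp)) y).hasFDerivAt.mul ((hκ.differentiable (by simp)) y).hasFDerivAt
      have h4 : fderiv ℝ (fun y => X ε y * κ y) y = _ := this.fderiv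
      rw [h4]; simp
    have h' : (∫ y in hplane, u y * fderiv ℝ (fun y => X ε y * κ y) y (stdb2 d)) + ∫ y in hplane, v d y * (X ε y * κ y) = 0 := by
      have : (EuclideanSpace.single d 1 : E2) = stdb2 d := rfl
      rw [this] at h
      linarith
    rw [← integral_add] at h'
    rotate_left
    · exact integrable_mul_test hu ((hs.continuous_fderiv (by simp)).clm_apply continuous_const) (hsc.fderiv_apply (𝕜 := ℝ) _)
    · exact integrable_mul_test (hv d) hs.continuous hsc
    have i1 : IntegrableOn (fun y => X ε y * (u y * fderiv ℝ κ y (stdb2 d) + v d y * κ y)) hplane := by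
      refine Integrable.bdd_mul (c := 1) hintg (hXs ε).continuous.aestronglyMeasurable (Eventually.of_forall fun y => ?_)
      exact S1_le _
    split_ifs with h0
    · subst h0
      rw [← integral_add i1]
      · rw [← h']
        refine setIntegral_congr_fun measurableSet_hplane fun y hy => ?_
        simp only [hd, hXd, if_true]
        rw [uh_eq (le_of_lt hy)]; ring
      · refine Integrable.integrableOn (Continuous.integrable_of_hasCompactSupport ?_ huκc.mul_right)
        have := dS1_cont
        fun_prop
    · rw [add_zero, ← h']
      refine setIntegral_congr_fun measurableSet_hplane fun y hy => ?_
      simp only [hd, hXd, h0, if_false]; ring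
  have l1 : Tendsto (fun ε : ℝ => ∫ y in hplane, X ε y * (u y * fderiv ℝ κ y (stdb2 d) + v d y * κ y)) (𝓝[>] 0)
      (𝓝 (∫ y in hplane, (u y * fderiv ℝ κ y (stdb2 d) + v d y * κ y))) := by
    refine tendsto_integral_filter_of_dominated_convergence (fun y => ‖u y * fderiv ℝ κ y (stdb2 d) + v d y * κ y‖) ?_ ?_ hintg.norm ?_
    · exact Eventually.of_forall fun ε => (hXs ε).continuous.aestronglyMeasurable.mul hintg.1
    · refine Eventually.of_forall fun ε => Eventually.of_forall fun y => ?_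
      rw [norm_mul]
      exact mul_le_of_le_one_left (norm_nonneg _) (S1_le _)
    · filter_upwards [ae_restrict_mem measurableSet_hplane] with y hy
      have hy' : 0 < y 0 := hy
      refine tendsto_const_nhds.congr' ?_
      filter_upwards [Ioo_mem_nhdsGT (half_pos hy')] with ε hε
      have : X ε y = 1 := S1_one (by rw [le_inv_mul_iff₀ hε.1]; linarith [hε.2])
      rw [this, one_mul]
  have l2 : Tendsto (fun ε : ℝ => if d = 0 then ∫ y in hplane, (uh u y * κ y) * (ε⁻¹ * deriv S1 (ε⁻¹ * y 0)) else 0) (𝓝[>] 0)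
      (𝓝 (if d = 0 then ∫ r, uh u (in2 (0, r)) * κ (in2 (0, r)) else 0)) := by
    split_ifs
    · exact bdry_lim huκ huκc
    · exact tendsto_const_nhds
  have l3 := (l1.add l2).congr' (f₂ := fun _ => (0:ℝ)) (by
    filter_upwards [self_mem_nhdsWithin] with ε hε using main ε hε)
  have := tendsto_nhds_unique l3 tendsto_const_nhds
  simp only [single_eq_in2]
  have e : ∀ r, uh u (in2 (0, r)) = u (in2 (0, r)) := fun r => uh_eq (by rw [in2_zero])
  simp only [e] at this
  linarith

end

section
/-! ### Part 13 : symmetry of second derivatives and tangential traces -/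

open Filter Topology
open scoped ENNReal

lemma Kd_comm {κ : E2 → ℝ} (h : ContDiff ℝ (⊤ : ℕ∞) κ) (i j : Fin 2) : Kd (Kd κ i) j = Kd (Kd κ j) i := by
  ext z
  have hd : DifferentiableAt ℝ (fderiv ℝ κ) z :=
    (h.fderiv_right (m := ((⊤ : ℕ∞) : WithTop ℕ∞)) (by simp)).differentiable (by simp) z
  have e : ∀ i j, Kd (Kd κ i) j z = fderiv ℝ (fderiv ℝ κ) z (stdb2 j) (stdb2 i) := by
    intro i j
    have h1 := hd.hasFDerivAt.clm_apply (hasFDerivAt_const (stdb2 i) z)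
    have h2 : fderiv ℝ (Kd κ i) z = _ := h1.fderiv
    rw [Kd, h2]; simp
  rw [e, e]
  have hs : IsSymmSndFDerivAt ℝ κ z := ((h.of_le (m := 2) (WithTop.coe_le_coe.2 (le_top : (2 : ℕ∞) ≤ ⊤))).contDiffAt).isSymmSndFDerivAt (by simp)
  exact hs _ _

lemma cpt_Kd {κ : E2 → ℝ} (hc : HasCompactSupport κ) (j : Fin 2) : HasCompactSupport (Kd κ j) := hc.fderiv_apply (𝕜 := ℝ) _

lemma weak_split {u v κ : E2 → ℝ} (hu : L2on hplane u) (hv : L2on hplane v) (hκ : ContDiff ℝ (⊤ : ℕ∞) κ) (hc : HasCompactSupport κ) (d : Fin 2) :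
    ∫ x in hplane, (u x * fderiv ℝ κ x (stdb2 d) + v x * κ x) = (∫ x in hplane, u x * Kd κ d x) + ∫ x in hplane, v x * κ x :=
  integral_add (integrable_mul_test hu (Kd_smooth hκ d).continuous (cpt_Kd hc d)) (integrable_mul_test hv hκ.continuous hc)

lemma hess_symm {φ : E2 → ℝ} {G : Fin 2 → E2 → ℝ} {H : Fin 2 → Fin 2 → E2 → ℝ} (h : MemH2W hplane φ G H) :
    H 0 1 =ᵐ[volume.restrict hplane] H 1 0 := by
  have hl : L2on hplane (fun x => H 0 1 x - H 1 0 x) := (h.2.2 0 1).1.sub (h.2.2 1 0).1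
  have hloc : LocallyIntegrableOn (fun x => H 0 1 x - H 1 0 x) hplane volume := by
    have := hl.locallyIntegrable (by norm_num)
    exact locallyIntegrableOn_of_locallyIntegrable_restrict this
  have key := isOpen_hplane.ae_eq_zero_of_integral_contDiff_smul_eq_zero hloc ?_
  · rw [Filter.EventuallyEq, ae_restrict_iff' measurableSet_hplane]
    filter_upwards [key] with x hx hxh
    linarith [hx hxh]
  · intro g hg hgc hgs
    have e : ∀ d d', ∫ x in hplane, H d d' x * g x = ∫ x in hplane, φ x * Kd (Kd g d') d x := by
      intro d d'
      have h1 := (h.2.2 d d').2 g hg hgc hgs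
      have h2 := (h.2.1 d).2 (Kd g d') (Kd_smooth hg d') (cpt_Kd hgc d') ((Kd_tsupport g d').trans hgs)
      have h3 : ∫ x in hplane, φ x * Kd (Kd g d') d x = - ∫ x in hplane, G d x * Kd g d' x := h2
      have h4 : ∫ x in hplane, G d x * Kd g d' x = - ∫ x in hplane, H d d' x * g x := h1
      linarith
    have e1 : ∫ x, g x • (H 0 1 x - H 1 0 x) = ∫ x in hplane, g x • (H 0 1 x - H 1 0 x) := by
      symm
      refine setIntegral_eq_integral_of_forall_compl_eq_zero fun x hx => ?_
      have : g x = 0 := image_eq_zero_of_notMem_tsupport fun h => hx (hgs h)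
      simp [this]
    rw [e1]
    have e2 : ∀ x, g x • (H 0 1 x - H 1 0 x) = H 0 1 x * g x - H 1 0 x * g x := fun x => by simp; ring
    simp only [e2]
    rw [integral_sub (integrable_mul_test (h.2.2 0 1).1 hg.continuous hgc) (integrable_mul_test (h.2.2 1 0).1 hg.continuous hgc), e, e,
      Kd_comm hg, sub_self]

lemma tang_trace {φ : E2 → ℝ} {G : Fin 2 → E2 → ℝ} {H : Fin 2 → Fin 2 → E2 → ℝ} (h : MemH2W hplane φ G H)
    {Jφ J0 J1 : (ℝ → ℝ) → ℝ} (hφ : HPT φ G Jφ) (h0 : HPT (G 0) (H 0) J0) (h1 : HPT (G 1) (H 1) J1)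
    {κ : E2 → ℝ} (hκ : ContDiff ℝ (⊤ : ℕ∞) κ) (hc : HasCompactSupport κ) :
    J1 (fun t => κ (EuclideanSpace.single 1 t)) = - Jφ (fun t => Kd κ 1 (EuclideanSpace.single 1 t)) := by
  have a1 := h1 κ hκ hc 0
  have a2 := h0 κ hκ hc 1
  have a3 := hφ (Kd κ 0) (Kd_smooth hκ 0) (cpt_Kd hc 0) 1
  have a4 := hφ (Kd κ 1) (Kd_smooth hκ 1) (cpt_Kd hc 1) 0
  rw [weak_split (h.2.1 1).1 (h.2.2 1 0).1 hκ hc] at a1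
  rw [weak_split (h.2.1 0).1 (h.2.2 0 1).1 hκ hc] at a2
  rw [weak_split h.1 (h.2.1 1).1 (Kd_smooth hκ 0) (cpt_Kd hc 0), Kd_comm hκ] at a3
  rw [weak_split h.1 (h.2.1 0).1 (Kd_smooth hκ 1) (cpt_Kd hc 1)] at a4
  have e : ∫ x in hplane, H 0 1 x * κ x = ∫ x in hplane, H 1 0 x * κ x := by
    refine integral_congr_ae ?_
    filter_upwards [hess_symm h] with x hx
    rw [hx]
  simp only [if_true, one_ne_zero, if_false] at a1 a2 a3 a4
  linarith

lemma HPT.h1 {u : E2 → ℝ} {v : Fin 2 → E2 → ℝ} {J : (ℝ → ℝ) → ℝ} (h : HPT u v J) (hu : L2on hplane u) (hv : ∀ j, L2on hplane (v j))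
    (hJ : ∀ κ : E2 → ℝ, ContDiff ℝ (⊤ : ℕ∞) κ → HasCompactSupport κ → J (fun t => κ (EuclideanSpace.single 1 t)) = 0) : H1 univ u v := by
  refine ⟨hu, hv, fun κ hκ hc _ j => ?_⟩
  rw [h κ hκ hc j, hJ κ hκ hc]; simp

lemma wk_h1 {u : E2 → ℝ} {v : Fin 2 → E2 → ℝ} (hu : L2on hplane u) (hv : ∀ j, L2on hplane (v j))
    (hw : ∀ j, IsWeakD hplane u (v j) (EuclideanSpace.single j 1)) : H1 hplane u v := by
  refine ⟨hu, hv, fun κ hκ hc hs j => ?_⟩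
  rw [weak_split hu (hv j) hκ hc]
  have := hw j κ hκ hc hs
  have h2 : ∫ x in hplane, u x * Kd κ j x = - ∫ x in hplane, v j x * κ x := this
  linarith

end

section
/-! ### Part 14 : kernels -/

open Filter Topology
open scoped ENNReal

lemma ex_prof : ∃ c : ℝ → ℝ, Prof c := by
  let b : ContDiffBump (0 : ℝ) := ⟨1, 2, one_pos, by norm_num⟩
  refine ⟨b, b.contDiff, b.hasCompactSupport, b.eventuallyEq_one.self_of_nhds, ?_⟩
  rw [b.eventuallyEq_one.deriv_eq]
  simp

lemma ex_eta : ∃ η : E2 → ℝ, ContDiff ℝ (⊤ : ℕ∞) η ∧ HasCompactSupport η ∧ (∫ z, η z = 1) ∧ (∀ j, ∫ z : E2, z j * η z = 0) ∧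
    ∀ z, η z ≠ 0 → ‖z‖ ≤ 1 := by
  let b : ContDiffBump (0 : E2) := ⟨1/2, 1, by norm_num, by norm_num⟩
  refine ⟨b.normed volume, b.contDiff_normed, b.hasCompactSupport_normed, b.integral_normed, ?_, ?_⟩
  · intro j
    have h := integral_neg_eq_self (fun z : E2 => z j * b.normed volume z) volume
    have e : ∀ z : E2, (-z) j * b.normed volume (-z) = -(z j * b.normed volume z) := by
      intro z
      rw [b.normed_neg]; simp
    simp only [e] at h
    rw [integral_neg] at h
    linarith
  · intro z hz
    have : z ∈ Function.support (b.normed volume) := hz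
    rw [b.support_normed_eq] at this
    rw [mem_ball_zero_iff] at this
    exact le_of_lt this

lemma ex_rho {s : ℝ} (hs : |s| = 3) : ∃ ρ : E2 → ℝ, ContDiff ℝ (⊤ : ℕ∞) ρ ∧ HasCompactSupport ρ ∧ (∫ z, ρ z = 1) ∧ (∀ j, ∫ z : E2, Kz ρ j z = 0) ∧
    ∀ z ∈ tsupport ρ, 6 ≤ s * z 0 := by
  obtain ⟨η, h1, h2, h3, h4, h5⟩ := ex_eta
  set e : E2 := s • stdb2 0 with he
  have e0 : e 0 = s := by simp [he, stdb2]
  have sm : ∀ a : E2, ContDiff ℝ (⊤ : ℕ∞) (fun z => η (z - a)) := fun a => h1.comp (contDiff_id.sub contDiff_const)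
  have cp : ∀ a : E2, HasCompactSupport (fun z => η (z - a)) := fun a => h2.comp_homeomorph (Homeomorph.subRight a)
  have it : ∀ a : E2, Integrable (fun z => η (z - a)) := fun a => (sm a).continuous.integrable_of_hasCompactSupport (cp a)
  have itz : ∀ a : E2, ∀ j, Integrable (fun z : E2 => z j * η (z - a)) := fun a j => by
    refine Continuous.integrable_of_hasCompactSupport ?_ (cp a).mul_left
    have := (sm a).continuous
    fun_prop
  have i1 : ∀ a : E2, ∫ z, η (z - a) = 1 := fun a => by rw [integral_sub_right_eq_self (fun z => η z) a, h3]
  have i2 : ∀ a : E2, ∀ j, ∫ z : E2, z j * η (z - a) = a j := fun a j => by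
    have := integral_sub_right_eq_self (μ := (volume : Measure E2)) (fun z : E2 => (z j + a j) * η z) a
    have e1 : ∀ z : E2, ((z - a) j + a j) = z j := fun z => by simp
    simp only [e1] at this
    rw [this]
    have e2 : ∀ z : E2, (z j + a j) * η z = z j * η z + a j * η z := fun z => by ring
    simp only [e2]
    have q0 := itz 0 j
    have q1 := it 0
    simp only [sub_zero] at q0 q1
    rw [integral_add q0 (q1.const_mul _), integral_const_mul, h4, h3]; simp
  refine ⟨fun z => 2 * η (z - e) - η (z - (2:ℝ) • e), (contDiff_const.mul (sm _)).sub (sm _), ?_, ?_, ?_, ?_⟩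
  · exact (cp e).mul_left.sub (cp _)
  · rw [integral_sub ((it e).const_mul 2) (it _), integral_const_mul, i1, i1]; norm_num
  · intro j
    have e3 : ∀ z : E2, Kz (fun z => 2 * η (z - e) - η (z - (2:ℝ) • e)) j z = 2 * (z j * η (z - e)) - z j * η (z - (2:ℝ) • e) := fun z => by
      simp only [Kz]; ring
    simp only [e3]
    rw [integral_sub ((itz e j).const_mul 2) (itz _ j), integral_const_mul, i2, i2]; simp
  · intro z hz
    have hcl : IsClosed {z : E2 | 6 ≤ s * z 0} := isClosed_le continuous_const (by fun_prop)
    refine closure_minimal ?_ hcl hz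
    intro z hz
    have ss : s * s = 9 := by rw [← abs_mul_abs_self s, hs]; norm_num
    have key : ∀ a : E2, η (z - a) ≠ 0 → s * a 0 - 3 ≤ s * z 0 := by
      intro a ha
      have := (PiLp.norm_apply_le (z - a) 0).trans (h5 _ ha)
      simp only [PiLp.sub_apply, Real.norm_eq_abs] at this
      have h6 : |s * (z 0 - a 0)| ≤ 3 := by rw [abs_mul, hs]; linarith
      have := (abs_le.1 h6).1
      linarith
    have : η (z - e) ≠ 0 ∨ η (z - (2:ℝ) • e) ≠ 0 := by
      by_contra hh
      push Not at hh
      apply hz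
      simp [hh.1, hh.2]
    rcases this with h | h
    · have := key _ h
      rw [e0] at this
      show 6 ≤ s * z 0
      linarith
    · have := key _ h
      simp only [PiLp.smul_apply, e0, smul_eq_mul] at this
      show 6 ≤ s * z 0
      nlinarith

end

section
/-! ### Part 15 : continuity up to the boundary -/

open Filter Topology
open scoped ENNReal

lemma nAA_bound {u K : E2 → ℝ} (hu : L2on hplane u) (hK : Continuous K) (hKc : HasCompactSupport K) :
    ∃ (f : E2 → ℝ≥0∞) (C : ℝ≥0∞) (R : ℝ), ∫⁻ w, f w ≠ ∞ ∧ C ≠ ∞ ∧ 0 ≤ R ∧ ∀ (y : E2) (n : ℝ), 0 < n →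
      ‖n * AA K u y n‖ₑ ^ 2 ≤ C * ∫⁻ w in Metric.closedBall y (n * R), f w := by
  obtain ⟨f, hfm, hf2, -, hf⟩ := AA_rep hu
  obtain ⟨M, hM⟩ := hK.bounded_above_of_compact_support hKc
  have hM0 : 0 ≤ M := (norm_nonneg _).trans (hM 0)
  obtain ⟨R, hR0, hR⟩ : ∃ R : ℝ, 0 ≤ R ∧ ∀ z, K z ≠ 0 → ‖z‖ ≤ R := by
    obtain ⟨R, hR⟩ := (Metric.isBounded_iff_subset_closedBall (0 : E2)).1 hKc.isCompact.isBounded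
    refine ⟨max R 0, le_max_right _ _, fun z hz => ?_⟩
    have := hR (subset_tsupport _ hz)
    simp at this
    exact this.trans (le_max_left _ _)
  refine ⟨fun w => ‖f w‖ₑ ^ 2, ENNReal.ofReal (M * R) ^ 2 * ENNReal.ofReal π, R, (memLp2_iff.1 hf2).2.ne, by finiteness, hR0, ?_⟩
  intro y n hn
  set S := Metric.closedBall y (n * R)
  have e1 : n * AA K u y n = ∫ w, f w * (n⁻¹ * K (-(n⁻¹ • (y - w)))) := by
    rw [hf K y n hn, conv_scale K _ y hn, ← integral_const_mul]
    congr 1; ext w; simp only [RCLike.ofReal_real_eq_id, id]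
    have : n * (n ^ 2)⁻¹ = n⁻¹ := by field_simp
    rw [← this]; ring
  have e2 : ‖n * AA K u y n‖ₑ ≤ ENNReal.ofReal (n⁻¹ * M) * ∫⁻ w in S, 1 * ‖f w‖ₑ := by
    rw [e1]
    refine (enorm_integral_le_lintegral_enorm _).trans ?_
    rw [← lintegral_const_mul _ (by fun_prop), ← lintegral_indicator Metric.isClosed_closedBall.measurableSet]
    refine lintegral_mono fun w => ?_
    by_cases hw : w ∈ S
    · rw [indicator_of_mem hw, enorm_mul, one_mul, mul_comm]
      gcongr
      rw [← ofReal_norm]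
      apply ENNReal.ofReal_le_ofReal
      rw [norm_mul, Real.norm_of_nonneg (by positivity : 0 ≤ n⁻¹)]
      gcongr
      exact hM _
    · rw [indicator_of_notMem hw]
      have : K (-(n⁻¹ • (y - w))) = 0 := by
        by_contra h
        have := hR _ h
        apply hw
        rw [norm_neg, norm_smul, Real.norm_of_nonneg (by positivity : 0 ≤ n⁻¹)] at this
        simp only [S, Metric.mem_closedBall, dist_comm w y, dist_eq_norm]
        rwa [inv_mul_le_iff₀ hn] at this
      simp [this]
  have e3 := cs_weight (μ := volume.restrict S) (k := fun _ => 1) (f := fun w => ‖f w‖ₑ) (by fun_prop) (by fun_prop)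
  simp only [lintegral_one, Measure.restrict_apply_univ] at e3
  have e4 : volume S = ENNReal.ofReal (n * R) ^ 2 * ENNReal.ofReal π := by
    simp only [S]; rw [EuclideanSpace.volume_closedBall_fin_two]
  calc _ ≤ (ENNReal.ofReal (n⁻¹ * M) * ∫⁻ w in S, 1 * ‖f w‖ₑ) ^ 2 := by gcongr
    _ ≤ ENNReal.ofReal (n⁻¹ * M) ^ 2 * (volume S * ∫⁻ w in S, 1 * ‖f w‖ₑ ^ 2) := by rw [mul_pow]; gcongr
    _ = _ := by
      rw [e4, ← mul_assoc, ← mul_assoc, ← mul_pow, ← ENNReal.ofReal_mul (by positivity)]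
      simp only [one_mul]
      congr 4
      field_simp

def Cw : Set E3 := {x | 0 ≤ x 0 ∧ 0 ≤ x 1}

lemma TT_cont2 (i : Fin 2) {c : ℝ → ℝ} (hc : Continuous c) {u K : E2 → ℝ} (hu : L2on hplane u) (hK : ContDiff ℝ (⊤ : ℕ∞) K) (hKc : HasCompactSupport K) :
    ContinuousOn (TT i.castSucc (nc c) K u) Cw := by
  intro x hx
  have hC : ∀ x ∈ Cw, 0 ≤ x i.castSucc := by intro x hx; fin_cases i; exacts [hx.1, hx.2]
  rcases (hC x hx).lt_or_eq with h | h
  · exact ((TT_continuousOn i.castSucc (a := nc c) (by unfold nc; fun_prop) hu hK hKc).continuousAt ((isOpen_W _).mem_nhds h)).continuousWithinAt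
  obtain ⟨f, C, R, hf, hCt, hR, hb⟩ := nAA_bound hu hK.continuous hKc
  have h0 : TT i.castSucc (nc c) K u x = 0 := by simp [TT, nc, ← h]
  rw [ContinuousWithinAt, h0]
  have hcx : Tendsto (fun x : E3 => c (x i.castSucc)) (𝓝[Cw] x) (𝓝 (c (x i.castSucc))) := by
    apply Continuous.continuousWithinAt; fun_prop
  have key : Tendsto (fun x : E3 => x i.castSucc * AA K u (py i.castSucc x) (x i.castSucc)) (𝓝[Cw] x) (𝓝 0) := by
    have hv : Tendsto (fun x : E3 => volume (Metric.closedBall (py i.castSucc x) (x i.castSucc * R))) (𝓝[Cw] x) (𝓝 0) := by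
      simp only [EuclideanSpace.volume_closedBall_fin_two]
      have : Tendsto (fun x : E3 => ENNReal.ofReal (x i.castSucc * R)) (𝓝[Cw] x) (𝓝 (ENNReal.ofReal (x i.castSucc * R))) := by
        apply Continuous.continuousWithinAt; exact ENNReal.continuous_ofReal.comp (by fun_prop)
      rw [← h, zero_mul, ENNReal.ofReal_zero] at this
      have h2 := ENNReal.Tendsto.mul_const (b := ENNReal.ofReal π) (ENNReal.Tendsto.pow (n := 2) this) (Or.inr (by simp))
      simpa using h2
    have h1 := tendsto_setLIntegral_zero hf hv
    have h2 := ENNReal.Tendsto.const_mul (a := C) h1 (Or.inr hCt)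
    rw [mul_zero] at h2
    have h3 : Tendsto (fun x : E3 => ‖x i.castSucc * AA K u (py i.castSucc x) (x i.castSucc)‖ₑ ^ 2) (𝓝[Cw] x) (𝓝 0) := by
      refine tendsto_of_tendsto_of_tendsto_of_le_of_le' tendsto_const_nhds h2 (Eventually.of_forall fun _ => zero_le) ?_
      filter_upwards [self_mem_nhdsWithin] with z hz
      rcases (hC z hz).lt_or_eq with h | h
      · exact hb _ _ h
      · rw [← h]; simp
    have h4 := (ENNReal.continuous_rpow_const (y := 1/2)).tendsto 0 |>.comp h3
    simp only [Function.comp_def] at h4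
    rw [ENNReal.zero_rpow_of_pos (by norm_num)] at h4
    rw [tendsto_zero_iff_enorm_tendsto_zero]
    refine h4.congr fun z => ?_
    rw [← ENNReal.rpow_natCast, ← ENNReal.rpow_mul]; norm_num
  have := hcx.mul key
  rw [mul_zero] at this
  refine this.congr fun z => ?_
  simp only [TT, nc]; ring

lemma TT_cont1 (i : Fin 3) {c : ℝ → ℝ} (hc : Continuous c) {u g K : E2 → ℝ} (hg : Continuous g) (hK : Continuous K) (hKc : HasCompactSupport K)
    {C : Set E3} (h : ∀ x ∈ C, ∀ z, K z ≠ 0 → uz u (py i x + x i • z) = g (py i x + x i • z)) :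
    ContinuousOn (TT i c K u) C := by
  have hp := continuous_py i
  have h1 : Continuous (fun x : E3 => c (x i) * ∫ z in tsupport K, K z * g (py i x + x i • z)) := by
    refine Continuous.mul (by fun_prop) ?_
    refine continuous_parametric_integral_of_continuous ?_ hKc
    fun_prop
  refine h1.continuousOn.congr fun x hx => ?_
  simp only [TT, AA]
  congr 1
  rw [setIntegral_eq_integral_of_forall_compl_eq_zero]
  · congr 1; ext z
    by_cases hz : K z = 0
    · simp [hz]
    · rw [h x hx z hz]
  · intro z hz
    rw [image_eq_zero_of_notMem_tsupport hz, zero_mul]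

lemma AA_zero (K u : E2 → ℝ) {y : E2} (hy : 0 ≤ y 0) : AA K u y 0 = (∫ z, K z) * u y := by
  simp [AA, uz, indicator, hy, integral_mul_const]

lemma closure_wedge : closure wedge ⊆ Cw := by
  refine closure_minimal (fun x hx => ⟨hx.1.le, hx.2.le⟩) ?_
  exact (isClosed_le (f := fun _ : E3 => (0:ℝ)) (g := fun x : E3 => x 0) continuous_const (by fun_prop)).inter
    (isClosed_le (f := fun _ : E3 => (0:ℝ)) (g := fun x : E3 => x 1) continuous_const (by fun_prop))

end

section
/-! ### Part 16 : assembly -/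

open Filter Topology
open scoped ENNReal

lemma face_sum {F1 F2 : E3 → ℝ} {D1 D2 : Fin 3 → E3 → ℝ} {b0 b1 : E2 → ℝ} {J1 J2 : (ℝ → ℝ) → ℝ}
    (h1 : Gd 1 0 F1 D1 b1 J1) (h2 : Gd 0 1 F2 D2 (fun y => b0 y + - F1 (embFace 0 y)) J2)
    (h : ∀ y ∈ hplane, F2 (embFace 1 y) = 0) :
    Good (fun x => F1 x + F2 x) (fun d x => D1 d x + D2 d x) ![b0, b1] := by
  refine (h1.good.add h2.good).congr (fun _ _ => rfl) (fun _ _ _ => rfl) ?_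
  intro i
  filter_upwards [ae_restrict_mem measurableSet_hplane] with y hy
  fin_cases i
  · simp
  · have := h y hy
    simp [this]

lemma resid {u b : E2 → ℝ} {F : E3 → ℝ} {DF : Fin 3 → E3 → ℝ} {v : Fin 2 → E2 → ℝ} {J J' : (ℝ → ℝ) → ℝ}
    (h : HPT u v J) (hu : L2on hplane u) (hv : ∀ j, L2on hplane (v j)) (h' : Gd 1 0 F DF b J')
    (hJ : ∀ κ : E2 → ℝ, ContDiff ℝ (⊤ : ℕ∞) κ → HasCompactSupport κ →
      J (fun t => κ (EuclideanSpace.single 1 t)) = J' (fun t => κ (EuclideanSpace.single 1 t))) :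
    H1 univ (fun y => u y + - F (embFace 0 y)) (fun m y => v m y + - DF ((0 : Fin 3).succAbove m) (embFace 0 y)) := by
  refine (h.add h'.hpt.neg hu (h'.sl (by decide)).neg hv (fun m => (h'.sd m).neg)).h1 (hu.add (h'.sl (by decide)).neg)
    (fun m => (hv m).add (h'.sd m).neg) ?_
  intro κ hκ hc
  rw [hJ κ hκ hc]; ring

lemma lift_val (i : Fin 3) {c : ℝ → ℝ} {ρ φ ψ : E2 → ℝ} (hc : Prof c) (hρ : ∫ z, ρ z = 1) {x : E3} (hx : x i = 0) (hy : 0 ≤ py i x 0) :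
    TT i c ρ φ x + TT i (nc c) ρ ψ x = φ (py i x) := by
  simp [TT, hx, nc, hc.c0, AA_zero _ _ hy, hρ]

lemma wedge_main
    (φ ψ : Fin 2 → E2 → ℝ)
    (Gφ : Fin 2 → Fin 2 → E2 → ℝ) (Hφ : Fin 2 → Fin 2 → Fin 2 → E2 → ℝ)
    (Gψ : Fin 2 → Fin 2 → E2 → ℝ)
    (bGφ : Fin 2 → Fin 2 → ℝ → ℝ) (bψ : Fin 2 → ℝ → ℝ)
    (hφ : ∀ i, MemH2W hplane (φ i) (Gφ i) (Hφ i))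
    (hφc : ∀ i, ContinuousOn (φ i) (closure hplane))
    (hψ : ∀ i, L2on hplane (ψ i) ∧ ∀ d, L2on hplane (Gψ i d) ∧
      IsWeakD hplane (ψ i) (Gψ i d) (stdb2 d))
    (hbGφ : ∀ i d, HPTrace (Gφ i d) (fun d' => Hφ i d d') (bGφ i d))
    (hbψ : ∀ i, HPTrace (ψ i) (Gψ i) (bψ i))
    (c1 : ∀ t : ℝ, φ 0 (EuclideanSpace.single 1 t) = φ 1 (EuclideanSpace.single 1 t))
    (c2 : ∀ᵐ t : ℝ, bψ 0 t = bGφ 1 0 t)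
    (c3 : ∀ᵐ t : ℝ, bψ 1 t = bGφ 0 0 t) :
    ∃ (ζ : E3 → ℝ) (Gζ : Fin 3 → E3 → ℝ) (Hζ : Fin 3 → Fin 3 → E3 → ℝ),
      Good ζ Gζ ![φ 0, φ 1] ∧ Good (Gζ 0) (Hζ 0) ![ψ 0, Gφ 1 0] ∧ Good (Gζ 1) (Hζ 1) ![Gφ 0 0, ψ 1] ∧
      Good (Gζ 2) (Hζ 2) ![Gφ 0 1, Gφ 1 1] ∧ ContinuousOn ζ (closure wedge) ∧
      (∀ y : E2, 0 ≤ y 0 → ζ (embFace 0 y) = φ 0 y) ∧ (∀ y : E2, 0 ≤ y 0 → ζ (embFace 1 y) = φ 1 y) := by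
  obtain ⟨c, hc⟩ := ex_prof
  obtain ⟨ρ, r1, r2, r3, r4, r5⟩ := ex_rho (s := 3) (by norm_num)
  obtain ⟨σ, s1, s2, s3, s4, s5⟩ := ex_rho (s := -3) (by norm_num)
  have hρ0 : ∀ z ∈ tsupport ρ, 1 ≤ z 0 := fun z hz => by linarith [r5 z hz]
  have hσ0 : ∀ z ∈ tsupport σ, z 0 < 0 := fun z hz => by linarith [s5 z hz]
  have kρ : KC hplane ρ := ⟨r1, r2, fun z hz y hy n hn => by
    have := hρ0 z hz
    have : 0 < n * z 0 := by positivity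
    simp only [hplane, mem_ofPred_eq, PiLp.add_apply, PiLp.smul_apply, smul_eq_mul]
    linarith⟩
  have kσ : KC univ σ := ⟨s1, s2, fun _ _ _ _ _ _ => mem_univ _⟩
  -- the data
  have tφ : ∀ i, HPT (φ i) (Gφ i) (fun f => ∫ t, φ i (EuclideanSpace.single 1 t) * f t) := fun i =>
    wk_cont_HPT (hφ i).1 (fun j => ((hφ i).2.1 j).1) (fun j => ((hφ i).2.1 j).2) (hφc i)
  have tG : ∀ i d, HPT (Gφ i d) (Hφ i d) (fun f => ∫ t, bGφ i d t * f t) := fun i d => hbGφ i d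
  have tψ : ∀ i, HPT (ψ i) (Gψ i) (fun f => ∫ t, bψ i t * f t) := fun i => hbψ i
  have hom : ∀ (b : ℝ → ℝ) (c : ℝ) (f : ℝ → ℝ), ∫ t, b t * (c * f t) = c * ∫ t, b t * f t := fun b c f => by
    rw [← integral_const_mul]; congr 1; ext t; ring
  have h1φ := wk_h1 (hφ 1).1 (fun j => ((hφ 1).2.1 j).1) (fun j => ((hφ 1).2.1 j).2)
  have h1G := fun d => wk_h1 ((hφ 1).2.1 d).1 (fun j => ((hφ 1).2.2 d j).1) (fun j => ((hφ 1).2.2 d j).2)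
  have h1ψ := wk_h1 (hψ 1).1 (fun j => ((hψ 1).2 j).1) (fun j => ((hψ 1).2 j).2)
  have bin := base_in hρ0
  -- first lift
  obtain ⟨G1, H1', g1, g1n, g1t, -⟩ := lift (i := 1) (o := 0) (by decide) hc kρ r3 r4 (φ := φ 1) (ψ := ψ 1) (Gφ := Gφ 1) (Gψ := Gψ 1) (Hφ := Hφ 1) h1ψ
    (fun a K ha hac hK hs => bin a K _ _ _ ha hac hK hs ⟨h1φ, tφ 1, hom _⟩)
    (fun a K ha hac hK hs => bin a K _ _ _ ha hac hK hs ⟨h1ψ, tψ 1, hom _⟩)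
    (fun d a K ha hac hK hs => bin a K _ _ _ ha hac hK hs ⟨h1G d, tG 1 d, hom _⟩)
  have g1t0 := g1t 0
  have g1t1 := g1t 1
  clear g1t
  change Gd 1 0 (G1 1) (H1' 1) _ _ at g1n
  change Gd 1 0 (G1 0) (H1' 0) _ _ at g1t0
  change Gd 1 0 (G1 2) (H1' 2) _ _ at g1t1
  set ζ1 : E3 → ℝ := fun x => TT (1 : Fin 2).castSucc c ρ (φ 1) x + TT (1 : Fin 2).castSucc (nc c) ρ (ψ 1) x with hζ1
  -- residuals
  have Rφ := resid (tφ 0) (hφ 0).1 (fun j => ((hφ 0).2.1 j).1) g1 (fun κ _ _ => by simp only [c1])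
  have RG0 := resid (tG 0 0) ((hφ 0).2.1 0).1 (fun j => ((hφ 0).2.2 0 j).1) g1n (fun κ _ _ => by
    refine integral_congr_ae ?_
    filter_upwards [c3] with t ht
    rw [ht])
  have RG1 := resid (tG 0 1) ((hφ 0).2.1 1).1 (fun j => ((hφ 0).2.2 1 j).1) g1t1 (fun κ hκ hκc => by
    rw [tang_trace (hφ 0) (tφ 0) (tG 0 0) (tG 0 1) hκ hκc, tang_trace (hφ 1) (tφ 1) (tG 1 0) (tG 1 1) hκ hκc]
    simp only [c1])
  have Rψ := resid (tψ 0) (hψ 0).1 (fun j => ((hψ 0).2 j).1) g1t0 (fun κ _ _ => by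
    refine integral_congr_ae ?_
    filter_upwards [c2] with t ht
    rw [ht])
  have sA0 : (0 : Fin 3).succAbove (0 : Fin 2) = 1 := rfl
  have sA1 : (0 : Fin 3).succAbove (1 : Fin 2) = 2 := rfl
  -- second lift
  obtain ⟨G2, H2, g2, g2n, g2t, g2z⟩ := lift (i := 0) (o := 1) (by decide) hc kσ s3 s4
    (φ := fun y => φ 0 y + - ζ1 (embFace 0 y)) (ψ := fun y => ψ 0 y + - G1 0 (embFace 0 y))
    (Gφ := fun m y => Gφ 0 m y + - G1 ((0 : Fin 3).succAbove m) (embFace 0 y))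
    (Hφ := fun d m y => Hφ 0 d m y + - H1' ((0 : Fin 3).succAbove d) ((0 : Fin 3).succAbove m) (embFace 0 y))
    (Jφ := fun _ => 0) (Jψ := fun _ => 0) (JG := fun _ _ => 0) Rψ
    (fun a K ha hac hK hs => base_out' hσ0 (fun _ => rfl) ha hac hK hs Rφ)
    (fun a K ha hac hK hs => base_out' hσ0 (fun _ => rfl) ha hac hK hs Rψ)
    (fun d a K ha hac hK hs => base_out' hσ0 (fun _ => rfl) ha hac hK hs (by
      revert d
      rw [Fin.forall_fin_two]
      exact ⟨RG0, RG1⟩))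
  have g2t0 := g2t 0
  have g2t1 := g2t 1
  clear g2t
  change Gd 0 1 (G2 0) (H2 0) _ _ at g2n
  change Gd 0 1 (G2 1) (H2 1) (fun y => Gφ 0 0 y + - G1 1 (embFace 0 y)) _ at g2t0
  change Gd 0 1 (G2 2) (H2 2) (fun y => Gφ 0 1 y + - G1 2 (embFace 0 y)) _ at g2t1
  set φt : E2 → ℝ := fun y => φ 0 y + - ζ1 (embFace 0 y) with hφt
  set ψt : E2 → ℝ := fun y => ψ 0 y + - G1 0 (embFace 0 y) with hψt
  have out : ∀ y ∈ hplane, ∀ (a : ℝ → ℝ) (K u : E2 → ℝ), tsupport K ⊆ tsupport σ → TT (0 : Fin 2).castSucc a K u (embFace 1 y) = 0 :=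
    fun y hy a K u hs => TT_out (fun z hz => hσ0 z (hs (subset_tsupport _ hz))) hy
  have z2 : ∀ d, ∀ y ∈ hplane, G2 d (embFace 1 y) = 0 := fun d y hy => g2z _ (out y hy) d
  -- continuity
  have cont1 : ContinuousOn ζ1 Cw := by
    refine ContinuousOn.add (TT_cont1 _ hc.sm.continuous (uh_cont (hφc 1)) r1.continuous r2 ?_) (TT_cont2 1 hc.sm.continuous (hψ 1).1 r1 r2)
    intro x hx z hz
    have h0 : 0 ≤ (py (1 : Fin 2).castSucc x + x (1 : Fin 2).castSucc • z) 0 := by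
      have e1 : 1 ≤ z 0 := hρ0 z (subset_tsupport _ hz)
      have e2 : 0 ≤ x 1 := hx.2
      have e3 : 0 ≤ x 0 := hx.1
      have : py (1 : Fin 2).castSucc x 0 = x 0 := by rw [py_apply]; rfl
      simp only [PiLp.add_apply, PiLp.smul_apply, smul_eq_mul, this]
      have : 0 ≤ x 1 * z 0 := by positivity
      exact add_nonneg e3 this
    rw [uh_eq h0]
    exact indicator_of_mem (s := {y : E2 | 0 ≤ y 0}) h0 _
  have embC : ∀ y : E2, 0 ≤ y 0 → embFace 0 y ∈ Cw := fun y hy => by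
    refine ⟨by rw [embFace_same], ?_⟩
    have := embFace_succAbove 0 y 0
    rw [sA0] at this
    rwa [this]
  have clh : ∀ y ∈ closure hplane, 0 ≤ y 0 := by
    have : closure hplane ⊆ {y : E2 | 0 ≤ y 0} := closure_minimal (fun y hy => by
      have h : 0 < y 0 := hy
      exact h.le)
      (isClosed_le (f := fun _ : E2 => (0:ℝ)) (g := fun y : E2 => y 0) continuous_const (by fun_prop))
    exact fun y hy => this hy
  have contφt : ContinuousOn φt (closure hplane) := by
    refine (hφc 0).add (ContinuousOn.neg ?_)
    exact cont1.comp (continuous_embFace 0).continuousOn (fun y hy => embC y (clh y hy))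
  have v1 : ∀ y : E2, 0 ≤ y 0 → ζ1 (embFace 1 y) = φ 1 y := fun y hy => by
    have := lift_val (1 : Fin 3) (φ := φ 1) (ψ := ψ 1) hc r3 (x := embFace 1 y) (embFace_same _ _) (by rwa [py_embFace])
    rw [py_embFace] at this
    exact this
  have edge : ∀ y : E2, y 0 = 0 → embFace 0 y = embFace 1 y := fun y hy => by
    ext j
    have a0 := embFace_same 0 y
    have a1 := embFace_succAbove 0 y 0
    have a2 := embFace_succAbove 0 y 1
    have b0 := embFace_same 1 y
    have b1 := embFace_succAbove 1 y 0
    have b2 := embFace_succAbove 1 y 1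
    rw [sA0] at a1
    rw [sA1] at a2
    rw [show (1 : Fin 3).succAbove (0 : Fin 2) = 0 from rfl] at b1
    rw [show (1 : Fin 3).succAbove (1 : Fin 2) = 2 from rfl] at b2
    fin_cases j
    · exact a0.trans (b1.trans hy).symm
    · exact (a1.trans hy).trans b0.symm
    · exact a2.trans b2.symm
  have sing : ∀ y : E2, y 0 = 0 → y = EuclideanSpace.single 1 (y 1) := fun y hy => by
    ext j; fin_cases j <;> simp [hy]
  have φt0 : ∀ y : E2, y 0 = 0 → φt y = 0 := fun y hy => by
    simp only [hφt]
    rw [edge y hy, v1 y hy.ge, sing y hy, c1]; ring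
  have uzφ : ∀ y, uz φt y = uh φt y := fun y => by
    rcases le_or_gt 0 (y 0) with h | h
    · rw [uh_eq h]; simp [uz, indicator, h]
    · rw [uh, φt0 _ (by rw [in2_zero, max_eq_right h.le])]
      simp [uz, indicator, h]
  have cont2 : ContinuousOn (fun x => TT (0 : Fin 2).castSucc c σ φt x + TT (0 : Fin 2).castSucc (nc c) σ ψt x) Cw :=
    ContinuousOn.add (TT_cont1 _ hc.sm.continuous (uh_cont contφt) s1.continuous s2 (fun x _ z _ => uzφ _))
      (TT_cont2 0 hc.sm.continuous Rψ.l2u s1 s2)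
  refine ⟨fun x => ζ1 x + (TT (0 : Fin 2).castSucc c σ φt x + TT (0 : Fin 2).castSucc (nc c) σ ψt x), fun d x => G1 d x + G2 d x,
    fun d d' x => H1' d d' x + H2 d d' x, ?_, ?_, ?_, ?_, ?_, ?_, ?_⟩
  · refine face_sum g1 g2 fun y hy => ?_
    rw [out y hy _ _ _ subset_rfl, out y hy _ _ _ subset_rfl, add_zero]
  · exact face_sum g1t0 g2n (z2 0)
  · exact face_sum g1n g2t0 (z2 1)
  · exact face_sum g1t1 g2t1 (z2 2)
  · exact (cont1.add cont2).mono closure_wedge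
  · intro y hy
    have := lift_val (0 : Fin 3) (φ := φt) (ψ := ψt) hc s3 (x := embFace 0 y) (embFace_same _ _) (by rwa [py_embFace])
    rw [py_embFace] at this
    have h2 : TT (0 : Fin 2).castSucc c σ φt (embFace 0 y) + TT (0 : Fin 2).castSucc (nc c) σ ψt (embFace 0 y) = φt y := this
    simp only [h2]
    simp only [hφt]; ring
  · intro y hy
    simp only
    rw [v1 y hy]
    rcases hy.lt_or_eq with h | h
    · rw [out y h _ _ _ subset_rfl, out y h _ _ _ subset_rfl]; ring
    · have e := edge y h.symm
      have := lift_val (0 : Fin 3) (φ := φt) (ψ := ψt) hc s3 (x := embFace 0 y) (embFace_same _ _) (by rwa [py_embFace])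
      rw [py_embFace, φt0 y h.symm, e] at this
      have h2 : TT (0 : Fin 2).castSucc c σ φt (embFace 1 y) + TT (0 : Fin 2).castSucc (nc c) σ ψt (embFace 1 y) = 0 := this
      rw [h2, add_zero]

end

open scoped Fin.NatCast

theorem wedge_inverse_trace
    (φ ψ : Fin 2 → E2 → ℝ)
    (Gφ : Fin 2 → Fin 2 → E2 → ℝ) (Hφ : Fin 2 → Fin 2 → Fin 2 → E2 → ℝ)
    (Gψ : Fin 2 → Fin 2 → E2 → ℝ)
    (bGφ : Fin 2 → Fin 2 → ℝ → ℝ) (bψ : Fin 2 → ℝ → ℝ)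
    -- (φᵢ, ψᵢ) ∈ H²(ℝ₊×ℝ) × H¹(ℝ₊×ℝ), with continuous representatives of φᵢ,
    -- and with boundary traces of ∇φᵢ and ψᵢ on the boundary line
    (hφ : ∀ i, MemH2W hplane (φ i) (Gφ i) (Hφ i))
    (hφc : ∀ i, ContinuousOn (φ i) (closure hplane))
    (hψ : ∀ i, L2on hplane (ψ i) ∧ ∀ d, L2on hplane (Gψ i d) ∧
      IsWeakD hplane (ψ i) (Gψ i d) (stdb2 d))
    (hbGφ : ∀ i d, HPTrace (Gφ i d) (fun d' => Hφ i d d') (bGφ i d))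
    (hbψ : ∀ i, HPTrace (ψ i) (Gψ i) (bψ i))
    -- compatibility conditions along the common edge x₁ = x₂ = 0
    (c1 : ∀ t : ℝ, φ 0 (EuclideanSpace.single 1 t) = φ 1 (EuclideanSpace.single 1 t))
    (c2 : ∀ᵐ t : ℝ, bψ 0 t = bGφ 1 0 t)
    (c3 : ∀ᵐ t : ℝ, bψ 1 t = bGφ 0 0 t) :
    ∃ (ζ : E3 → ℝ) (Gζ : Fin 3 → E3 → ℝ) (Hζ : Fin 3 → Fin 3 → E3 → ℝ)
      (B : Fin 3 → Fin 2 → E2 → ℝ),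
      -- ζ ∈ H^{5/2}(ℝ₊×ℝ₊×ℝ)
      MemH2W wedge ζ Gζ Hζ ∧ (∀ d d', GagH12 wedge (Hζ d d')) ∧
      ContinuousOn ζ (closure wedge) ∧
      -- ζ = φᵢ on the face {x_i = 0}, i = 1, 2
      (∀ i : Fin 2, ∀ y : E2, 0 ≤ y 0 → ζ (embFace i y) = φ i y) ∧
      -- the boundary gradient on the face {x_i = 0} has normal component ψᵢ and
      -- tangential components ∇φᵢ
      (∀ i : Fin 2, B (Fin.castSucc i) i = ψ i ∧
        ∀ m : Fin 2, B ((Fin.castSucc i : Fin 3).succAbove m) i = Gφ i m) ∧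
      (∀ d : Fin 3, WedgeTrace (Gζ d) (fun d' => Hζ d d') (B d)) := by
  obtain ⟨ζ, G, H, g, g0, g1, g2, hc, f0, f1⟩ := wedge_main φ ψ Gφ Hφ Gψ bGφ bψ hφ hφc hψ hbGφ hbψ c1 c2 c3
  have gg : ∀ d, Good (G d) (H d) ((![![ψ 0, Gφ 1 0], ![Gφ 0 0, ψ 1], ![Gφ 0 1, Gφ 1 1]] : Fin 3 → Fin 2 → E2 → ℝ) d) := by
    intro d
    fin_cases d
    · exact g0
    · exact g1
    · exact g2
  refine ⟨ζ, G, H, ![![ψ 0, Gφ 1 0], ![Gφ 0 0, ψ 1], ![Gφ 0 1, Gφ 1 1]], ?_, ?_, hc, ?_, ?_, ?_⟩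
  · exact ⟨g.l2, fun d => ⟨g.l2d d, g.weak d⟩, fun d d' => ⟨(gg d).l2d d', (gg d).weak d'⟩⟩
  · exact fun d d' => (gg d).gag d'
  · intro i y hy
    fin_cases i
    · exact f0 y hy
    · exact f1 y hy
  · intro i
    fin_cases i
    · refine ⟨rfl, fun m => ?_⟩
      fin_cases m <;> rfl
    · refine ⟨rfl, fun m => ?_⟩
      fin_cases m <;> rfl
  · exact fun d => (gg d).tr
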